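/- For activated random walk on ℤ² with simple symmetric nearest-neighbor jumps, there exist a constant C > 0 and λ₀ > 1 such that for all λ ≥ λ₀, 1 − ρ_c(ℤ², λ) ≤ C/(λ · log λ); that is, ρ_c(ℤ², λ) = 1 − O((λ log λ)^{−1}) as λ → ∞. -/

import Mathlib

/-!
Common framework for the activated random walk (ARW) model on `ℤ^d`,
via the site-wise (Diaconis–Fulton) representation.
-/

open MeasureTheory ENNReal Filter

namespace ARW

noncomputable section
open scoped Classical

/-- A site of the lattice `ℤ^d`. -/
abbrev Site (d : ℕ) := Fin d → ℤ

/-- An instruction: `none` is a sleep instruction, `some z` is a jump instruction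
with displacement `z`. -/
abbrev Instr (d : ℕ) := Option (Site d)

instance (d : ℕ) : MeasurableSpace (Instr d) := ⊤

/-- The array of instruction stacks: `I (x, k)` is the `k`-th instruction at site `x`. -/
abbrev Stacks (d : ℕ) := Site d × ℕ → Instr d

/-- The state of a site: `active n` means `n` active particles (and no sleeping one),
`sleeping` means a single sleeping particle. -/
inductive SiteState : Type
  | active : ℕ → SiteState
  | sleeping : SiteState
  deriving DecidableEq

/-- A particle configuration. -/
abbrev Config (d : ℕ) := Site d → SiteState

/-- Number of active particles at a site state. -/
def numActive : SiteState → ℕ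
  | .active n => n
  | .sleeping => 0

/-- Adding one (active) particle to a site: a sleeping particle is reactivated. -/
def addParticle : SiteState → SiteState
  | .active n => .active (n + 1)
  | .sleeping => .active 2

/-- A state of the system: a configuration together with an odometer
(number of instructions already used at each site). -/
abbrev State (d : ℕ) := Config d × (Site d → ℕ)

/-- Initial state on `V` obtained from an all-active particle count `η` (particles
outside `V` are discarded), with odometer `0`. -/
def initState (d : ℕ) (V : Finset (Site d)) (η : Site d → ℕ) : State d :=
  (fun x => .active (if x ∈ V then η x else 0), fun _ => 0)

/-- Toppling the site `x` (inside `V`, particles jumping out of `V` are killed):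
the next unused instruction at `x` is executed and the odometer at `x` increases by one.
A sleep instruction puts the particle at `x` to sleep if it is alone (otherwise it has
no effect), and a jump instruction moves one particle from `x` to `x + z`
(reactivating a sleeping particle there), killing it if `x + z ∉ V`. -/
def topple {d : ℕ} (V : Finset (Site d)) (I : Stacks d) (x : Site d) (s : State d) :
    State d :=
  let σ := s.1
  let m := s.2
  let σ' : Config d :=
    match I (x, m x) with
    | none => if numActive (σ x) = 1 then Function.update σ x .sleeping else σ
    | some z =>
        let σ₁ := Function.update σ x (SiteState.active (numActive (σ x) - 1))
        if x + z ∈ V then Function.update σ₁ (x + z) (addParticle (σ₁ (x + z))) else σ₁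
  (σ', Function.update m x (m x + 1))

/-- Running a sequence of topplings. -/
def run {d : ℕ} (V : Finset (Site d)) (I : Stacks d) : State d → List (Site d) → State d
  | s, [] => s
  | s, x :: l => run V I (topple V I x s) l

/-- Legality of a toppling sequence: every toppled site lies in `V` and holds at least one
active particle when toppled. -/
def Legal {d : ℕ} (V : Finset (Site d)) (I : Stacks d) : State d → List (Site d) → Prop
  | _, [] => True
  | s, x :: l => x ∈ V ∧ 1 ≤ numActive (s.1 x) ∧ Legal V I (topple V I x s) l

/-- A configuration is stable in `V` if no site of `V` holds an active particle. -/
def Stable {d : ℕ} (V : Finset (Site d)) (σ : Config d) : Prop :=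
  ∀ x ∈ V, numActive (σ x) = 0

/-- The stabilization of `η` in `V` terminates. -/
def StabCompletes {d : ℕ} (V : Finset (Site d)) (I : Stacks d) (η : Site d → ℕ) : Prop :=
  ∃ l, Legal V I (initState d V η) l ∧ Stable V (run V I (initState d V η) l).1

/-- The stable configuration `Stab_V η` (well defined, independently of the chosen legal
toppling sequence, by the abelian property), when stabilization terminates. -/
def stabConfig {d : ℕ} (V : Finset (Site d)) (I : Stacks d) (η : Site d → ℕ) : Config d :=
  if h : StabCompletes V I η then (run V I (initState d V η) h.choose).1
  else fun _ => .active 0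

/-- The event `0 ∈ Stab_V η`: stabilization of `η` in `V` ends with a sleeping particle
at the origin. -/
def SleepAt0 {d : ℕ} (V : Finset (Site d)) (I : Stacks d) (η : Site d → ℕ) : Prop :=
  StabCompletes V I η ∧ stabConfig V I η 0 = .sleeping

/-- The event `0 ∉ Stab_V η`: stabilization of `η` in `V` ends with the origin empty. -/
def EmptyAt0 {d : ℕ} (V : Finset (Site d)) (I : Stacks d) (η : Site d → ℕ) : Prop :=
  StabCompletes V I η ∧ stabConfig V I η 0 ≠ .sleeping

/-- The limiting odometer of `η` at the origin: the supremum, over finite volumes `V` and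
legal toppling sequences in `V`, of the number of topplings performed at the origin. -/
def odom0 {d : ℕ} (I : Stacks d) (η : Site d → ℕ) : ℕ∞ :=
  ⨆ (V : Finset (Site d)) (l : List (Site d)) (_ : Legal V I (initState d V η) l),
    (l.count 0 : ℕ∞)

/-! ### The random instructions -/

/-- The normalized sleep rate `λ_s = λ/(1+λ)`. -/
def lamS (lam : ℝ) : ℝ := lam / (1 + lam)

/-- The normalized jump rate `λ_J = 1/(1+λ)`. -/
def lamJ (lam : ℝ) : ℝ := 1 / (1 + lam)

/-- The distribution of a single instruction: sleep with probability `λ_s`, jump by `z`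
with probability `λ_J · step z`. -/
def instrWeight {d : ℕ} (step : Site d → ℝ) (lam : ℝ) : Instr d → ℝ≥0∞
  | none => ENNReal.ofReal (lamS lam)
  | some z => ENNReal.ofReal (lamJ lam) * ENNReal.ofReal (step z)

/-- `μ` is the law of the i.i.d. instruction stacks: a probability measure whose
finite-dimensional cylinder probabilities are the products of the `instrWeight`s. -/
def IsStackLaw (d : ℕ) (step : Site d → ℝ) (lam : ℝ) (μ : Measure (Stacks d)) : Prop :=
  IsProbabilityMeasure μ ∧
    ∀ (F : Finset (Site d × ℕ)) (g : Site d × ℕ → Instr d),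
      μ {I | ∀ i ∈ F, I i = g i} = ∏ i ∈ F, instrWeight step lam (g i)

/-- The law of the i.i.d. instruction stacks (uniquely determined by its cylinder
probabilities; it exists whenever `step` is a probability distribution and `λ > 0`). -/
def stackLaw (d : ℕ) (step : Site d → ℝ) (lam : ℝ) : Measure (Stacks d) :=
  if h : ∃ μ, IsStackLaw d step lam μ then h.choose else 0

/-! ### Fixation and the critical density -/

/-- Translation of a particle count by `z`. -/
def shift {d : ℕ} (z : Site d) (η : Site d → ℕ) : Site d → ℕ := fun x => η (x + z)

/-- A translation-ergodic distribution of particles: invariant under all translations,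
and every translation-invariant event is trivial. -/
def IsTransErgodic {d : ℕ} (ν : Measure (Site d → ℕ)) : Prop :=
  (∀ z, Measure.map (shift z) ν = ν) ∧
    ∀ s : Set (Site d → ℕ), MeasurableSet s → (∀ z, shift z ⁻¹' s = s) → ν s = 0 ∨ ν s = 1

/-- Almost sure fixation of the initial distribution `ν`: for `ν`-almost every initial
configuration and almost every instructions, the limiting odometer at the origin is
finite (equivalently, by Amir–Gurel-Gurevich, every particle eventually sleeps forever). -/
def Fixates (d : ℕ) (step : Site d → ℝ) (lam : ℝ) (ν : Measure (Site d → ℕ)) : Prop :=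
  ∀ᵐ η ∂ν, ∀ᵐ I ∂(stackLaw d step lam), odom0 I η ≠ ⊤

/-- The critical density `ρ_c(ℤ^d, P, λ)`: the supremum of the densities `ρ` such that
every translation-ergodic probability distribution of active particles with mean `ρ`
particles per site fixates almost surely. -/
def critDensity (d : ℕ) (step : Site d → ℝ) (lam : ℝ) : ℝ :=
  sSup {ρ : ℝ | 0 ≤ ρ ∧
    ∀ ν : Measure (Site d → ℕ), IsProbabilityMeasure ν → IsTransErgodic ν →
      (∫⁻ η, (η 0 : ℝ≥0∞) ∂ν) = ENNReal.ofReal ρ → Fixates d step lam ν}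

/-! ### Random walk quantities -/

/-- Simple symmetric nearest-neighbour step distribution on `ℤ^d`. -/
def ssrwStep (d : ℕ) : Site d → ℝ :=
  fun z => if (∑ i, (z i).natAbs) = 1 then (1 : ℝ) / (2 * d) else 0

/-- `psum w k` : position after the first `k` steps with increments `w`. -/
def psum {d n : ℕ} (w : Fin n → Site d) (k : ℕ) : Site d :=
  ∑ i ∈ Finset.univ.filter (fun i : Fin n => (i : ℕ) < k), w i

/-- Probability of a given sequence of increments. -/
def pathProb {d n : ℕ} (step : Site d → ℝ) (w : Fin n → Site d) : ℝ := ∏ i, step (w i)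

/-- `P(S_n = 0)` for the discrete-time walk started at `0`. -/
def probAt0 {d : ℕ} (step : Site d → ℝ) (n : ℕ) : ℝ :=
  ∑' w : Fin n → Site d, if psum w n = 0 then pathProb step w else 0

/-- The Green's function `G = Σ_{n ≥ 0} P(S_n = 0)` of the walk, valued in `[0, ∞]`.
The walk is transient iff `greenE step < ∞`. -/
def greenE {d : ℕ} (step : Site d → ℝ) : ℝ≥0∞ :=
  ∑' n : ℕ, ENNReal.ofReal (probAt0 step n)

/-- Probability that the walk returns to `0` for the first time at time `n`, having
stayed inside `A` at all intermediate times. -/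
def returnIn {d : ℕ} (step : Site d → ℝ) (A : Set (Site d)) (n : ℕ) : ℝ :=
  ∑' w : Fin n → Site d,
    if (∀ k, 0 < k → k < n → psum w k ≠ 0 ∧ psum w k ∈ A) ∧ psum w n = 0
    then pathProb step w else 0

/-- `P(τ = n)` where `τ` is the first return time to the origin. -/
def firstReturn {d : ℕ} (step : Site d → ℝ) (n : ℕ) : ℝ := returnIn step Set.univ n

/-- The probability that the walk started at `0` exits `A` strictly before returning
to `0`. -/
def escProb {d : ℕ} (step : Site d → ℝ) (A : Set (Site d)) : ℝ :=
  ∑' n : ℕ, ∑' w : Fin (n + 1) → Site d,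
    if (∀ k, 0 < k → k ≤ n → psum w k ≠ 0 ∧ psum w k ∈ A) ∧ psum w (n + 1) ∉ A
    then pathProb step w else 0

/-- `q(ℤ^d, P, λ)`: the probability that a single particle started at the origin falls
asleep at the origin, i.e. that the walk is at `0` after `N` steps where
`P(N = n) = λ_s λ_J^n`. -/
def qProb {d : ℕ} (step : Site d → ℝ) (lam : ℝ) : ℝ :=
  ∑' n : ℕ, lamS lam * lamJ lam ^ n * probAt0 step n

/-- The ball `B_r = {x : ‖x‖₁ ≤ r}`. -/
def ball (d : ℕ) (r : ℝ) : Set (Site d) := {x | ((∑ i, (x i).natAbs : ℕ) : ℝ) ≤ r}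

/-- `η` fills `A`: at least one particle at each site of `A`. -/
def Fills {d : ℕ} (η : Site d → ℕ) (A : Set (Site d)) : Prop := ∀ x ∈ A, 1 ≤ η x

/-! ### Weak stabilization, strong stabilization and the number of chances -/

/-- Legality of a weak toppling sequence (with respect to the origin): off the origin as
usual, while the origin may only be toppled if it holds at least two active particles. -/
def WLegal {d : ℕ} (V : Finset (Site d)) (I : Stacks d) : State d → List (Site d) → Prop
  | _, [] => True
  | s, x :: l => x ∈ V ∧ (if x = 0 then 2 else 1) ≤ numActive (s.1 x) ∧
      WLegal V I (topple V I x s) l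

/-- Weak stability in `V` with respect to the origin. -/
def WStable {d : ℕ} (V : Finset (Site d)) (σ : Config d) : Prop :=
  numActive (σ 0) ≤ 1 ∧ ∀ x ∈ V, x ≠ 0 → numActive (σ x) = 0

/-- The weak stabilization of a state (well defined by the abelian property whenever it
terminates). -/
def weakStab {d : ℕ} (V : Finset (Site d)) (I : Stacks d) (s : State d) : State d :=
  if h : ∃ l, WLegal V I s l ∧ WStable V (run V I s l).1 then run V I s h.choose else s

/-- The jump-out step: the particle at the origin is acceptably toppled (consuming
instructions at the origin, ignoring the sleep instructions) until it jumps out. -/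
def jumpOut {d : ℕ} (V : Finset (Site d)) (I : Stacks d) (s : State d) : State d :=
  if h : ∃ k, (I (0, s.2 0 + k)).isSome then
    let k := Nat.find h
    let z := (I (0, s.2 0 + k)).get (Nat.find_spec h)
    let σ₁ := Function.update s.1 0 (SiteState.active (numActive (s.1 0) - 1))
    let σ' := if (0 : Site d) + z ∈ V then
        Function.update σ₁ ((0 : Site d) + z) (addParticle (σ₁ ((0 : Site d) + z)))
      else σ₁
    (σ', Function.update s.2 0 (s.2 0 + k + 1))
  else s

/-- The states of the strong stabilization of `η` on `V` with respect to the origin via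
successive weak stabilizations: `procState j` is the state after the `(j+1)`-st weak
stabilization; as long as the origin holds an active particle, it is jumped out and the
configuration is weakly stabilized again. -/
def procState {d : ℕ} (V : Finset (Site d)) (I : Stacks d) (η : Site d → ℕ) :
    ℕ → State d
  | 0 => weakStab V I (initState d V η)
  | j + 1 =>
      let s := procState V I η j
      if 1 ≤ numActive (s.1 0) then weakStab V I (jumpOut V I s) else s

/-- The number of chances `Ch(η, V)`: the number of completed iterations of the strong
stabilization procedure, i.e. the first `j` such that the origin is empty after the
`(j+1)`-st weak stabilization. -/
def chances {d : ℕ} (V : Finset (Site d)) (I : Stacks d) (η : Site d → ℕ) : ℕ∞ :=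
  if h : ∃ j, numActive ((procState V I η j).1 0) = 0 then (Nat.find h : ℕ∞) else ⊤

/-- The `j`-th weakly stable configuration `η^W_j` (for `1 ≤ j`). -/
def weakConfig {d : ℕ} (V : Finset (Site d)) (I : Stacks d) (η : Site d → ℕ) (j : ℕ) :
    Config d :=
  (procState V I η (j - 1)).1

/-- The `j`-th sleep trial `b_j` (for `1 ≤ j`): whether the first instruction used in the
`j`-th jump-out step is a sleep instruction. -/
def sleepTrial {d : ℕ} (V : Finset (Site d)) (I : Stacks d) (η : Site d → ℕ) (j : ℕ) :
    Prop :=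
  I (0, (procState V I η (j - 1)).2 0) = none

/-- `a^n` for `n ∈ ℕ∞`, with `a^∞ = 0` (appropriate for `a < 1`). -/
def enpow (a : ℝ≥0∞) : ℕ∞ → ℝ≥0∞
  | ⊤ => 0
  | (n : ℕ) => a ^ n

end
end ARW

open MeasureTheory ENNReal Filter

set_option linter.all false
namespace ARWP
open ARW

noncomputable section
open scoped Classical

variable {d : ℕ}

/-- Total number of particles at a site state. -/
def cnt : SiteState → ℕ
  | .active n => n
  | .sleeping => 1

/-- Effect of a sleep instruction on a site. -/
def slp (a : SiteState) : SiteState := if numActive a = 1 then .sleeping else a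

/-- Effect of the departure of a particle from a site. -/
def outp (a : SiteState) : SiteState := .active (numActive a - 1)

/-- Toppling with a prescribed instruction. -/
def toppleA (V : Finset (Site d)) (x : Site d) (a : Instr d) (s : State d) : State d :=
  (match a with
    | none => Function.update s.1 x (slp (s.1 x))
    | some z => fun y =>
        if x + z ∈ V ∧ y = x + z then addParticle (if y = x then outp (s.1 x) else s.1 y)
        else (if y = x then outp (s.1 x) else s.1 y),
   Function.update s.2 x (s.2 x + 1))

lemma topple_eq (V : Finset (Site d)) (I : Stacks d) (x : Site d) (s : State d) :
    topple V I x s = toppleA V x (I (x, s.2 x)) s := by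
  unfold topple toppleA
  dsimp only
  generalize I (x, s.2 x) = a
  cases a with
  | none =>
    simp only [Prod.mk.injEq, and_true]
    unfold slp
    split_ifs with h1
    · rfl
    · simp
  | some z =>
    simp only [Prod.mk.injEq, and_true]
    funext y
    by_cases h1 : x + z ∈ V
    · simp only [h1, if_true, true_and]
      by_cases h2 : y = x + z
      · subst h2
        simp only [Function.update_self, if_true]
        rw [Function.update_apply]
        rfl
      · simp only [h2, if_false]
        rw [Function.update_of_ne h2, Function.update_apply]
        rfl
    · simp only [h1, if_false, false_and]
      rw [Function.update_apply]
      rfl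

lemma numActive_add (a : SiteState) : numActive (addParticle a) = cnt a + 1 := by
  cases a <;> rfl
lemma cnt_add (a : SiteState) : cnt (addParticle a) = cnt a + 1 := by
  cases a <;> rfl
lemma numActive_le_cnt (a : SiteState) : numActive a ≤ cnt a := by
  cases a <;> simp [numActive, cnt]
lemma cnt_of_pos {a : SiteState} (h : 1 ≤ numActive a) : cnt a = numActive a := by
  cases a <;> simp_all [numActive, cnt]
lemma numActive_outp (a : SiteState) : numActive (outp a) = numActive a - 1 := rfl
lemma cnt_outp (a : SiteState) : cnt (outp a) = numActive a - 1 := rfl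
lemma cnt_slp (a : SiteState) : cnt (slp a) = cnt a := by
  unfold slp
  split_ifs with h
  · rw [cnt_of_pos (show 1 ≤ numActive a by omega), h]; rfl
  · rfl
lemma state_ext {a b : SiteState} (h1 : numActive a = numActive b) (h2 : cnt a = cnt b) : a = b := by
  cases a <;> cases b <;> simp_all [numActive, cnt]
  omega
lemma numActive_slp (a : SiteState) : numActive (slp a) = if numActive a = 1 then 0 else numActive a := by
  unfold slp
  split_ifs <;> rfl
lemma slp_of_two {a : SiteState} (h : 2 ≤ numActive a) : slp a = a := by
  unfold slp; rw [if_neg (by omega)]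

lemma sleeping_iff {a : SiteState} : a = .sleeping ↔ (numActive a = 0 ∧ cnt a = 1) := by
  cases a with
  | active n => simp only [numActive, cnt, reduceCtorEq, false_iff]; omega
  | sleeping => simp [numActive, cnt]

lemma toppleA_none (V : Finset (Site d)) (x y : Site d) (s : State d) :
    (toppleA V x none s).1 y = if y = x then slp (s.1 x) else s.1 y := by
  simp [toppleA, Function.update_apply]

lemma toppleA_some (V : Finset (Site d)) (x z y : Site d) (s : State d) :
    (toppleA V x (some z) s).1 y =
      if x + z ∈ V ∧ y = x + z then addParticle (if y = x then outp (s.1 x) else s.1 y)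
        else (if y = x then outp (s.1 x) else s.1 y) := by
  simp [toppleA]

lemma toppleA_snd (V : Finset (Site d)) (x : Site d) (a : Instr d) (s : State d) :
    (toppleA V x a s).2 = Function.update s.2 x (s.2 x + 1) := rfl

lemma numActive_toppleA_ne (V : Finset (Site d)) {x y : Site d} (h : y ≠ x) (a : Instr d)
    (s : State d) : numActive (s.1 y) ≤ numActive ((toppleA V x a s).1 y) := by
  cases a with
  | none => rw [toppleA_none, if_neg h]
  | some z =>
    rw [toppleA_some, if_neg h]
    split_ifs
    · rw [numActive_add]; have := numActive_le_cnt (s.1 y); omega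
    · exact le_rfl

lemma cnt_toppleA_ne (V : Finset (Site d)) {x y : Site d} (h : y ≠ x) (a : Instr d)
    (s : State d) : cnt (s.1 y) ≤ cnt ((toppleA V x a s).1 y) := by
  cases a with
  | none => rw [toppleA_none, if_neg h]
  | some z =>
    rw [toppleA_some, if_neg h]
    split_ifs
    · rw [cnt_add]; omega
    · exact le_rfl

lemma numActive_toppleA_self (V : Finset (Site d)) {x : Site d} (a : Instr d)
    (s : State d) (h : 2 ≤ numActive (s.1 x)) :
    numActive (s.1 x) - 1 ≤ numActive ((toppleA V x a s).1 x) := by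
  cases a with
  | none => rw [toppleA_none, if_pos rfl, slp_of_two h]; omega
  | some z =>
    rw [toppleA_some, if_pos rfl]
    split_ifs
    · rw [numActive_add, cnt_outp]; omega
    · rw [numActive_outp]

lemma cnt_toppleA_self (V : Finset (Site d)) {x : Site d} (a : Instr d)
    (s : State d) (h : 1 ≤ numActive (s.1 x)) :
    cnt (s.1 x) - 1 ≤ cnt ((toppleA V x a s).1 x) := by
  have := cnt_of_pos h
  cases a with
  | none => rw [toppleA_none, if_pos rfl, cnt_slp]; omega
  | some z =>
    rw [toppleA_some, if_pos rfl]
    split_ifs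
    · rw [cnt_add, cnt_outp]; omega
    · rw [cnt_outp]; omega

/-! ### Commutation -/

lemma toppleA_other (V : Finset (Site d)) (x w : Site d) (hw : w ≠ x) (a : Instr d) :
    (∀ s : State d, (toppleA V x a s).1 w = s.1 w) ∨
      (∀ s : State d, (toppleA V x a s).1 w = addParticle (s.1 w)) := by
  cases a with
  | none => left; intro s; rw [toppleA_none, if_neg hw]
  | some z =>
    by_cases h : x + z ∈ V ∧ w = x + z
    · right; intro s; rw [toppleA_some, if_pos h, if_neg hw]
    · left; intro s; rw [toppleA_some, if_neg h, if_neg hw]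

lemma toppleA_self (V : Finset (Site d)) (x : Site d) (a : Instr d) :
    (∀ s : State d, (toppleA V x a s).1 x = slp (s.1 x)) ∨
    (∀ s : State d, (toppleA V x a s).1 x = outp (s.1 x)) ∨
      (∀ s : State d, (toppleA V x a s).1 x = addParticle (outp (s.1 x))) := by
  cases a with
  | none => left; intro s; rw [toppleA_none, if_pos rfl]
  | some z =>
    right
    by_cases h : x + z ∈ V ∧ x = x + z
    · right; intro s; rw [toppleA_some, if_pos h, if_pos rfl]
    · left; intro s; rw [toppleA_some, if_neg h, if_pos rfl]

lemma toppleA_comm_aux (V : Finset (Site d)) {x y : Site d} (hxy : x ≠ y) (a b : Instr d)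
    (s : State d) (hx : 1 ≤ numActive (s.1 x)) :
    (toppleA V y b (toppleA V x a s)).1 x = (toppleA V x a (toppleA V y b s)).1 x := by
  have hcx := cnt_of_pos hx
  rcases toppleA_other V y x hxy b with h | h <;> rcases toppleA_self V x a with h' | h' | h' <;>
    rw [h, h', h', h] <;> apply state_ext <;>
    simp only [numActive_add, numActive_outp, numActive_slp, cnt_add, cnt_outp, cnt_slp] <;>
    first | omega | (split_ifs <;> omega)

lemma toppleA_comm (V : Finset (Site d)) {x y : Site d} (hxy : x ≠ y) (a b : Instr d) (s : State d)
    (hx : 1 ≤ numActive (s.1 x)) (hy : 1 ≤ numActive (s.1 y)) :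
    toppleA V y b (toppleA V x a s) = toppleA V x a (toppleA V y b s) := by
  have hyx : y ≠ x := fun h => hxy h.symm
  refine Prod.ext ?_ ?_
  · funext w
    by_cases hwx : w = x
    · rw [hwx]; exact toppleA_comm_aux V hxy a b s hx
    by_cases hwy : w = y
    · rw [hwy]; exact (toppleA_comm_aux V hyx b a s hy).symm
    rcases toppleA_other V y w hwy b with h | h <;> rcases toppleA_other V x w hwx a with h' | h' <;>
      rw [h, h', h', h]
  · simp only [toppleA_snd]
    rw [Function.update_of_ne hyx, Function.update_of_ne hxy, Function.update_comm hxy]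

lemma topple_comm (V : Finset (Site d)) (I : Stacks d) {x y : Site d} (hxy : x ≠ y) (s : State d)
    (hx : 1 ≤ numActive (s.1 x)) (hy : 1 ≤ numActive (s.1 y)) :
    topple V I y (topple V I x s) = topple V I x (topple V I y s) := by
  simp only [topple_eq, toppleA_snd]
  rw [Function.update_of_ne hxy, Function.update_of_ne (Ne.symm hxy)]
  exact toppleA_comm V hxy _ _ s hx hy

lemma numActive_topple_ne (V : Finset (Site d)) (I : Stacks d) {x y : Site d} (h : y ≠ x)
    (s : State d) : numActive (s.1 y) ≤ numActive ((topple V I x s).1 y) := by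
  rw [topple_eq]; exact numActive_toppleA_ne V h _ s

lemma run_append (V : Finset (Site d)) (I : Stacks d) (s : State d) (l l' : List (Site d)) :
    run V I s (l ++ l') = run V I (run V I s l) l' := by
  induction l generalizing s with
  | nil => rfl
  | cons x l ih => simp only [List.cons_append, run]; exact ih _

lemma legal_append (V : Finset (Site d)) (I : Stacks d) (s : State d) (l l' : List (Site d)) :
    Legal V I s (l ++ l') ↔ Legal V I s l ∧ Legal V I (run V I s l) l' := by
  induction l generalizing s with
  | nil => simp [Legal, run]
  | cons x l ih => simp only [List.cons_append, run, Legal, ih]; tauto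

lemma numActive_run_notMem (V : Finset (Site d)) (I : Stacks d) {y : Site d} (s : State d)
    (l : List (Site d)) (h : y ∉ l) : numActive (s.1 y) ≤ numActive ((run V I s l).1 y) := by
  induction l generalizing s with
  | nil => exact le_rfl
  | cons x l ih =>
    simp only [List.mem_cons, not_or] at h
    exact (numActive_topple_ne V I h.1 s).trans (ih _ h.2)

/-- Bringing an active site to the front of a legal sequence. -/
lemma legal_front (V : Finset (Site d)) (I : Stacks d) {y : Site d} (s : State d)
    (l : List (Site d)) (hl : Legal V I s l) (hy : 1 ≤ numActive (s.1 y)) (hyl : y ∈ l) :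
    Legal V I s (y :: l.erase y) ∧ run V I s (y :: l.erase y) = run V I s l := by
  induction l generalizing s with
  | nil => simp at hyl
  | cons x l ih =>
    by_cases hxy : x = y
    · subst hxy; rw [List.erase_cons_head]; exact ⟨hl, rfl⟩
    · have hyl' : y ∈ l := by
        rcases List.mem_cons.1 hyl with h | h
        · exact absurd h.symm hxy
        · exact h
      rw [List.erase_cons_tail (by simpa using hxy)]
      obtain ⟨hxV, hx, hl⟩ := hl
      have h1 := numActive_topple_ne V I (Ne.symm hxy) s
      obtain ⟨⟨hyV, _, h3⟩, h4⟩ := ih (topple V I x s) hl (hy.trans h1) hyl'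
      have hc := topple_comm V I hxy s hx hy
      refine ⟨⟨hyV, hy, hxV, hx.trans (numActive_topple_ne V I hxy s), ?_⟩, ?_⟩
      · rw [← hc]; exact h3
      · simp only [run] at h4 ⊢
        rw [← hc]; exact h4

/-- Least action principle and abelian property. -/
lemma abelian (V : Finset (Site d)) (I : Stacks d) (s : State d) (l l' : List (Site d))
    (hl : Legal V I s l) (hl' : Legal V I s l') (hst : Stable V (run V I s l').1) :
    (∀ x, l.count x ≤ l'.count x) ∧ l.length ≤ l'.length ∧
      (Stable V (run V I s l).1 → run V I s l = run V I s l') := by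
  induction l generalizing s l' with
  | nil =>
    refine ⟨by simp, by simp, fun h => ?_⟩
    cases l' with
    | nil => rfl
    | cons x l' => exact absurd (h x hl'.1) (by have := hl'.2.1; simp only [run]; omega)
  | cons y l ih =>
    obtain ⟨hyV, hy, hl⟩ := hl
    have hyl : y ∈ l' := by
      by_contra hc
      have := numActive_run_notMem V I s l' hc
      have := hst y hyV
      omega
    obtain ⟨h1, h2⟩ := legal_front V I s l' hl' hy hyl
    rw [← h2] at hst
    obtain ⟨i1, i2, i3⟩ := ih (topple V I y s) (l'.erase y) hl h1.2.2 hst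
    have hperm := List.perm_cons_erase hyl
    refine ⟨fun x => ?_, ?_, fun h => ?_⟩
    · rw [hperm.count_eq, List.count_cons, List.count_cons]; have := i1 x; omega
    · rw [hperm.length_eq]; simpa using i2
    · rw [← h2]; exact i3 h

/-! ### Monotonicity -/

def SLe (a b : SiteState) : Prop := numActive a ≤ numActive b ∧ cnt a ≤ cnt b

lemma SLe_add {a b : SiteState} (h : SLe a b) : SLe (addParticle a) (addParticle b) := by
  unfold SLe at *; simp only [numActive_add, cnt_add]; omega

lemma SLe_add' {a b : SiteState} (h : SLe a b) : SLe a (addParticle b) := by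
  unfold SLe at *; simp only [numActive_add, cnt_add]; have := numActive_le_cnt b; omega

lemma toppleA_mono {V W : Finset (Site d)} (hVW : V ⊆ W) (x : Site d) (a : Instr d) {s t : State d}
    (hst : ∀ y, SLe (s.1 y) (t.1 y)) (hx : 1 ≤ numActive (s.1 x)) (y : Site d) :
    SLe ((toppleA V x a s).1 y) ((toppleA W x a t).1 y) := by
  have h1 := hst x
  have hs := cnt_of_pos hx
  have ht := cnt_of_pos (hx.trans h1.1)
  cases a with
  | none =>
    simp only [toppleA_none]
    split_ifs
    · unfold SLe at *; simp only [numActive_slp, cnt_slp]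
      refine ⟨?_, h1.2⟩
      split_ifs <;> omega
    · exact hst y
  | some z =>
    simp only [toppleA_some]
    have h2 : SLe (if y = x then outp (s.1 x) else s.1 y) (if y = x then outp (t.1 x) else t.1 y) := by
      split_ifs
      · unfold SLe at *; simp only [numActive_outp, cnt_outp]; omega
      · exact hst y
    generalize (if y = x then outp (s.1 x) else s.1 y) = p at *
    generalize (if y = x then outp (t.1 x) else t.1 y) = q at *
    by_cases h3 : x + z ∈ V ∧ y = x + z
    · rw [if_pos h3, if_pos (show x + z ∈ W ∧ y = x + z from ⟨hVW h3.1, h3.2⟩)]; exact SLe_add h2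
    · rw [if_neg h3]
      split_ifs with h4
      · exact SLe_add' h2
      · exact h2

lemma legal_mono {V W : Finset (Site d)} (hVW : V ⊆ W) (I : Stacks d) (l : List (Site d))
    {s t : State d} (hst : ∀ y, SLe (s.1 y) (t.1 y)) (hm : s.2 = t.2) (hl : Legal V I s l) :
    Legal W I t l := by
  induction l generalizing s t with
  | nil => trivial
  | cons x l ih =>
    obtain ⟨h1, h2, h3⟩ := hl
    refine ⟨hVW h1, h2.trans (hst x).1, ih ?_ ?_ h3⟩
    · rw [topple_eq, topple_eq, ← hm]
      exact toppleA_mono hVW x _ hst h2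
    · simp only [topple_eq, toppleA_snd, hm]

lemma init_legal_mono {V W : Finset (Site d)} (hVW : V ⊆ W) (I : Stacks d) (η : Site d → ℕ)
    (l : List (Site d)) (hl : Legal V I (initState d V η) l) : Legal W I (initState d W η) l := by
  refine legal_mono (s := initState d V η) hVW I l (fun y => ?_) rfl hl
  simp only [initState, SLe, numActive, cnt]
  by_cases h : y ∈ V
  · simp [h, hVW h]
  · simp [h]

/-! ### Weighted mass -/

def Mass (V : Finset (Site d)) (h : Site d → ℝ) (s : State d) : ℝ := ∑ x ∈ V, (cnt (s.1 x) : ℝ) * h x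

lemma mass_none (V : Finset (Site d)) (h : Site d → ℝ) (s : State d) (x : Site d) :
    Mass V h (toppleA V x none s) = Mass V h s := by
  unfold Mass
  refine Finset.sum_congr rfl fun y _ => ?_
  rw [toppleA_none]
  split_ifs with h1
  · rw [cnt_slp, h1]
  · rfl

lemma mass_some (V : Finset (Site d)) (h : Site d → ℝ) (s : State d) (x z : Site d) (hx : x ∈ V)
    (ha : 1 ≤ numActive (s.1 x)) :
    Mass V h (toppleA V x (some z) s) = Mass V h s - h x + if x + z ∈ V then h (x + z) else 0 := by
  unfold Mass
  have key : ∀ y, (cnt ((toppleA V x (some z) s).1 y) : ℝ) * h y =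
      cnt (s.1 y) * h y - (if y = x then h y else 0) + (if y = x + z then (if x + z ∈ V then h y else 0) else 0) := by
    intro y
    rw [toppleA_some]
    have hc := cnt_of_pos ha
    have e1 : (cnt (if y = x then outp (s.1 x) else s.1 y) : ℝ) * h y =
        cnt (s.1 y) * h y - (if y = x then h y else 0) := by
      split_ifs with h1
      · subst h1
        rw [cnt_outp, hc, Nat.cast_sub ha]; push_cast; ring
      · ring
    rw [← e1]
    by_cases h2 : x + z ∈ V <;> by_cases h3 : y = x + z <;> simp only [h2, h3, true_and, and_true, false_and, and_false, if_true, if_false, cnt_add] <;> push_cast <;> ring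
  simp only [key]
  rw [Finset.sum_add_distrib, Finset.sum_sub_distrib, Finset.sum_ite_eq', if_pos hx, Finset.sum_ite_eq']
  congr 1
  split_ifs <;> rfl

lemma mass_nonneg (V : Finset (Site d)) (h : Site d → ℝ) (hh : ∀ x ∈ V, 0 ≤ h x) (s : State d) :
    0 ≤ Mass V h s := Finset.sum_nonneg fun x hx => mul_nonneg (Nat.cast_nonneg _) (hh x hx)

lemma mass_init (V : Finset (Site d)) (h : Site d → ℝ) (η : Site d → ℕ) :
    Mass V h (initState d V η) = ∑ x ∈ V, (η x : ℝ) * h x := by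
  unfold Mass initState
  refine Finset.sum_congr rfl fun x hx => ?_
  simp [cnt, hx]

lemma mass_run_le (V : Finset (Site d)) (I : Stacks d) (s : State d) (l : List (Site d))
    (hl : Legal V I s l) : Mass V (fun _ => 1) (run V I s l) ≤ Mass V (fun _ => 1) s := by
  induction l generalizing s with
  | nil => exact le_rfl
  | cons x l ih =>
    refine (ih _ hl.2.2).trans ?_
    rw [topple_eq]
    rcases I (x, s.2 x) with _ | z
    · exact (mass_none ..).le
    · rw [mass_some _ _ _ _ _ hl.1 hl.2.1]; split_ifs <;> linarith

/-- On a stable configuration the number of non-sleeping sites is at least `|V|` minus the mass. -/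
lemma stable_count (V : Finset (Site d)) (s : State d) :
    (V.card : ℝ) ≤ (∑ x ∈ V, if s.1 x ≠ .sleeping then (1:ℝ) else 0) + Mass V (fun _ => 1) s := by
  unfold Mass
  rw [← Finset.sum_add_distrib, Finset.card_eq_sum_ones]
  push_cast
  refine Finset.sum_le_sum fun x _ => ?_
  split_ifs with h
  · simp
  · have : s.1 x = .sleeping := by simpa using h
    simp [this, cnt]

/-! ### Dependence on finitely many instructions -/

lemma run_congr (V : Finset (Site d)) (I I' : Stacks d) (s : State d) (l : List (Site d))
    (h : ∀ x ∈ l, ∀ k < s.2 x + l.length, I (x, k) = I' (x, k)) :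
    run V I s l = run V I' s l ∧ (Legal V I s l → Legal V I' s l) := by
  induction l generalizing s with
  | nil => exact ⟨rfl, fun h => h⟩
  | cons x l ih =>
    have e : topple V I x s = topple V I' x s := by
      rw [topple_eq, topple_eq, h x (by simp) _ (by simp)]
    have := ih (topple V I x s) (fun y hy k hk => h y (by simp [hy]) k (by
      rw [topple_eq, toppleA_snd, Function.update_apply] at hk
      simp only [List.length_cons]
      split_ifs at hk with h1
      · subst h1; omega
      · omega))
    simp only [run, Legal]
    rw [← e]
    exact ⟨this.1, fun hh => ⟨hh.1, hh.2.1, this.2 hh.2.2⟩⟩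

lemma run_snd (V : Finset (Site d)) (I : Stacks d) (s : State d) (l : List (Site d)) (x : Site d) :
    (run V I s l).2 x = s.2 x + l.count x := by
  induction l generalizing s with
  | nil => simp [run]
  | cons y l ih =>
    simp only [run]
    rw [ih, topple_eq, toppleA_snd, Function.update_apply, List.count_cons]
    by_cases h : x = y
    · subst h; simp; omega
    · simp [h, Ne.symm h]

end
end ARWP

open MeasureTheory ENNReal Filter
set_option linter.all false
namespace ARWP
open ARW

noncomputable section
open scoped Classical

/-! ### The stack law -/

def dirs : Finset (Site 2) := {![1, 0], ![-1, 0], ![0, 1], ![0, -1]}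

lemma sum_dirs {M : Type*} [AddCommMonoid M] (f : Site 2 → M) :
    ∑ z ∈ dirs, f z = f ![1, 0] + (f ![-1, 0] + (f ![0, 1] + f ![0, -1])) := by
  unfold dirs
  rw [Finset.sum_insert, Finset.sum_insert, Finset.sum_insert, Finset.sum_singleton]
  · simp only [Finset.mem_singleton]; intro h; have := congrFun h 1; simp at this
  · simp only [Finset.mem_insert, Finset.mem_singleton]; rintro (h | h) <;> have := congrFun h 0 <;> simp at this
  · simp only [Finset.mem_insert, Finset.mem_singleton]; rintro (h | h | h) <;> have := congrFun h 0 <;> simp at this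

lemma mem_dirs {z : Site 2} : z ∈ dirs ↔ (∑ i, (z i).natAbs) = 1 := by
  rw [Fin.sum_univ_two]
  unfold dirs
  simp only [Finset.mem_insert, Finset.mem_singleton]
  constructor
  · rintro (h | h | h | h) <;> subst h <;> simp
  · intro h
    have h2 : (z 0 = 1 ∧ z 1 = 0) ∨ (z 0 = -1 ∧ z 1 = 0) ∨ (z 0 = 0 ∧ z 1 = 1) ∨ (z 0 = 0 ∧ z 1 = -1) := by
      omega
    rcases h2 with h2 | h2 | h2 | h2
    · left; ext i; fin_cases i <;> simp [h2]
    · right; left; ext i; fin_cases i <;> simp [h2]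
    · right; right; left; ext i; fin_cases i <;> simp [h2]
    · right; right; right; ext i; fin_cases i <;> simp [h2]

lemma ne_zero_of_mem_dirs {z : Site 2} (h : z ∈ dirs) : z ≠ 0 := by
  rintro rfl
  rw [mem_dirs] at h
  simp at h

lemma lamS_pos {lam : ℝ} (h : 0 < lam) : 0 < lamS lam := by unfold lamS; positivity
lemma lamJ_pos {lam : ℝ} (h : 0 < lam) : 0 < lamJ lam := by unfold lamJ; positivity
lemma lam_sum {lam : ℝ} (h : 0 < lam) : lamS lam + lamJ lam = 1 := by
  unfold lamS lamJ; field_simp; ring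

abbrev wt (lam : ℝ) : Instr 2 → ℝ≥0∞ := instrWeight (ssrwStep 2) lam

lemma wt_none (lam : ℝ) : wt lam none = ENNReal.ofReal (lamS lam) := rfl
lemma wt_some (lam : ℝ) (h : 0 < lam) (z : Site 2) :
    wt lam (some z) = if z ∈ dirs then ENNReal.ofReal (lamJ lam / 4) else 0 := by
  show ENNReal.ofReal (lamJ lam) * ENNReal.ofReal (ssrwStep 2 z) = _
  unfold ssrwStep
  simp only [mem_dirs]
  split_ifs
  · rw [← ENNReal.ofReal_mul (lamJ_pos h).le]; congr 1; push_cast; ring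
  · simp

def insts : Finset (Instr 2) := insert none (dirs.map Function.Embedding.some)

lemma sum_insts {M : Type*} [AddCommMonoid M] (f : Instr 2 → M) :
    ∑ a ∈ insts, f a = f none + ∑ z ∈ dirs, f (some z) := by
  unfold insts
  rw [Finset.sum_insert (by simp), Finset.sum_map]
  rfl

lemma wt_notMem {lam : ℝ} (h : 0 < lam) {a : Instr 2} (ha : a ∉ insts) : wt lam a = 0 := by
  cases a with
  | none => simp [insts] at ha
  | some z =>
    rw [wt_some lam h, if_neg]
    intro hz; apply ha; simp [insts, hz]

def instLaw (lam : ℝ) : Measure (Instr 2) := ∑ a ∈ insts, wt lam a • Measure.dirac a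

lemma instLaw_singleton {lam : ℝ} (h : 0 < lam) (a : Instr 2) : instLaw lam {a} = wt lam a := by
  unfold instLaw
  simp only [Measure.coe_finset_sum, Finset.sum_apply, Measure.smul_apply, smul_eq_mul]
  by_cases ha : a ∈ insts
  · rw [Finset.sum_eq_single a]
    · simp
    · intro b _ hb
      rw [Measure.dirac_apply' _ (MeasurableSpace.measurableSet_top)]
      simp [hb]
    · intro h; exact absurd ha h
  · rw [wt_notMem h ha]
    apply Finset.sum_eq_zero
    intro b hb
    rw [Measure.dirac_apply' _ (MeasurableSpace.measurableSet_top)]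
    have : b ≠ a := by rintro rfl; exact ha hb
    simp [this]

lemma sum_wt {lam : ℝ} (h : 0 < lam) : ∑ a ∈ insts, wt lam a = 1 := by
  rw [sum_insts, sum_dirs]
  rw [wt_none]
  simp only [wt_some lam h]
  rw [if_pos (by simp [dirs]), if_pos (by simp [dirs]), if_pos (by simp [dirs]), if_pos (by simp [dirs])]
  have := (lamJ_pos h).le
  have := (lamS_pos h).le
  rw [← ENNReal.ofReal_add, ← ENNReal.ofReal_add, ← ENNReal.ofReal_add, ← ENNReal.ofReal_add] <;> try positivity
  rw [← ENNReal.ofReal_one, ← lam_sum h]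
  congr 1; ring

instance (d : ℕ) : MeasurableSingletonClass (Instr d) := ⟨fun _ => MeasurableSpace.measurableSet_top⟩

lemma instLaw_prob {lam : ℝ} (h : 0 < lam) : IsProbabilityMeasure (instLaw lam) := by
  constructor
  rw [← sum_wt h]
  unfold instLaw
  simp

def Cyl (F : Finset (Site 2 × ℕ)) (g : Site 2 × ℕ → Instr 2) : Set (Stacks 2) := {I | ∀ i ∈ F, I i = g i}

lemma exists_law {lam : ℝ} (h : 0 < lam) : ∃ μ, IsStackLaw 2 (ssrwStep 2) lam μ := by
  haveI := instLaw_prob h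
  refine ⟨Measure.infinitePi (fun _ => instLaw lam), inferInstance, fun F g => ?_⟩
  have : {I : Stacks 2 | ∀ i ∈ F, I i = g i} = Set.pi F (fun i => {g i}) := by
    ext I; simp [Set.mem_pi]
  rw [this, Measure.infinitePi_pi _ (fun i _ => measurableSet_singleton _)]
  refine Finset.prod_congr rfl fun i _ => instLaw_singleton h _

lemma measurableSet_cyl (F : Finset (Site 2 × ℕ)) (g : Site 2 × ℕ → Instr 2) : MeasurableSet (Cyl F g) := by
  have : Cyl F g = ⋂ i ∈ F, (fun I : Stacks 2 => I i) ⁻¹' {g i} := by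
    ext I; simp [Cyl]
  rw [this]
  exact Finset.measurableSet_biInter _ fun i _ => measurable_pi_apply i (measurableSet_singleton _)

lemma law_unique {lam : ℝ} {μ μ' : Measure (Stacks 2)} (h : IsStackLaw 2 (ssrwStep 2) lam μ)
    (h' : IsStackLaw 2 (ssrwStep 2) lam μ') : μ = μ' := by
  haveI := h.1
  haveI := h'.1
  let C : Set (Set (Stacks 2)) := {S | S = ∅ ∨ ∃ F g, S = Cyl F g}
  refine ext_of_generate_finite C ?_ ?_ ?_ (by simp)
  · apply le_antisymm
    · apply iSup_le
      intro i
      rw [← measurable_iff_comap_le]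
      apply @measurable_to_countable' _ _ _ _ (MeasurableSpace.generateFrom C)
      intro a
      apply MeasurableSpace.measurableSet_generateFrom
      right
      refine ⟨{i}, fun _ => a, ?_⟩
      ext I; simp [Cyl]
    · apply MeasurableSpace.generateFrom_le
      rintro S (rfl | ⟨F, g, rfl⟩)
      · exact MeasurableSet.empty
      · exact measurableSet_cyl F g
  · rintro S hS T hT hne
    rcases hS with rfl | ⟨F, g, rfl⟩
    · simp at hne
    rcases hT with rfl | ⟨F', g', rfl⟩
    · simp at hne
    obtain ⟨I, hI, hI'⟩ := hne
    right
    refine ⟨F ∪ F', I, ?_⟩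
    ext J
    simp only [Cyl, Set.mem_inter_iff, Set.mem_setOf_eq, Finset.mem_union] at *
    constructor
    · rintro ⟨h1, h2⟩ i (hi | hi)
      · rw [h1 i hi, hI i hi]
      · rw [h2 i hi, hI' i hi]
    · intro h1
      exact ⟨fun i hi => (h1 i (Or.inl hi)).trans (hI i hi), fun i hi => (h1 i (Or.inr hi)).trans (hI' i hi)⟩
  · rintro S (rfl | ⟨F, g, rfl⟩)
    · simp
    · exact (h.2 F g).trans (h'.2 F g).symm

lemma stackLaw_spec {lam : ℝ} (h : 0 < lam) : IsStackLaw 2 (ssrwStep 2) lam (stackLaw 2 (ssrwStep 2) lam) := by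
  unfold stackLaw
  rw [dif_pos (exists_law h)]
  exact (exists_law h).choose_spec

lemma stackLaw_eq {lam : ℝ} (h : 0 < lam) :
    stackLaw 2 (ssrwStep 2) lam = Measure.infinitePi (fun _ => instLaw lam) := by
  haveI := instLaw_prob h
  refine law_unique (stackLaw_spec h) ⟨inferInstance, fun F g => ?_⟩
  have : {I : Stacks 2 | ∀ i ∈ F, I i = g i} = Set.pi F (fun i => {g i}) := by
    ext I; simp [Set.mem_pi]
  rw [this, Measure.infinitePi_pi _ (fun i _ => measurableSet_singleton _)]
  refine Finset.prod_congr rfl fun i _ => instLaw_singleton h _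

/-! ### Adaptive toppling processes -/

structure Proc (V : Finset (Site 2)) (Ph : Type) where
  pick : Ph → State 2 → Option (Site 2)
  nph : Ph → State 2 → Instr 2 → Ph
  legal : ∀ p s x, pick p s = some x → x ∈ V ∧ 1 ≤ numActive (s.1 x)

variable {V : Finset (Site 2)} {Ph : Type} (P : Proc V Ph)

def Proc.nxt (c : Ph × State 2) (x : Site 2) (a : Instr 2) : Ph × State 2 :=
  (P.nph c.1 c.2 a, toppleA V x a c.2)

def Proc.exec (I : Stacks 2) : ℕ → Ph × State 2 → Ph × State 2
  | 0, c => c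
  | n + 1, c => match P.pick c.1 c.2 with
    | none => c
    | some x => Proc.exec I n (P.nxt c x (I (x, c.2.2 x)))

def avg (lam : ℝ) (φ : Instr 2 → ℝ) : ℝ := lamS lam * φ none + lamJ lam / 4 * ∑ z ∈ dirs, φ (some z)

def Proc.E (lam : ℝ) (φ : Ph × State 2 → ℝ) : ℕ → Ph × State 2 → ℝ
  | 0, c => φ c
  | n + 1, c => match P.pick c.1 c.2 with
    | none => φ c
    | some x => avg lam fun a => Proc.E lam φ n (P.nxt c x a)

lemma avg_mono {lam : ℝ} (h : 0 < lam) {φ ψ : Instr 2 → ℝ} (h0 : φ none ≤ ψ none)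
    (h1 : ∀ z ∈ dirs, φ (some z) ≤ ψ (some z)) : avg lam φ ≤ avg lam ψ := by
  unfold avg
  have := lamS_pos h
  have := lamJ_pos h
  gcongr with z hz
  exact h1 z hz

lemma avg_const {lam : ℝ} (h : 0 < lam) (c : ℝ) : avg lam (fun _ => c) = c := by
  unfold avg
  rw [sum_dirs]
  linear_combination c * lam_sum h

lemma avg_add (lam : ℝ) (φ ψ : Instr 2 → ℝ) : avg lam (fun a => φ a + ψ a) = avg lam φ + avg lam ψ := by
  unfold avg; rw [Finset.sum_add_distrib]; ring

lemma avg_smul (lam : ℝ) (c : ℝ) (φ : Instr 2 → ℝ) : avg lam (fun a => c * φ a) = c * avg lam φ := by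
  unfold avg; rw [← Finset.mul_sum]; ring

lemma Proc.E_zero (lam : ℝ) (φ : Ph × State 2 → ℝ) (c) : P.E lam φ 0 c = φ c := rfl
lemma Proc.E_none (lam : ℝ) (φ : Ph × State 2 → ℝ) (n c) (h : P.pick c.1 c.2 = none) :
    P.E lam φ n c = φ c := by
  cases n with
  | zero => rfl
  | succ n => rw [Proc.E, h]
lemma Proc.E_some (lam : ℝ) (φ : Ph × State 2 → ℝ) (n c x) (h : P.pick c.1 c.2 = some x) :
    P.E lam φ (n+1) c = avg lam fun a => P.E lam φ n (P.nxt c x a) := by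
  rw [Proc.E, h]
lemma Proc.exec_none (I : Stacks 2) (n c) (h : P.pick c.1 c.2 = none) :
    P.exec I n c = c := by
  cases n with
  | zero => rfl
  | succ n => rw [Proc.exec, h]
lemma Proc.exec_some (I : Stacks 2) (n c x) (h : P.pick c.1 c.2 = some x) :
    P.exec I (n+1) c = P.exec I n (P.nxt c x (I (x, c.2.2 x))) := by
  rw [Proc.exec, h]

lemma Proc.E_mono {lam : ℝ} (h : 0 < lam) {φ ψ : Ph × State 2 → ℝ} (hh : ∀ c, φ c ≤ ψ c) (n c) :
    P.E lam φ n c ≤ P.E lam ψ n c := by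
  induction n generalizing c with
  | zero => exact hh c
  | succ n ih =>
    cases hp : P.pick c.1 c.2 with
    | none => rw [P.E_none _ _ _ _ hp, P.E_none _ _ _ _ hp]; exact hh c
    | some x =>
      rw [P.E_some _ _ _ _ _ hp, P.E_some _ _ _ _ _ hp]
      exact avg_mono h (ih _) (fun z _ => ih _)

lemma Proc.E_const {lam : ℝ} (h : 0 < lam) (k : ℝ) (n c) :
    P.E lam (fun _ => k) n c = k := by
  induction n generalizing c with
  | zero => rfl
  | succ n ih =>
    cases hp : P.pick c.1 c.2 with
    | none => rw [P.E_none _ _ _ _ hp]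
    | some x =>
      rw [P.E_some _ _ _ _ _ hp]
      simp only [ih]
      exact avg_const h k

lemma Proc.E_add (lam : ℝ) (φ ψ : Ph × State 2 → ℝ) (n c) :
    P.E lam (fun c => φ c + ψ c) n c = P.E lam φ n c + P.E lam ψ n c := by
  induction n generalizing c with
  | zero => rfl
  | succ n ih =>
    cases hp : P.pick c.1 c.2 with
    | none => simp only [P.E_none _ _ _ _ hp]
    | some x =>
      simp only [P.E_some _ _ _ _ _ hp, ih]
      exact avg_add ..

lemma Proc.E_smul (lam : ℝ) (k : ℝ) (φ : Ph × State 2 → ℝ) (n c) :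
    P.E lam (fun c => k * φ c) n c = k * P.E lam φ n c := by
  induction n generalizing c with
  | zero => rfl
  | succ n ih =>
    cases hp : P.pick c.1 c.2 with
    | none => simp only [P.E_none _ _ _ _ hp]
    | some x =>
      simp only [P.E_some _ _ _ _ _ hp, ih]
      exact avg_smul ..

lemma Proc.E_sum {ι : Type*} (lam : ℝ) (s : Finset ι) (φ : ι → Ph × State 2 → ℝ) (n c) (h : 0 < lam) :
    P.E lam (fun c => ∑ i ∈ s, φ i c) n c = ∑ i ∈ s, P.E lam (φ i) n c := by
  induction s using Finset.induction_on with
  | empty => simp [P.E_const h]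
  | insert i s hi ih => simp only [Finset.sum_insert hi, P.E_add, ih]

/-- Supermartingale bound. -/
lemma Proc.E_le {lam : ℝ} (h : 0 < lam) (φ : Ph × State 2 → ℝ)
    (hφ : ∀ c x, P.pick c.1 c.2 = some x → avg lam (fun a => φ (P.nxt c x a)) ≤ φ c) (n c) :
    P.E lam φ n c ≤ φ c := by
  induction n generalizing c with
  | zero => exact le_rfl
  | succ n ih =>
    cases hp : P.pick c.1 c.2 with
    | none => rw [P.E_none _ _ _ _ hp]
    | some x =>
      rw [P.E_some _ _ _ _ _ hp]
      exact (avg_mono h (ih _) (fun z _ => ih _)).trans (hφ c x hp)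

lemma Proc.E_nonneg {lam : ℝ} (h : 0 < lam) {φ : Ph × State 2 → ℝ} (hh : ∀ c, 0 ≤ φ c) (n c) :
    0 ≤ P.E lam φ n c := by
  have := P.E_mono h (φ := fun _ => 0) hh n c
  rwa [P.E_const h] at this

lemma ofReal_avg {lam : ℝ} (h : 0 < lam) (φ : Instr 2 → ℝ) (hφ : ∀ a, 0 ≤ φ a) :
    ENNReal.ofReal (avg lam φ) = ∑ a ∈ insts, wt lam a * ENNReal.ofReal (φ a) := by
  unfold avg
  have h1 := (lamS_pos h).le
  have h2 : 0 ≤ lamJ lam / 4 := by have := lamJ_pos h; positivity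
  rw [ENNReal.ofReal_add (mul_nonneg h1 (hφ _)) (mul_nonneg h2 (Finset.sum_nonneg fun _ _ => hφ _)),
    ENNReal.ofReal_mul h1, ENNReal.ofReal_mul h2, ENNReal.ofReal_sum_of_nonneg (fun _ _ => hφ _),
    sum_insts, Finset.mul_sum]
  congr 1
  refine Finset.sum_congr rfl fun z hz => ?_
  rw [wt_some lam h, if_pos hz]

theorem Proc.exec_law_aux {lam : ℝ} (h : 0 < lam) {μ : Measure (Stacks 2)}
    (hμ : IsStackLaw 2 (ssrwStep 2) lam μ) (Q : Set (Ph × State 2)) (n : ℕ) (c : Ph × State 2)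
    (F : Finset (Site 2 × ℕ)) (g : Site 2 × ℕ → Instr 2) (hF : ∀ i ∈ F, i.2 < c.2.2 i.1) :
    μ (Cyl F g ∩ {I | P.exec I n c ∈ Q}) =
      μ (Cyl F g) * ENNReal.ofReal (P.E lam (Q.indicator 1) n c) := by
  have hbase : ∀ (c : Ph × State 2), μ (Cyl F g ∩ {I | c ∈ Q}) =
      μ (Cyl F g) * ENNReal.ofReal (Q.indicator 1 c) := by
    intro c
    by_cases hc : c ∈ Q <;> simp [hc]
  induction n generalizing c F g with
  | zero => exact hbase c
  | succ n ih =>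
    cases hp : P.pick c.1 c.2 with
    | none =>
      rw [P.E_none _ _ _ _ hp]
      simp only [P.exec_none _ _ _ hp]
      exact hbase c
    | some x =>
      rw [P.E_some _ _ _ _ _ hp]
      simp only [P.exec_some _ _ _ _ hp]
      set i : Site 2 × ℕ := (x, c.2.2 x) with hi
      have hiF : i ∉ F := fun hc => lt_irrefl _ (hF i hc)
      set A := {I : Stacks 2 | P.exec I n (P.nxt c x (I i)) ∈ Q} with hA
      have hCa : ∀ a, Cyl (insert i F) (Function.update g i a) = Cyl F g ∩ {I | I i = a} := by
        intro a
        ext I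
        simp only [Cyl, Set.mem_setOf_eq, Finset.mem_insert, Set.mem_inter_iff]
        constructor
        · intro hI
          refine ⟨fun j hj => ?_, ?_⟩
          · rw [hI j (Or.inr hj), Function.update_of_ne]; rintro rfl; exact hiF hj
          · rw [hI i (Or.inl rfl), Function.update_self]
        · rintro ⟨h1, h2⟩ j (rfl | hj)
          · rw [Function.update_self]; exact h2
          · rw [Function.update_of_ne]; exact h1 j hj; rintro rfl; exact hiF hj
      have hU : Cyl F g = ⋃ a, Cyl (insert i F) (Function.update g i a) := by
        simp only [hCa]; ext I; simp
      have hdisj : Pairwise (Function.onFun Disjoint fun a => Cyl (insert i F) (Function.update g i a)) := by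
        intro a b hab
        simp only [Function.onFun, hCa]
        rw [Set.disjoint_left]
        rintro I ⟨_, h1⟩ ⟨_, h2⟩
        exact hab (h1.symm.trans h2)
      have hmu : ∀ a, μ (Cyl (insert i F) (Function.update g i a)) = μ (Cyl F g) * wt lam a := by
        intro a
        rw [Cyl, hμ.2, Cyl, hμ.2, Finset.prod_insert hiF, Function.update_self, mul_comm]
        congr 1
        refine Finset.prod_congr rfl fun j hj => ?_
        rw [Function.update_of_ne]; rintro rfl; exact hiF hj
      have e1 : μ (Cyl F g ∩ A) = ∑' a, μ (Cyl (insert i F) (Function.update g i a) ∩ A) := by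
        rw [← Measure.restrict_apply (measurableSet_cyl F g), hU,
          measure_iUnion hdisj (fun a => measurableSet_cyl _ _)]
        refine tsum_congr fun a => ?_
        rw [Measure.restrict_apply (measurableSet_cyl _ _)]
      rw [e1, ofReal_avg h _ (fun a => P.E_nonneg h (fun c => Set.indicator_nonneg (by simp) c) _ _),
        tsum_eq_sum (s := insts), Finset.mul_sum]
      · refine Finset.sum_congr rfl fun a _ => ?_
        have e2 : Cyl (insert i F) (Function.update g i a) ∩ A =
            Cyl (insert i F) (Function.update g i a) ∩ {I | P.exec I n (P.nxt c x a) ∈ Q} := by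
          ext I
          simp only [Set.mem_inter_iff, and_congr_right_iff]
          intro hI
          rw [hCa] at hI
          have : I i = a := hI.2
          simp [hA, this]
        rw [e2, ih, hmu, mul_assoc]
        · intro j hj
          have e3 : (P.nxt c x a).2.2 = Function.update c.2.2 x (c.2.2 x + 1) := rfl
          rw [e3]
          rcases Finset.mem_insert.1 hj with rfl | hj
          · simp [hi]
          · have := hF j hj
            rw [Function.update_apply]
            split_ifs with h5
            · rw [h5] at this; omega
            · exact this
        · intro c
          by_cases hc : c ∈ Q <;> simp [hc]
      · intro a ha
        refine le_antisymm ((measure_mono Set.inter_subset_left).trans ?_) bot_le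
        rw [hmu, wt_notMem h ha, mul_zero]

theorem Proc.exec_law {lam : ℝ} (h : 0 < lam) {μ : Measure (Stacks 2)}
    (hμ : IsStackLaw 2 (ssrwStep 2) lam μ) (Q : Set (Ph × State 2)) (n : ℕ) (c : Ph × State 2) :
    μ {I | P.exec I n c ∈ Q} = ENNReal.ofReal (P.E lam (Q.indicator 1) n c) := by
  haveI := hμ.1
  have := P.exec_law_aux h hμ Q n c ∅ (fun _ => none) (by simp)
  have e : Cyl ∅ (fun _ => none) = Set.univ := by ext; simp [Cyl]
  rw [e] at this
  simpa using this

lemma Proc.exec_run (I : Stacks 2) (n : ℕ) (c : Ph × State 2) :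
    ∃ l, Legal V I c.2 l ∧ (P.exec I n c).2 = run V I c.2 l ∧
      (P.pick (P.exec I n c).1 (P.exec I n c).2 ≠ none → l.length = n) := by
  induction n generalizing c with
  | zero => exact ⟨[], trivial, rfl, fun _ => rfl⟩
  | succ n ih =>
    cases hp : P.pick c.1 c.2 with
    | none =>
      rw [P.exec_none _ _ _ hp]
      exact ⟨[], trivial, rfl, fun h => absurd hp h⟩
    | some x =>
      rw [P.exec_some _ _ _ _ hp]
      obtain ⟨l, h1, h2, h3⟩ := ih (P.nxt c x (I (x, c.2.2 x)))
      have e : (P.nxt c x (I (x, c.2.2 x))).2 = topple V I x c.2 := by rw [topple_eq]; rfl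
      rw [e] at h1 h2
      obtain ⟨hx, hx'⟩ := P.legal _ _ _ hp
      exact ⟨x :: l, ⟨hx, hx', h1⟩, h2, fun h => by simp [h3 h]⟩

/-- Invariants propagate along the execution. -/
lemma Proc.exec_inv (J : Ph × State 2 → Prop)
    (hJ : ∀ c x a, J c → P.pick c.1 c.2 = some x → J (P.nxt c x a)) (I : Stacks 2) (n : ℕ)
    (c : Ph × State 2) (hc : J c) : J (P.exec I n c) := by
  induction n generalizing c with
  | zero => exact hc
  | succ n ih =>
    cases hp : P.pick c.1 c.2 with
    | none => rw [P.exec_none _ _ _ hp]; exact hc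
    | some x => rw [P.exec_some _ _ _ _ hp]; exact ih _ (hJ _ _ _ hc hp)

end
end ARWP

open MeasureTheory ENNReal Filter
set_option linter.all false
namespace ARWP
open ARW

noncomputable section
open scoped Classical

variable {V : Finset (Site 2)} {Ph : Type} (P : Proc V Ph)

/-! ### Termination -/

def quad (R : ℝ) (x : Site 2) : ℝ := R - (x 0 : ℝ) ^ 2

lemma avg_mass {lam : ℝ} (h : 0 < lam) (f : Site 2 → ℝ) (s : State 2) (x : Site 2) (hx : x ∈ V)
    (ha : 1 ≤ numActive (s.1 x)) :
    avg lam (fun a => Mass V f (toppleA V x a s)) =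
      Mass V f s + lamJ lam / 4 * ∑ z ∈ dirs, ((if x + z ∈ V then f (x + z) else 0) - f x) := by
  unfold avg
  beta_reduce
  rw [mass_none]
  simp only [mass_some V f s x _ hx ha]
  have : ∑ z ∈ dirs, (Mass V f s - f x + if x + z ∈ V then f (x + z) else 0) =
      4 * Mass V f s + ∑ z ∈ dirs, ((if x + z ∈ V then f (x + z) else 0) - f x) := by
    rw [sum_dirs, sum_dirs]; ring
  rw [this]
  linear_combination Mass V f s * lam_sum h

lemma avg_quad {lam : ℝ} (h : 0 < lam) {R : ℝ} (hR : ∀ x ∈ V, ∀ z ∈ dirs, 0 ≤ quad R (x + z))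
    (s : State 2) (x : Site 2) (hx : x ∈ V) (ha : 1 ≤ numActive (s.1 x)) :
    avg lam (fun a => Mass V (quad R) (toppleA V x a s)) ≤ Mass V (quad R) s - lamJ lam / 2 := by
  rw [avg_mass h _ s x hx ha]
  have : ∑ z ∈ dirs, ((if x + z ∈ V then quad R (x + z) else 0) - quad R x) ≤
      ∑ z ∈ dirs, (quad R (x + z) - quad R x) := by
    refine Finset.sum_le_sum fun z hz => ?_
    have := hR x hx z hz
    split_ifs <;> linarith
  have h2 : ∑ z ∈ dirs, (quad R (x + z) - quad R x) = -2 := by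
    rw [sum_dirs]; simp [quad]; ring
  rw [h2] at this
  have := mul_le_mul_of_nonneg_left this (show 0 ≤ lamJ lam / 4 by have := lamJ_pos h; positivity)
  linarith

lemma Proc.term_aux {lam : ℝ} (h : 0 < lam) {R : ℝ} (hR : ∀ x ∈ V, ∀ z ∈ dirs, 0 ≤ quad R (x + z))
    (n : ℕ) (c : Ph × State 2) :
    P.E lam (fun c => Mass V (quad R) c.2) n c +
      lamJ lam / 2 * n * P.E lam ({c | P.pick c.1 c.2 ≠ none}.indicator 1) n c ≤
        Mass V (quad R) c.2 := by
  induction n generalizing c with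
  | zero => simp [P.E_zero]
  | succ n ih =>
    cases hp : P.pick c.1 c.2 with
    | none => simp [P.E_none _ _ _ _ hp, hp]
    | some x =>
      obtain ⟨hx, ha⟩ := P.legal _ _ _ hp
      have hu : P.E lam ({c | P.pick c.1 c.2 ≠ none}.indicator 1) (n+1) c ≤ 1 := by
        have := P.E_mono h (φ := ({c | P.pick c.1 c.2 ≠ none}.indicator 1)) (ψ := fun _ => 1)
          (fun c => by
            by_cases hc : c ∈ {c : Ph × State 2 | P.pick c.1 c.2 ≠ none} <;> simp [hc]) (n+1) c
        rwa [P.E_const h] at this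
      have h3 := P.E_some lam ({c | P.pick c.1 c.2 ≠ none}.indicator 1) n c x hp
      have h4 := P.E_some lam (fun c => Mass V (quad R) c.2) n c x hp
      have h5 := avg_mono h (φ := fun a => P.E lam (fun c => Mass V (quad R) c.2) n (P.nxt c x a) +
        lamJ lam / 2 * n * P.E lam ({c | P.pick c.1 c.2 ≠ none}.indicator 1) n (P.nxt c x a))
        (ψ := fun a => Mass V (quad R) (P.nxt c x a).2) (ih _) (fun z _ => ih _)
      rw [avg_add, avg_smul, ← h3, ← h4] at h5
      have h6 := avg_quad h hR c.2 x hx ha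
      have h7 := lamJ_pos h
      have h8 := mul_le_mul_of_nonneg_left hu (show 0 ≤ lamJ lam / 2 by positivity)
      push_cast
      have h9 : avg lam (fun a => Mass V (quad R) (P.nxt c x a).2) =
        avg lam (fun a => Mass V (quad R) (toppleA V x a c.2)) := rfl
      linarith

lemma exists_R (V : Finset (Site 2)) : ∃ R : ℝ, ∀ x ∈ V, ∀ z ∈ dirs, 0 ≤ quad R (x + z) := by
  refine ⟨∑ x ∈ V, ∑ z ∈ dirs, (((x + z) 0 : ℤ) : ℝ) ^ 2, fun x hx z hz => ?_⟩
  unfold quad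
  have h1 := Finset.single_le_sum (f := fun x => ∑ z ∈ dirs, (((x + z) 0 : ℤ) : ℝ) ^ 2)
    (fun x _ => Finset.sum_nonneg fun z _ => sq_nonneg _) hx
  have h2 := Finset.single_le_sum (f := fun z => (((x + z) 0 : ℤ) : ℝ) ^ 2)
    (fun x _ => sq_nonneg _) hz
  linarith

lemma quad_nonneg_of {R : ℝ} (hR : ∀ x ∈ V, ∀ z ∈ dirs, 0 ≤ quad R (x + z)) (x) (hx : x ∈ V) :
    0 ≤ quad R x := by
  have := hR x hx ![0, 1] (by simp [dirs])
  simpa [quad] using this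

/-- The process halts with probability tending to one. -/
lemma Proc.term {lam : ℝ} (h : 0 < lam) {μ : Measure (Stacks 2)}
    (hμ : IsStackLaw 2 (ssrwStep 2) lam μ) (c : Ph × State 2) :
    Tendsto (fun n => μ {I | P.pick (P.exec I n c).1 (P.exec I n c).2 ≠ none}) atTop (nhds 0) := by
  obtain ⟨R, hR⟩ := exists_R V
  have h7 := lamJ_pos h
  have key : ∀ n : ℕ, 0 < n → μ {I | P.pick (P.exec I n c).1 (P.exec I n c).2 ≠ none} ≤
      ENNReal.ofReal ((Mass V (quad R) c.2 / (lamJ lam / 2)) / n) := by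
    intro n hn
    have e := P.exec_law h hμ {c | P.pick c.1 c.2 ≠ none} n c
    simp only [Set.mem_setOf_eq] at e
    rw [e]
    refine ENNReal.ofReal_le_ofReal ?_
    have h1 := P.term_aux h hR n c
    have h2 : 0 ≤ P.E lam (fun c => Mass V (quad R) c.2) n c :=
      P.E_nonneg h (fun c => mass_nonneg _ _ (quad_nonneg_of hR) _) _ _
    have hn' : (0:ℝ) < n := by exact_mod_cast hn
    rw [div_div, le_div_iff₀ (by positivity)]
    nlinarith
  have lim : Tendsto (fun n : ℕ => ENNReal.ofReal ((Mass V (quad R) c.2 / (lamJ lam / 2)) / n)) atTop (nhds 0) := by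
    have := ENNReal.tendsto_ofReal (tendsto_const_div_atTop_nhds_zero_nat (Mass V (quad R) c.2 / (lamJ lam / 2)))
    simpa using this
  exact tendsto_of_tendsto_of_tendsto_of_le_of_le' tendsto_const_nhds lim (.of_forall fun _ => bot_le)
    ((eventually_gt_atTop 0).mono key)

end
end ARWP

open MeasureTheory ENNReal Filter
set_option linter.all false
namespace ARWP
open ARW

noncomputable section
open scoped Classical

/-- The events. -/
def NS (V : Finset (Site 2)) (η : Site 2 → ℕ) (x : Site 2) : Set (Stacks 2) :=
  {I | ∃ l, Legal V I (initState 2 V η) l ∧ Stable V (run V I (initState 2 V η) l).1 ∧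
    (run V I (initState 2 V η) l).1 x ≠ .sleeping}

def Vis (V : Finset (Site 2)) (η : Site 2 → ℕ) (x : Site 2) : Set (Stacks 2) :=
  {I | ∃ l, Legal V I (initState 2 V η) l ∧ x ∈ l}

inductive Ph4 : Type
  | p0 | walk (y : Site 2) | p3 | done | fail

open Ph4

def act (V : Finset (Site 2)) (c : Site 2) (s : State 2) : Prop :=
  ∃ x, x ∈ V ∧ x ≠ c ∧ 1 ≤ numActive (s.1 x)

def posn (B : Finset (Site 2)) (c y : Site 2) : Ph4 :=
  if y = c then p3 else if y ∈ B then walk y else fail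

def pickS (V : Finset (Site 2)) (c : Site 2) (s : State 2) : Option (Site 2) :=
  if h : act V c s then some h.choose
  else if c ∈ V ∧ 1 ≤ numActive (s.1 c) then some c else none

def core (V B : Finset (Site 2)) (c : Site 2) : Proc V Ph4 where
  pick p s := match p with
    | p0 => pickS V c s
    | p3 => pickS V c s
    | walk y => if y ∈ B ∧ y ≠ c ∧ y ∈ V ∧ 1 ≤ numActive (s.1 y) then some y else none
    | done => none
    | fail => none
  nph p s a := match p with
    | p0 => if act V c s ∨ numActive (s.1 c) ≠ 1 then p0 else
        match a with
        | none => done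
        | some z => if ∀ x ∈ B.erase c, s.1 x = .sleeping then posn B c (c + z) else fail
    | p3 => if act V c s ∨ numActive (s.1 c) ≠ 1 then p3 else
        match a with
        | none => done
        | some _ => fail
    | walk y => match a with
        | none => walk y
        | some z => posn B c (y + z)
    | done => done
    | fail => fail
  legal p s x h := by
    have hS : pickS V c s = some x → x ∈ V ∧ 1 ≤ numActive (s.1 x) := by
      unfold pickS
      split_ifs with h1 h2
      · intro h
        obtain rfl := Option.some.inj h
        exact ⟨h1.choose_spec.1, h1.choose_spec.2.2⟩
      · intro h
        obtain rfl := Option.some.inj h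
        exact h2
      · simp
    cases p with
    | p0 => exact hS h
    | p3 => exact hS h
    | walk y =>
      dsimp only at h
      split_ifs at h with h1
      obtain rfl := Option.some.inj h
      exact h1.2.2
    | done => simp at h
    | fail => simp at h

lemma pickS_cases {V : Finset (Site 2)} {c : Site 2} {s : State 2} {x : Site 2} (h : pickS V c s = some x) :
    (act V c s ∧ x ≠ c ∧ x ∈ V) ∨ (¬ act V c s ∧ x = c ∧ c ∈ V ∧ 1 ≤ numActive (s.1 c)) := by
  unfold pickS at h
  split_ifs at h with h1 h2
  · obtain rfl := Option.some.inj h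
    exact Or.inl ⟨h1, h1.choose_spec.2.1, h1.choose_spec.1⟩
  · obtain rfl := Option.some.inj h
    exact Or.inr ⟨h1, rfl, h2⟩

lemma pickS_none {V : Finset (Site 2)} {c : Site 2} {s : State 2} (h : pickS V c s = none) (hc : c ∈ V) :
    ¬ act V c s ∧ numActive (s.1 c) = 0 := by
  unfold pickS at h
  split_ifs at h with h1 h2
  exact ⟨h1, by by_contra h3; exact h2 ⟨hc, by omega⟩⟩

/-- The invariant. -/
def Inv (V B : Finset (Site 2)) (c : Site 2) (p : Ph4 × State 2) : Prop :=
  match p.1 with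
  | p0 => p.2.2 c = 0 ∨ 1 ≤ numActive (p.2.1 c)
  | p3 => 1 ≤ numActive (p.2.1 c)
  | walk y => y ∈ B ∧ y ≠ c ∧ 2 ≤ numActive (p.2.1 y) ∧ ∀ x ∈ B.erase c, 1 ≤ cnt (p.2.1 x)
  | done => Stable V p.2.1 ∧ p.2.1 c = .sleeping
  | fail => True

lemma stable_of_not_act {V : Finset (Site 2)} {c : Site 2} {s : State 2} (h : ¬ act V c s)
    (h0 : numActive (s.1 c) = 0) : Stable V s.1 := by
  intro x hx
  by_cases hxc : x = c
  · rw [hxc]; exact h0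
  · by_contra h3; exact h ⟨x, hx, hxc, by omega⟩

lemma inv_jump {V B : Finset (Site 2)} {c y z : Site 2} {s : State 2} (hBV : B ⊆ V) (hc : c ∈ B)
    (hy : y ∈ B) (hcnt : ∀ x ∈ B.erase c, 1 ≤ cnt (s.1 x)) (hy2 : y = c ∨ 2 ≤ numActive (s.1 y)) :
    Inv V B c (posn B c (y + z), toppleA V y (some z) s) := by
  unfold posn
  split_ifs with h1 h2
  · show 1 ≤ numActive _
    dsimp only
    rw [toppleA_some, if_pos ⟨h1 ▸ hBV hc, h1.symm⟩, numActive_add]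
    omega
  · refine ⟨h2, h1, ?_, ?_⟩
    · show 2 ≤ numActive _
      dsimp only
      rw [toppleA_some, if_pos ⟨hBV h2, rfl⟩, numActive_add]
      split_ifs with h3
      · rw [cnt_outp]
        rcases hy2 with h4 | h4
        · exact absurd (h3.trans h4) h1
        · omega
      · have := hcnt (y + z) (Finset.mem_erase.2 ⟨h1, h2⟩)
        omega
    · intro x hx
      have hx1 := hcnt x hx
      by_cases hxy : x = y
      · rcases hy2 with h4 | h4
        · exact absurd (hxy.trans h4) (Finset.ne_of_mem_erase hx)
        · have := cnt_toppleA_self V (some z) s (x := y) (by omega)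
          have h5 := numActive_le_cnt (s.1 y)
          subst hxy
          show 1 ≤ cnt ((toppleA V x (some z) s).1 x)
          omega
      · exact hx1.trans (cnt_toppleA_ne V hxy (some z) s)
  · trivial

lemma inv_step {V B : Finset (Site 2)} {c : Site 2} (hBV : B ⊆ V) (hc : c ∈ B)
    (p : Ph4 × State 2) (x : Site 2) (a : Instr 2) (hI : Inv V B c p)
    (hp : (core V B c).pick p.1 p.2 = some x) : Inv V B c ((core V B c).nxt p x a) := by
  obtain ⟨p, s⟩ := p
  dsimp only at hp
  cases p with
  | p0 =>
    have hp : pickS V c s = some x := hp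
    have hI : s.2 c = 0 ∨ 1 ≤ numActive (s.1 c) := hI
    rcases pickS_cases hp with ⟨h1, h2, h3⟩ | ⟨h1, rfl, h3, h4⟩
    · have e : (core V B c).nxt (p0, s) x a = (p0, toppleA V x a s) := by
        simp [Proc.nxt, core, h1]
      rw [e]
      show (toppleA V x a s).2 c = 0 ∨ 1 ≤ numActive ((toppleA V x a s).1 c)
      rcases hI with hI | hI
      · left; rw [toppleA_snd, Function.update_of_ne (Ne.symm h2)]; exact hI
      · right; exact hI.trans (numActive_toppleA_ne V (Ne.symm h2) a s)
    · by_cases h5 : numActive (s.1 x) = 1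
      · cases a with
        | none =>
          have e : (core V B x).nxt (p0, s) x none = (done, toppleA V x none s) := by
            simp [Proc.nxt, core, h1, h5]
          rw [e]
          have h6 : (toppleA V x none s).1 x = .sleeping := by
            rw [toppleA_none, if_pos rfl, slp, if_pos h5]
          refine ⟨?_, h6⟩
          apply stable_of_not_act (c := x)
          · rintro ⟨w, hw1, hw2, hw3⟩
            rw [toppleA_none, if_neg hw2] at hw3
            exact h1 ⟨w, hw1, hw2, hw3⟩
          · dsimp only; rw [h6]; rfl
        | some z =>
          by_cases h6 : ∀ w ∈ B.erase x, s.1 w = .sleeping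
          · have e : (core V B x).nxt (p0, s) x (some z) = (posn B x (x + z), toppleA V x (some z) s) := by
              simp only [Proc.nxt, core, h1, h5]
              rw [if_neg (by simp), if_pos h6]
            rw [e]
            exact inv_jump hBV hc hc (fun w hw => by rw [h6 w hw]; exact le_rfl) (Or.inl rfl)
          · have e : (core V B x).nxt (p0, s) x (some z) = (fail, toppleA V x (some z) s) := by
              simp only [Proc.nxt, core, h1, h5]
              rw [if_neg (by simp), if_neg h6]
            rw [e]; trivial
      · have e : (core V B x).nxt (p0, s) x a = (p0, toppleA V x a s) := by
          simp [Proc.nxt, core, h5]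
        rw [e]
        right
        have := numActive_toppleA_self V a s (x := x) (by omega)
        dsimp only
        omega
  | p3 =>
    have hp : pickS V c s = some x := hp
    have hI : 1 ≤ numActive (s.1 c) := hI
    rcases pickS_cases hp with ⟨h1, h2, h3⟩ | ⟨h1, rfl, h3, h4⟩
    · have e : (core V B c).nxt (p3, s) x a = (p3, toppleA V x a s) := by
        simp [Proc.nxt, core, h1]
      rw [e]
      show 1 ≤ numActive ((toppleA V x a s).1 c)
      exact hI.trans (numActive_toppleA_ne V (Ne.symm h2) a s)
    · by_cases h5 : numActive (s.1 x) = 1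
      · cases a with
        | none =>
          have e : (core V B x).nxt (p3, s) x none = (done, toppleA V x none s) := by
            simp [Proc.nxt, core, h1, h5]
          rw [e]
          have h6 : (toppleA V x none s).1 x = .sleeping := by
            rw [toppleA_none, if_pos rfl, slp, if_pos h5]
          refine ⟨?_, h6⟩
          apply stable_of_not_act (c := x)
          · rintro ⟨w, hw1, hw2, hw3⟩
            rw [toppleA_none, if_neg hw2] at hw3
            exact h1 ⟨w, hw1, hw2, hw3⟩
          · dsimp only; rw [h6]; rfl
        | some z =>
          have e : (core V B x).nxt (p3, s) x (some z) = (fail, toppleA V x (some z) s) := by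
            simp [Proc.nxt, core, h1, h5]
          rw [e]; trivial
      · have e : (core V B x).nxt (p3, s) x a = (p3, toppleA V x a s) := by
          simp [Proc.nxt, core, h5]
        rw [e]
        show 1 ≤ numActive ((toppleA V x a s).1 x)
        have := numActive_toppleA_self V a s (x := x) (by omega)
        omega
  | walk y =>
    have hp : (if y ∈ B ∧ y ≠ c ∧ y ∈ V ∧ 1 ≤ numActive (s.1 y) then some y else none) = some x := hp
    obtain ⟨i1, i2, i3, i4⟩ := hI
    dsimp only at i3 i4
    split_ifs at hp with h1
    obtain rfl := Option.some.inj hp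
    cases a with
    | none =>
      refine ⟨i1, i2, ?_, ?_⟩
      · show 2 ≤ numActive ((toppleA V y none s).1 y)
        rw [toppleA_none, if_pos rfl, slp_of_two i3]; exact i3
      · intro w hw
        show 1 ≤ cnt ((toppleA V y none s).1 w)
        rw [toppleA_none]
        split_ifs with h2
        · rw [cnt_slp, ← h2]; exact i4 w hw
        · exact i4 w hw
    | some z => exact inv_jump hBV hc i1 i4 (Or.inr i3)
  | done => simp [core] at hp
  | fail => simp [core] at hp

def PhiP (lam eb : ℝ) (e : Site 2 → ℝ) : Ph4 → ℝ
  | p0 => lamJ lam * (lamJ lam + eb)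
  | walk y => lamJ lam + e y
  | p3 => lamJ lam
  | done => 0
  | fail => 1

structure CoreHyp (B : Finset (Site 2)) (c : Site 2) (e : Site 2 → ℝ) (eb : ℝ) : Prop where
  mem : c ∈ B
  nn : ∀ y, 0 ≤ e y
  off : ∀ y, y ∉ B → 1 ≤ e y
  sup : ∀ y ∈ B, y ≠ c → ∑ z ∈ dirs, e (y + z) ≤ 4 * e y
  ctr : ∑ z ∈ dirs, e (c + z) ≤ 4 * eb

variable {V B : Finset (Site 2)} {c : Site 2} {e : Site 2 → ℝ} {eb : ℝ}

def bad (B : Finset (Site 2)) (c : Site 2) (x : Site 2) : Set (Ph4 × State 2) :=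
  {p | p.1 = done ∧ p.2.1 x ≠ .sleeping}

lemma PhiP_posn {lam : ℝ} (h : 0 < lam) (H : CoreHyp B c e eb) (y : Site 2) :
    PhiP lam eb e (posn B c y) ≤ lamJ lam + e y := by
  have := lamJ_pos h
  unfold posn
  split_ifs with h1 h2
  · have := H.nn y; simp [PhiP, this]
  · simp [PhiP]
  · have := H.off y h2; simp only [PhiP]; linarith

lemma PhiP_nonneg {lam : ℝ} (h : 0 < lam) (H : CoreHyp B c e eb) (p : Ph4) : 0 ≤ PhiP lam eb e p := by
  have := lamJ_pos h
  have h1 := H.ctr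
  have h2 : 0 ≤ ∑ z ∈ dirs, e (c + z) := Finset.sum_nonneg fun _ _ => H.nn _
  have h3 : 0 ≤ eb := by linarith
  cases p <;> simp only [PhiP]
  · positivity
  · have := H.nn ‹Site 2›; positivity
  · positivity
  · exact le_rfl
  · exact zero_le_one

lemma core_est {lam : ℝ} (h : 0 < lam) (H : CoreHyp B c e eb) (n : ℕ) (p : Ph4 × State 2) :
    (core V B c).E lam ({p : Ph4 × State 2 | p.1 = fail}.indicator 1) n p ≤ PhiP lam eb e p.1 +
      lamJ lam / lamS lam * (core V B c).E lam (fun p => ∑ x ∈ B.erase c, (bad B c x).indicator 1 p) n p := by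
  have hJ := lamJ_pos h
  have hS := lamS_pos h
  have hw : ∀ p : Ph4 × State 2, 0 ≤ ∑ x ∈ B.erase c, (bad B c x).indicator (1 : Ph4 × State 2 → ℝ) p := fun p =>
    Finset.sum_nonneg fun x _ => Set.indicator_nonneg (by simp) p
  have hW : ∀ n p, 0 ≤ (core V B c).E lam (fun p => ∑ x ∈ B.erase c, (bad B c x).indicator 1 p) n p :=
    fun n p => (core V B c).E_nonneg h hw n p
  have hbase : ∀ p : Ph4 × State 2, ({p : Ph4 × State 2 | p.1 = fail}.indicator (1 : Ph4 × State 2 → ℝ)) p ≤ PhiP lam eb e p.1 +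
      lamJ lam / lamS lam * ∑ x ∈ B.erase c, (bad B c x).indicator 1 p := by
    intro p
    have h1 := hw p
    have h2 := PhiP_nonneg h H p.1
    by_cases hf : p.1 = fail
    · simp only [Set.indicator, Set.mem_setOf_eq, hf, if_true, PhiP]
      have : 0 ≤ lamJ lam / lamS lam * ∑ x ∈ B.erase c, (bad B c x).indicator 1 p := by positivity
      simpa [Set.indicator] using this
    · rw [Set.indicator_of_notMem (by simpa using hf)]
      positivity
  induction n generalizing p with
  | zero => exact hbase p
  | succ n ih =>
    cases hp : (core V B c).pick p.1 p.2 with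
    | none => rw [Proc.E_none _ _ _ _ _ hp, Proc.E_none _ _ _ _ _ hp]; exact hbase p
    | some x =>
      rw [Proc.E_some _ _ _ _ _ _ hp, Proc.E_some _ _ _ _ _ _ hp]
      have main : avg lam (fun a => PhiP lam eb e ((core V B c).nph p.1 p.2 a)) ≤ PhiP lam eb e p.1 →
        avg lam (fun a => (core V B c).E lam ({p : Ph4 × State 2 | p.1 = fail}.indicator 1) n ((core V B c).nxt p x a)) ≤
        PhiP lam eb e p.1 + lamJ lam / lamS lam *
         avg lam (fun a => (core V B c).E lam (fun p => ∑ x ∈ B.erase c, (bad B c x).indicator 1 p) n ((core V B c).nxt p x a)) := by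
        intro h1
        refine (avg_mono h (ψ := fun a => PhiP lam eb e ((core V B c).nxt p x a).1 + lamJ lam / lamS lam * (core V B c).E lam (fun p => ∑ x ∈ B.erase c, (bad B c x).indicator 1 p) n ((core V B c).nxt p x a)) (ih _) (fun z _ => ih _)).trans ?_
        rw [avg_add, avg_smul]
        exact add_le_add_left h1 _
      have hc : ∀ p', (∀ a, (core V B c).nph p.1 p.2 a = p') → p.1 = p' → 
          avg lam (fun a => PhiP lam eb e ((core V B c).nph p.1 p.2 a)) ≤ PhiP lam eb e p.1 := by
        intro p' h1 h2
        simp only [h1]; rw [avg_const h, h2]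
      obtain ⟨p, s⟩ := p
      dsimp only at hp main hc ⊢
      cases p with
      | p0 =>
        have hp : pickS V c s = some x := hp
        by_cases hh : act V c s ∨ numActive (s.1 c) ≠ 1
        · exact main (hc p0 (fun a => by simp [core, hh]) rfl)
        · have hh1 : ¬ act V c s := fun h => hh (Or.inl h)
          rcases pickS_cases hp with ⟨h1, h2, h3⟩ | ⟨h1, rfl, h3, h4⟩
          · exact absurd h1 hh1
          have nph_none : (core V B x).nph p0 s none = done := by simp only [core]; rw [if_neg hh]
          have nph_some : ∀ z, (core V B x).nph p0 s (some z) = 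
            if ∀ w ∈ B.erase x, s.1 w = .sleeping then posn B x (x + z) else fail := by
            intro z; simp only [core]; rw [if_neg hh]
          by_cases h6 : ∀ w ∈ B.erase x, s.1 w = .sleeping
          · apply main
            unfold avg
            simp only [nph_none, nph_some, if_pos h6]
            have h7 : ∑ z ∈ dirs, PhiP lam eb e (posn B x (x + z)) ≤ ∑ z ∈ dirs, (lamJ lam + e (x + z)) :=
              Finset.sum_le_sum fun z _ => PhiP_posn h H _
            rw [Finset.sum_add_distrib, Finset.sum_const] at h7
            have h8 : dirs.card = 4 := by rw [Finset.card_eq_sum_ones, sum_dirs]; norm_num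
            rw [h8, nsmul_eq_mul] at h7
            have h9 := H.ctr
            simp only [PhiP] at *
            have := mul_le_mul_of_nonneg_left (h7.trans (add_le_add_right h9 _)) (show 0 ≤ lamJ lam / 4 by positivity)
            push_cast at this
            linarith
          · refine le_trans (b := lamJ lam) ?_ ?_
            · unfold avg
              have e1 : (core V B x).E lam ({p : Ph4 × State 2 | p.1 = fail}.indicator 1) n ((core V B x).nxt (p0, s) x none) = 0 := by
                rw [Proc.E_none]
                · simp [Proc.nxt, nph_none]
                · simp only [Proc.nxt, nph_none]; rfl
              have e2 : ∀ z, (core V B x).E lam ({p : Ph4 × State 2 | p.1 = fail}.indicator 1) n ((core V B x).nxt (p0, s) x (some z)) = 1 := by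
                intro z
                rw [Proc.E_none]
                · simp only [Proc.nxt, nph_some, if_neg h6]; simp
                · simp only [Proc.nxt, nph_some, if_neg h6]; rfl
              simp only [e1, e2]
              rw [sum_dirs]
              linarith
            · have e1 : 1 ≤ (core V B x).E lam (fun p => ∑ x' ∈ B.erase x, (bad B x x').indicator 1 p) n ((core V B x).nxt (p0, s) x none) := by
                rw [Proc.E_none]
                · push Not at h6
                  obtain ⟨w, hw1, hw2⟩ := h6
                  have := Finset.single_le_sum (f := fun x' => (bad B x x').indicator (1 : Ph4 × State 2 → ℝ) ((core V B x).nxt (p0, s) x none))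
                    (fun i _ => Set.indicator_nonneg (by simp) _) hw1
                  refine le_trans ?_ this
                  have hm : (core V B x).nxt (p0, s) x none ∈ bad B x w := by
                    refine ⟨nph_none, ?_⟩
                    show (toppleA V x none s).1 w ≠ .sleeping
                    rw [toppleA_none, if_neg (Finset.ne_of_mem_erase hw1)]
                    exact hw2
                  rw [Set.indicator_of_mem hm]; exact le_rfl
                · simp only [Proc.nxt, nph_none]; rfl
              have h7 := PhiP_nonneg h H p0
              have h8 : lamS lam ≤ avg lam (fun a => (core V B x).E lam (fun p => ∑ x' ∈ B.erase x, (bad B x x').indicator 1 p) n ((core V B x).nxt (p0, s) x a)) := by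
                unfold avg
                have h9 := mul_le_mul_of_nonneg_left e1 hS.le
                have h10 : 0 ≤ lamJ lam / 4 * ∑ z ∈ dirs, (core V B x).E lam (fun p => ∑ x' ∈ B.erase x, (bad B x x').indicator 1 p) n ((core V B x).nxt (p0, s) x (some z)) :=
                  mul_nonneg (by positivity) (Finset.sum_nonneg fun _ _ => hW _ _)
                linarith
              have h9 := mul_le_mul_of_nonneg_left h8 (show 0 ≤ lamJ lam / lamS lam by positivity)
              rw [div_mul_cancel₀ _ hS.ne'] at h9
              linarith
      | p3 =>
        have hp : pickS V c s = some x := hp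
        apply main
        by_cases hh : act V c s ∨ numActive (s.1 c) ≠ 1
        · exact (hc p3 (fun a => by simp [core, hh]) rfl)
        · unfold avg
          have nph_none : (core V B c).nph p3 s none = done := by simp only [core]; rw [if_neg hh]
          have nph_some : ∀ z, (core V B c).nph p3 s (some z) = fail := by
            intro z; simp only [core]; rw [if_neg hh]
          simp only [nph_none, nph_some, PhiP]
          rw [sum_dirs]
          linarith
      | walk y =>
        have hp : (if y ∈ B ∧ y ≠ c ∧ y ∈ V ∧ 1 ≤ numActive (s.1 y) then some y else none) = some x := hp
        split_ifs at hp with h1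
        obtain rfl := Option.some.inj hp
        apply main
        have nph_none : (core V B c).nph (walk y) s none = walk y := rfl
        have nph_some : ∀ z, (core V B c).nph (walk y) s (some z) = posn B c (y + z) := fun z => rfl
        unfold avg
        simp only [nph_none, nph_some]
        have h7 : ∑ z ∈ dirs, PhiP lam eb e (posn B c (y + z)) ≤ ∑ z ∈ dirs, (lamJ lam + e (y + z)) :=
              Finset.sum_le_sum fun z _ => PhiP_posn h H _
        rw [Finset.sum_add_distrib, Finset.sum_const] at h7
        have h8 : dirs.card = 4 := by rw [Finset.card_eq_sum_ones, sum_dirs]; norm_num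
        rw [h8, nsmul_eq_mul] at h7
        have h9 := H.sup y h1.1 h1.2.1
        have h10 := lam_sum h
        have := mul_le_mul_of_nonneg_left (h7.trans (add_le_add_right h9 _)) (show 0 ≤ lamJ lam / 4 by positivity)
        push_cast at this
        have hPw : PhiP lam eb e (walk y) = lamJ lam + e y := rfl
        rw [hPw]
        have h11 : lamJ lam / 4 * (4 * lamJ lam + 4 * e y) = (1 - lamS lam) * (lamJ lam + e y) := by
          rw [← h10]; ring
        rw [h11] at this
        linarith
      | done => simp [core] at hp
      | fail => simp [core] at hp

/-- The core estimate. -/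
theorem core_main {lam : ℝ} (h : 0 < lam) {μ : Measure (Stacks 2)}
    (hμ : IsStackLaw 2 (ssrwStep 2) lam μ) (η : Site 2 → ℕ) (hBV : B ⊆ V) (H : CoreHyp B c e eb) :
    μ (Vis V η c ∩ NS V η c) ≤ ENNReal.ofReal (lamJ lam * (lamJ lam + eb)) +
      ENNReal.ofReal (lamJ lam / lamS lam) * ∑ x ∈ B.erase c, μ (NS V η x) := by
  haveI := hμ.1
  set P := core V B c with hP
  set s0 : Ph4 × State 2 := (p0, initState 2 V η) with hs0
  have hJ := lamJ_pos h
  have hS := lamS_pos h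
  have hcV := hBV H.mem
  have hinv : ∀ I n, Inv V B c (P.exec I n s0) := fun I n =>
    P.exec_inv (Inv V B c) (fun p x a hI hp => inv_step hBV H.mem p x a hI hp) I n s0 (Or.inl rfl)
  have key : ∀ n, μ (Vis V η c ∩ NS V η c) ≤ (ENNReal.ofReal (lamJ lam * (lamJ lam + eb)) +
      ENNReal.ofReal (lamJ lam / lamS lam) * ∑ x ∈ B.erase c, μ (NS V η x)) +
        μ {I | P.pick (P.exec I n s0).1 (P.exec I n s0).2 ≠ none} := by
    intro n
    have h1 : Vis V η c ∩ NS V η c ⊆ {I | P.exec I n s0 ∈ {p : Ph4 × State 2 | p.1 = fail}} ∪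
        {I | P.pick (P.exec I n s0).1 (P.exec I n s0).2 ≠ none} := by
      rintro I ⟨⟨l1, hl1, hl1'⟩, l2, hl2, hl2', hl2''⟩
      by_contra hcon
      simp only [Set.mem_union, Set.mem_setOf_eq, not_or, not_not] at hcon
      obtain ⟨hn1, hn2⟩ := hcon
      obtain ⟨l, hl, hrun, -⟩ := P.exec_run I n s0
      have hi := hinv I n
      have hsnd := run_snd V I s0.2 l c
      rw [← hrun] at hsnd
      have hsnd0 : s0.2.2 c = 0 := rfl
      rw [hsnd0] at hsnd
      have hrun' : (P.exec I n s0).2 = run V I (initState 2 V η) l := hrun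
      generalize P.exec I n s0 = p at *
      obtain ⟨p, s⟩ := p
      dsimp only at hn1 hn2 hrun hrun' hsnd
      cases p with
      | p0 =>
        have hn2 : pickS V c s = none := hn2
        obtain ⟨i1, i2⟩ := pickS_none hn2 hcV
        have hi : s.2 c = 0 ∨ 1 ≤ numActive (s.1 c) := hi
        have hst := stable_of_not_act i1 i2
        have h0 : s.2 c = 0 := by omega
        rw [hrun'] at hst
        have := (abelian V I _ l1 l hl1 hl hst).1 c
        have h2 := List.count_pos_iff.2 hl1'
        omega
      | p3 =>
        have hn2 : pickS V c s = none := hn2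
        obtain ⟨i1, i2⟩ := pickS_none hn2 hcV
        have hi : 1 ≤ numActive (s.1 c) := hi
        omega
      | walk y =>
        obtain ⟨j1, j2, j3, j4⟩ := hi
        dsimp only at j3
        have hn2 : (if y ∈ B ∧ y ≠ c ∧ y ∈ V ∧ 1 ≤ numActive (s.1 y) then some y else none) = none := hn2
        rw [if_pos ⟨j1, j2, hBV j1, by omega⟩] at hn2
        simp at hn2
      | done =>
        obtain ⟨j1, j2⟩ := hi
        dsimp only at j1 j2
        rw [hrun'] at j1 j2
        rw [← (abelian V I _ l l2 hl hl2 hl2').2.2 j1] at hl2''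
        exact hl2'' j2
      | fail => exact hn1 rfl
    refine (measure_mono h1).trans ((measure_union_le _ _).trans ?_)
    gcongr
    rw [P.exec_law h hμ]
    have h2 := core_est (V := V) h H n s0
    refine (ENNReal.ofReal_le_ofReal h2).trans ?_
    refine ENNReal.ofReal_add_le.trans ?_
    rw [ENNReal.ofReal_mul (by positivity)]
    refine add_le_add le_rfl (mul_le_mul_right ?_ _)
    rw [Proc.E_sum _ _ _ _ _ _ h, ENNReal.ofReal_sum_of_nonneg
      (fun x _ => Proc.E_nonneg _ h (fun p => Set.indicator_nonneg (by simp) p) _ _)]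
    refine Finset.sum_le_sum fun x _ => ?_
    have h3 := P.exec_law h hμ (bad B c x) n s0
    have h4 : ENNReal.ofReal ((core V B c).E lam ((bad B c x).indicator 1) n s0) = μ {I | P.exec I n s0 ∈ bad B c x} := h3.symm
    refine (le_of_eq h4).trans (measure_mono ?_)
    rintro I ⟨hI1, hI2⟩
    obtain ⟨l, hl, hrun, -⟩ := P.exec_run I n s0
    have hi := hinv I n
    have hrun' : (P.exec I n s0).2 = run V I (initState 2 V η) l := hrun
    generalize P.exec I n s0 = p at *
    obtain ⟨p, s⟩ := p
    dsimp only at hI1 hI2 hrun'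
    subst hI1
    obtain ⟨j1, j2⟩ := hi
    dsimp only at j1
    refine ⟨l, hl, ?_, ?_⟩
    · rw [← hrun']; exact j1
    · rw [← hrun']; exact hI2
  have lim := (tendsto_const_nhds (x := ENNReal.ofReal (lamJ lam * (lamJ lam + eb)) +
      ENNReal.ofReal (lamJ lam / lamS lam) * ∑ x ∈ B.erase c, μ (NS V η x))).add (P.term h hμ s0)
  rw [add_zero] at lim
  exact ge_of_tendsto' lim key

end
end ARWP

open MeasureTheory ENNReal Filter
set_option linter.all false
namespace ARWP
open ARW

noncomputable section
open scoped Classical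

/-! ### Almost sure stabilization -/

def topp (V : Finset (Site 2)) : Proc V Unit where
  pick _ s := if h : ∃ x, x ∈ V ∧ 1 ≤ numActive (s.1 x) then some h.choose else none
  nph _ _ _ := ()
  legal p s x h := by
    split_ifs at h with h1
    obtain rfl := Option.some.inj h
    exact h1.choose_spec

lemma topp_none {V : Finset (Site 2)} {p : Unit} {s : State 2} (h : (topp V).pick p s = none) : Stable V s.1 := by
  simp only [topp] at h
  split_ifs at h with h1
  intro x hx
  by_contra h3
  exact h1 ⟨x, hx, by omega⟩

lemma stab_ae {lam : ℝ} (h : 0 < lam) {μ : Measure (Stacks 2)}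
    (hμ : IsStackLaw 2 (ssrwStep 2) lam μ) (V : Finset (Site 2)) (η : Site 2 → ℕ) :
    ∀ᵐ I ∂μ, ∃ l, Legal V I (initState 2 V η) l ∧ Stable V (run V I (initState 2 V η) l).1 := by
  rw [ae_iff]
  refine le_antisymm (ge_of_tendsto' ((topp V).term h hμ ((), initState 2 V η)) fun n => measure_mono ?_) bot_le
  intro I hI hc
  apply hI
  obtain ⟨l, h1, h2, -⟩ := (topp V).exec_run I n ((), initState 2 V η)
  exact ⟨l, h1, h2 ▸ topp_none hc⟩

/-! ### Measurability -/

abbrev Om := (Site 2 → ℕ) × Stacks 2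

lemma meas_dep (F : Finset (Site 2)) (G : Finset (Site 2 × ℕ)) (S : Set Om)
    (h : ∀ η η' I I', (∀ x ∈ F, η x = η' x) → (∀ i ∈ G, I i = I' i) → (η, I) ∈ S → (η', I') ∈ S) :
    MeasurableSet S := by
  let f : Om → (F → ℕ) × (G → Instr 2) := fun p => (fun x => p.1 x, fun i => p.2 i)
  have hf : Measurable f := by fun_prop
  have : S = f ⁻¹' (f '' S) := by
    refine Set.Subset.antisymm (Set.subset_preimage_image _ _) ?_
    rintro ⟨η', I'⟩ ⟨⟨η, I⟩, hS, he⟩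
    have h1 := congrArg Prod.fst he
    have h2 := congrArg Prod.snd he
    exact h η η' I I' (fun x hx => congrFun h1 ⟨x, hx⟩) (fun i hi => congrFun h2 ⟨i, hi⟩) hS
  rw [this]
  exact hf ((Set.to_countable _).measurableSet)

lemma meas_dep' (G : Finset (Site 2 × ℕ)) (S : Set (Stacks 2))
    (h : ∀ I I', (∀ i ∈ G, I i = I' i) → I ∈ S → I' ∈ S) :
    ∃ T : Set (G → Instr 2), MeasurableSet T ∧ S = (fun I (i : G) => I i) ⁻¹' T := by
  refine ⟨(fun I (i : G) => I i) '' S, (Set.to_countable _).measurableSet, ?_⟩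
  refine Set.Subset.antisymm (Set.subset_preimage_image _ _) ?_
  rintro I' ⟨I, hS, he⟩
  exact h I I' (fun i hi => congrFun he ⟨i, hi⟩) hS

lemma indep_dep {lam : ℝ} (hl : 0 < lam) {μ : Measure (Stacks 2)}
    (hμ : IsStackLaw 2 (ssrwStep 2) lam μ) (G G' : Finset (Site 2 × ℕ)) (hd : Disjoint G G') (S S' : Set (Stacks 2))
    (h : ∀ I I', (∀ i ∈ G, I i = I' i) → I ∈ S → I' ∈ S)
    (h' : ∀ I I', (∀ i ∈ G', I i = I' i) → I ∈ S' → I' ∈ S') : μ (S ∩ S') = μ S * μ S' := by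
  haveI := instLaw_prob hl
  have e : μ = Measure.infinitePi (fun _ => instLaw lam) :=
    (law_unique hμ (stackLaw_spec hl)).trans (stackLaw_eq hl)
  have h1 : ProbabilityTheory.iIndepFun (fun (i : Site 2 × ℕ) (I : Stacks 2) => I i)
      (Measure.infinitePi (fun _ => instLaw lam)) :=
    ProbabilityTheory.iIndepFun_infinitePi (P := fun _ => instLaw lam) (X := fun i a => a) (fun i => measurable_id)
  have h2 := h1.indepFun_finset G G' hd (fun i => measurable_pi_apply i)
  obtain ⟨T, hT, rfl⟩ := meas_dep' G S h
  obtain ⟨T', hT', rfl⟩ := meas_dep' G' S' h'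
  rw [e]
  exact h2.measure_inter_preimage_eq_mul _ _ hT hT'

lemma init_congr {V : Finset (Site 2)} {η η' : Site 2 → ℕ} (h : ∀ x ∈ V, η x = η' x) :
    initState 2 V η = initState 2 V η' := by
  unfold initState
  congr 1
  funext x
  split_ifs with hx
  · rw [h x hx]
  · rfl

def LQ (V : Finset (Site 2)) (l : List (Site 2)) (Q : State 2 → Prop) : Set Om :=
  {p | Legal V p.2 (initState 2 V p.1) l ∧ Q (run V p.2 (initState 2 V p.1) l)}

lemma LQ_dep (V : Finset (Site 2)) (l : List (Site 2)) (Q : State 2 → Prop) (n : ℕ) (hn : l.length ≤ n)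
    (η η' : Site 2 → ℕ) (I I' : Stacks 2)
    (h1 : ∀ x ∈ V, η x = η' x) (h2 : ∀ i ∈ V ×ˢ Finset.range n, I i = I' i) (h3 : (η, I) ∈ LQ V l Q) :
    (η', I') ∈ LQ V l Q := by
  have hlV : ∀ (l : List (Site 2)) s, Legal V I s l → ∀ x ∈ l, x ∈ V := by
    intro l
    induction l with
    | nil => simp
    | cons y l ih =>
      intro s hl x hx
      rcases List.mem_cons.1 hx with rfl | hx
      · exact hl.1
      · exact ih _ hl.2.2 x hx
  obtain ⟨h3, h4⟩ := h3
  dsimp only at h3 h4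
  obtain ⟨e1, e2⟩ := run_congr V I I' (initState 2 V η) l (fun x hx k hk => h2 _ (by
    simp only [Finset.mem_product, Finset.mem_range]
    refine ⟨hlV l _ h3 x hx, ?_⟩
    have : (initState 2 V η).2 x = 0 := rfl
    omega))
  refine ⟨?_, ?_⟩
  · show Legal V I' (initState 2 V η') l
    rw [← init_congr h1]; exact e2 h3
  · show Q (run V I' (initState 2 V η') l)
    rw [← init_congr h1, ← e1]; exact h4

lemma LQ_meas (V : Finset (Site 2)) (l : List (Site 2)) (Q : State 2 → Prop) : MeasurableSet (LQ V l Q) :=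
  meas_dep V (V ×ˢ Finset.range l.length) _ (fun η η' I I' h1 h2 h3 => LQ_dep V l Q _ le_rfl η η' I I' h1 h2 h3)

lemma NSJ_meas (V : Finset (Site 2)) (x : Site 2) : MeasurableSet {p : Om | p.2 ∈ NS V p.1 x} := by
  have : {p : Om | p.2 ∈ NS V p.1 x} = ⋃ l : List (Site 2), LQ V l (fun s => Stable V s.1 ∧ s.1 x ≠ .sleeping) := by
    ext p; simp only [NS, LQ, Set.mem_setOf_eq, Set.mem_iUnion]
  rw [this]
  exact MeasurableSet.iUnion fun l => LQ_meas _ _ _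

lemma VisJ_meas (V : Finset (Site 2)) (x : Site 2) : MeasurableSet {p : Om | p.2 ∈ Vis V p.1 x} := by
  have : {p : Om | p.2 ∈ Vis V p.1 x} = ⋃ l : List (Site 2), LQ V l (fun s => x ∈ l) := by
    ext p; simp only [Vis, LQ, Set.mem_setOf_eq, Set.mem_iUnion]
  rw [this]
  exact MeasurableSet.iUnion fun l => LQ_meas _ _ _

/-- Site `x` topples at least `k` times. -/
def GJ (k : ℕ) (x : Site 2) : Set Om := ⋃ V : Finset (Site 2), ⋃ l : List (Site 2), LQ V l (fun _ => k ≤ l.count x)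

lemma GJ_meas (k : ℕ) (x : Site 2) : MeasurableSet (GJ k x) :=
  MeasurableSet.iUnion fun V => MeasurableSet.iUnion fun l => LQ_meas _ _ _

/-- Site `x` topples infinitely often. -/
def AJ (x : Site 2) : Set Om := ⋂ k, GJ k x

lemma AJ_meas (x : Site 2) : MeasurableSet (AJ x) := MeasurableSet.iInter fun k => GJ_meas k x

lemma mem_GJ {k : ℕ} {x : Site 2} {p : Om} : p ∈ GJ k x ↔
    ∃ V l, Legal V p.2 (initState 2 V p.1) l ∧ k ≤ l.count x := by
  simp only [GJ, LQ, Set.mem_iUnion, Set.mem_setOf_eq]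

lemma mem_AJ_iff {p : Om} : p ∈ AJ 0 ↔ odom0 p.2 p.1 = ⊤ := by
  rw [AJ, Set.mem_iInter]
  constructor
  · intro h
    rw [ENat.eq_top_iff_forall_ge]
    intro k
    obtain ⟨V, l, h1, h2⟩ := mem_GJ.1 (h k)
    unfold odom0
    refine le_trans (show (k : ℕ∞) ≤ (l.count 0 : ℕ∞) by exact_mod_cast h2) ?_
    exact le_iSup_of_le V (le_iSup_of_le l (le_iSup_of_le h1 le_rfl))
  · intro h k
    rw [mem_GJ]
    by_contra hc
    push Not at hc
    have : odom0 p.2 p.1 ≤ (k : ℕ∞) := by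
      unfold odom0
      refine iSup_le fun V => iSup_le fun l => iSup_le fun hl => ?_
      exact_mod_cast (hc V l hl).le
    rw [h] at this
    exact absurd this (by simp)

/-! ### Shifts -/

def tau (z : Site 2) (I : Stacks 2) : Stacks 2 := fun i => I (i.1 + z, i.2)

def shS (z : Site 2) (s : State 2) : State 2 := (fun x => s.1 (x + z), fun x => s.2 (x + z))

def shV (z : Site 2) (V : Finset (Site 2)) : Finset (Site 2) := V.map (addRightEmbedding z)

lemma mem_shV {z x : Site 2} {V : Finset (Site 2)} : x + z ∈ shV z V ↔ x ∈ V := by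
  simp [shV]

lemma topple_sh (V : Finset (Site 2)) (z x : Site 2) (I : Stacks 2) (s : State 2) :
    topple V (tau z I) x (shS z s) = shS z (topple (shV z V) I (x + z) s) := by
  rw [topple_eq, topple_eq]
  have e : tau z I (x, (shS z s).2 x) = I (x + z, s.2 (x + z)) := rfl
  rw [e]
  generalize I (x + z, s.2 (x + z)) = a
  refine Prod.ext ?_ ?_
  · funext y
    cases a with
    | none =>
      show _ = (toppleA (shV z V) (x + z) none s).1 (y + z)
      rw [toppleA_none, toppleA_none]
      simp [shS]
    | some w =>
      show _ = (toppleA (shV z V) (x + z) (some w) s).1 (y + z)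
      rw [toppleA_some, toppleA_some]
      have e2 : x + z + w = x + w + z := by abel
      rw [e2]
      have e3 : (y + z = x + w + z) = (y = x + w) := propext (add_left_inj z)
      have e4 : (y + z = x + z) = (y = x) := propext (add_left_inj z)
      simp only [mem_shV, e3, e4, shS]
  · funext y
    show _ = (toppleA (shV z V) (x + z) a s).2 (y + z)
    rw [toppleA_snd, toppleA_snd, Function.update_apply, Function.update_apply]
    simp [shS]

lemma run_sh (V : Finset (Site 2)) (z : Site 2) (I : Stacks 2) (s : State 2) (l : List (Site 2)) :
    run V (tau z I) (shS z s) l = shS z (run (shV z V) I s (l.map (· + z))) := by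
  induction l generalizing s with
  | nil => rfl
  | cons x l ih => simp only [run, List.map_cons]; rw [topple_sh, ih]

lemma legal_sh (V : Finset (Site 2)) (z : Site 2) (I : Stacks 2) (s : State 2) (l : List (Site 2)) :
    Legal V (tau z I) (shS z s) l ↔ Legal (shV z V) I s (l.map (· + z)) := by
  induction l generalizing s with
  | nil => simp [Legal]
  | cons x l ih => simp only [Legal, List.map_cons]; rw [topple_sh, ih, mem_shV]; rfl

lemma init_sh (V : Finset (Site 2)) (z : Site 2) (η : Site 2 → ℕ) :
    initState 2 V (shift z η) = shS z (initState 2 (shV z V) η) := by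
  unfold initState shS shift
  simp only [mem_shV]

lemma legal_init_sh (V : Finset (Site 2)) (z : Site 2) (I : Stacks 2) (η : Site 2 → ℕ) (l : List (Site 2)) :
    Legal V (tau z I) (initState 2 V (shift z η)) l ↔
      Legal (shV z V) I (initState 2 (shV z V) η) (l.map (· + z)) := by
  rw [init_sh, legal_sh]

def TT (z : Site 2) (p : Om) : Om := (shift z p.1, tau z p.2)

lemma vis_sh (V : Finset (Site 2)) (z x : Site 2) (p : Om) :
    (TT z p).2 ∈ Vis V (TT z p).1 x → p.2 ∈ Vis (shV z V) p.1 (x + z) := by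
  rintro ⟨l, h1, h2⟩
  exact ⟨l.map (· + z), (legal_init_sh ..).1 h1, List.mem_map_of_mem h2⟩

lemma tau_tau (z w : Site 2) (I : Stacks 2) : tau z (tau w I) = tau (z + w) I := by
  funext i; simp [tau, add_assoc]
lemma shift_shift (z w : Site 2) (η : Site 2 → ℕ) : shift z (shift w η) = shift (z + w) η := by
  funext i; simp [shift, add_assoc]
lemma TT_TT (z w : Site 2) (p : Om) : TT z (TT w p) = TT (z + w) p := by
  simp [TT, tau_tau, shift_shift]
lemma TT_zero (p : Om) : TT 0 p = p := by
  refine Prod.ext ?_ ?_ <;> funext i <;> simp [TT, tau, shift]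

lemma GJ_sh (k : ℕ) (z x : Site 2) (p : Om) : TT z p ∈ GJ k x ↔ p ∈ GJ k (x + z) := by
  have key : ∀ (z x : Site 2) (p : Om), TT z p ∈ GJ k x → p ∈ GJ k (x + z) := by
    intro z x p h
    obtain ⟨V, l, h1, h2⟩ := mem_GJ.1 h
    refine mem_GJ.2 ⟨shV z V, l.map (· + z), (legal_init_sh ..).1 h1, ?_⟩
    rwa [List.count_map_of_injective _ (· + z) (add_left_injective z)]
  refine ⟨key z x p, fun h => ?_⟩
  have := key (-z) (x + z) (TT z p) (by rw [TT_TT]; simpa [TT_zero] using h)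
  simpa using this

lemma AJ_sh (z x : Site 2) (p : Om) : TT z p ∈ AJ x ↔ p ∈ AJ (x + z) := by
  simp only [AJ, Set.mem_iInter, GJ_sh]

lemma tau_meas (z : Site 2) : Measurable (tau z) := by
  unfold tau; fun_prop
lemma shift_meas (z : Site 2) : Measurable (shift z : (Site 2 → ℕ) → _) := by
  unfold shift; fun_prop

lemma tau_map {lam : ℝ} (hl : 0 < lam) {μ : Measure (Stacks 2)}
    (hμ : IsStackLaw 2 (ssrwStep 2) lam μ) (z : Site 2) : μ.map (tau z) = μ := by
  haveI := hμ.1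
  refine law_unique (lam := lam) ⟨Measure.isProbabilityMeasure_map (tau_meas z).aemeasurable, fun F g => ?_⟩ hμ
  change μ.map (tau z) (Cyl F g) = _
  rw [Measure.map_apply (tau_meas z) (measurableSet_cyl F g)]
  have inj : Function.Injective (fun i : Site 2 × ℕ => (i.1 + z, i.2)) := by
    rintro ⟨a, b⟩ ⟨a', b'⟩ h
    simpa using h
  have := hμ.2 (F.map ⟨_, inj⟩) (fun i => g (i.1 - z, i.2))
  rw [Finset.prod_map] at this
  simp only [Function.Embedding.coeFn_mk, add_sub_cancel_right] at this
  rw [← this]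
  congr 1
  ext I
  simp only [Set.mem_preimage, Cyl, tau, Set.mem_setOf_eq, Finset.mem_map, Function.Embedding.coeFn_mk]
  constructor
  · rintro h i ⟨j, hj, rfl⟩
    rw [h j hj]; simp
  · intro h i hi
    rw [h _ ⟨i, hi, rfl⟩]; simp

end
end ARWP

open MeasureTheory ENNReal Filter
set_option linter.all false
namespace ARWP
open ARW

noncomputable section
open scoped Classical

lemma good_one {lam : ℝ} (hl : 0 < lam) {μ : Measure (Stacks 2)}
    (hμ : IsStackLaw 2 (ssrwStep 2) lam μ) (x z : Site 2) (hz : z ∈ dirs) (N : ℕ) :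
    ∀ᵐ I ∂μ, ∃ k ≥ N, I (x, k) = some z := by
  haveI := instLaw_prob hl
  have e : μ = Measure.infinitePi (fun _ => instLaw lam) :=
    (law_unique hμ (stackLaw_spec hl)).trans (stackLaw_eq hl)
  rw [ae_iff]
  set r := instLaw lam ({some z}ᶜ) with hr
  have hr1 : r < 1 := by
    rw [hr, prob_compl_eq_one_sub (measurableSet_singleton _), instLaw_singleton hl]
    apply ENNReal.sub_lt_self (by simp) (by simp)
    show wt lam (some z) ≠ 0
    rw [wt_some lam hl, if_pos hz]
    have := lamJ_pos hl
    simp; linarith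
  refine le_antisymm (ge_of_tendsto' (ENNReal.tendsto_pow_atTop_nhds_zero_of_lt_one hr1) fun n => ?_) bot_le
  have h1 := Measure.infinitePi_pi (fun _ : Site 2 × ℕ => instLaw lam)
    (s := (Finset.Ico N (N + n)).map ⟨fun k => (x, k), fun a b h => by simpa using h⟩)
    (t := fun _ => {some z}ᶜ) (fun i _ => (measurableSet_singleton _).compl)
  rw [Finset.prod_const, Finset.card_map, Nat.card_Ico] at h1
  simp only [add_tsub_cancel_left] at h1
  rw [hr, ← h1, e]
  refine measure_mono ?_
  intro I hI i hi
  simp only [Finset.coe_map, Function.Embedding.coeFn_mk, Set.mem_image, Finset.mem_coe, Finset.mem_Ico] at hi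
  obtain ⟨k, hk, rfl⟩ := hi
  intro h2
  exact hI ⟨k, hk.1, h2⟩

lemma good_ae {lam : ℝ} (hl : 0 < lam) {μ : Measure (Stacks 2)}
    (hμ : IsStackLaw 2 (ssrwStep 2) lam μ) :
    ∀ᵐ I ∂μ, ∀ x z, z ∈ dirs → ∀ N, ∃ k ≥ N, I (x, k) = some z := by
  rw [ae_all_iff]; intro x
  rw [ae_all_iff]; intro z
  by_cases hz : z ∈ dirs
  · have := ae_all_iff.2 (good_one hl hμ x z hz)
    filter_upwards [this] with I hI _ using hI
  · simp [hz]

lemma arrive (V : Finset (Site 2)) (I : Stacks 2) (x z : Site 2) (hz : x + z ≠ x) (hV : x + z ∈ V)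
    (l : List (Site 2)) (s : State 2) (hl : Legal V I s l) :
    cnt (s.1 (x + z)) + Nat.count (fun k => I (x, k) = some z) ((run V I s l).2 x) ≤
      cnt ((run V I s l).1 (x + z)) + l.count (x + z) + Nat.count (fun k => I (x, k) = some z) (s.2 x) := by
  induction l generalizing s with
  | nil => simp [run]
  | cons w l ih =>
    obtain ⟨h1, h2, h3⟩ := hl
    have := ih _ h3
    simp only [run]
    rw [topple_eq] at *
    rw [toppleA_snd] at this
    by_cases hw : w = x
    · subst hw
      have h5 : (w :: l).count (w + z) = l.count (w + z) := List.count_cons_of_ne (Ne.symm hz)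
      rw [Function.update_self, Nat.count_succ] at this
      have h6 : cnt (s.1 (w + z)) + (if I (w, s.2 w) = some z then 1 else 0) ≤
          cnt ((toppleA V w (I (w, s.2 w)) s).1 (w + z)) := by
        split_ifs with h7
        · rw [h7, toppleA_some, if_pos ⟨hV, rfl⟩, cnt_add, if_neg hz]
        · exact cnt_toppleA_ne V hz _ s
      omega
    · rw [Function.update_of_ne (Ne.symm hw)] at this
      by_cases hw2 : w = x + z
      · have h5 : (w :: l).count (x + z) = l.count (x + z) + 1 := by rw [hw2]; exact List.count_cons_self
        have h6 := cnt_toppleA_self V (I (w, s.2 w)) s h2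
        clear ih h1 h2 h3
        subst hw2
        omega
      · have h5 : (w :: l).count (x + z) = l.count (x + z) := List.count_cons_of_ne hw2
        have h6 := cnt_toppleA_ne V (Ne.symm hw2) (I (w, s.2 w)) s
        omega

lemma legal_replicate (V : Finset (Site 2)) (I : Stacks 2) (y : Site 2) (hy : y ∈ V) (K : ℕ) (s : State 2)
    (h : K + 1 ≤ numActive (s.1 y)) : Legal V I s (List.replicate K y) := by
  induction K generalizing s with
  | zero => trivial
  | succ K ih =>
    rw [List.replicate_succ]
    refine ⟨hy, by omega, ih _ ?_⟩
    rw [topple_eq]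
    have := numActive_toppleA_self V (I (y, s.2 y)) s (x := y) (by omega)
    omega

lemma numActive_of_cnt {a : SiteState} (h : 2 ≤ cnt a) : numActive a = cnt a := by
  cases a <;> simp_all [numActive, cnt]

lemma neighbor {I : Stacks 2} (hI : ∀ x z, z ∈ dirs → ∀ N, ∃ k ≥ N, I (x, k) = some z) (η : Site 2 → ℕ)
    (x z : Site 2) (hz : z ∈ dirs) (h : (η, I) ∈ AJ x) : (η, I) ∈ AJ (x + z) := by
  have hz0 : x + z ≠ x := by simpa using ne_zero_of_mem_dirs hz
  rw [AJ, Set.mem_iInter] at h ⊢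
  intro K
  let p : ℕ → Prop := fun k => I (x, k) = some z
  have hinf : (setOf p).Infinite := by
    rw [Set.infinite_iff_exists_gt]
    intro N
    obtain ⟨k, hk, hk'⟩ := hI x z hz (N + 1)
    exact ⟨k, hk', by omega⟩
  obtain ⟨V, l, h1, h2⟩ := mem_GJ.1 (h (Nat.nth p (2 * K + 2)))
  dsimp only at h1
  obtain ⟨W, hWe⟩ : ∃ W, W = insert (x + z) V := ⟨_, rfl⟩
  have hW : x + z ∈ W := hWe ▸ Finset.mem_insert_self _ _
  have h1' := init_legal_mono (hWe ▸ Finset.subset_insert (x + z) V : V ⊆ W) I η l h1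
  rw [mem_GJ]
  by_cases hc : K ≤ l.count (x + z)
  · exact ⟨W, l, h1', hc⟩
  · have h3 : _ + Nat.count p _ ≤ _ + _ + Nat.count p _ := arrive W I x z hz0 hW l _ h1'
    rw [run_snd] at h3
    have h4 : (initState 2 W η).2 x = 0 := rfl
    rw [h4, zero_add] at h3
    have h5 : Nat.count p (Nat.nth p (2 * K + 2)) ≤ Nat.count p (l.count x) := Nat.count_monotone _ h2
    rw [Nat.count_nth_of_infinite hinf] at h5
    rw [Nat.count_zero] at h3
    refine ⟨W, l ++ List.replicate K (x + z), (legal_append ..).2 ⟨h1', legal_replicate W I _ hW K _ ?_⟩, ?_⟩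
    · dsimp only
      rw [numActive_of_cnt]
      · omega
      · omega
    · rw [List.count_append, List.count_replicate_self]; omega

lemma all_or_none {I : Stacks 2} (hI : ∀ x z, z ∈ dirs → ∀ N, ∃ k ≥ N, I (x, k) = some z) (η : Site 2 → ℕ)
    (x : Site 2) : (η, I) ∈ AJ 0 ↔ (η, I) ∈ AJ x := by
  have one : ∀ (x z : Site 2), z ∈ dirs → ((η, I) ∈ AJ x ↔ (η, I) ∈ AJ (x + z)) := by
    intro x z hz
    refine ⟨neighbor hI η x z hz, fun h => ?_⟩
    have hz' : -z ∈ dirs := by rw [mem_dirs] at hz ⊢; simpa using hz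
    simpa using neighbor hI η (x + z) (-z) hz' h
  have d1 : ∀ n : ℤ, (η, I) ∈ AJ 0 ↔ (η, I) ∈ AJ ![n, 0] := by
    intro n
    induction n using Int.induction_on with
    | zero =>
      have : (![0, 0] : Site 2) = 0 := by ext i; fin_cases i <;> rfl
      rw [this]
    | succ n ih => rw [ih, one _ ![1, 0] (by simp [dirs])]; simp
    | pred n ih => rw [ih, one _ ![-1, 0] (by simp [dirs])]; simp [sub_eq_add_neg]
  have d2 : ∀ m n : ℤ, (η, I) ∈ AJ 0 ↔ (η, I) ∈ AJ ![m, n] := by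
    intro m n
    induction n using Int.induction_on with
    | zero => exact d1 m
    | succ n ih => rw [ih, one _ ![0, 1] (by simp [dirs])]; simp
    | pred n ih => rw [ih, one _ ![0, -1] (by simp [dirs])]; simp [sub_eq_add_neg]
  rw [d2 (x 0) (x 1)]
  have : ![x 0, x 1] = x := by ext i; fin_cases i <;> rfl
  rw [this]

/-! ### The zero-one law -/

def pA (μ : Measure (Stacks 2)) (η : Site 2 → ℕ) : ℝ≥0∞ := μ {I | (η, I) ∈ AJ 0}

lemma pA_meas {μ : Measure (Stacks 2)} [SFinite μ] : Measurable (pA μ) := measurable_measure_prodMk_left (AJ_meas 0)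

lemma pA_shift {lam : ℝ} (hl : 0 < lam) {μ : Measure (Stacks 2)} (hμ : IsStackLaw 2 (ssrwStep 2) lam μ)
    (z : Site 2) (η : Site 2 → ℕ) : pA μ (shift z η) = pA μ η := by
  unfold pA
  have h1 : MeasurableSet {I | (shift z η, I) ∈ AJ 0} := measurable_prodMk_left (AJ_meas 0)
  conv_lhs => rw [← tau_map hl hμ z, Measure.map_apply (tau_meas z) h1]
  refine measure_congr ?_
  filter_upwards [good_ae hl hμ] with I hI
  refine propext ?_
  show TT z (η, I) ∈ AJ 0 ↔ (η, I) ∈ AJ 0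
  rw [AJ_sh, zero_add, ← all_or_none hI η z]

end
end ARWP

open MeasureTheory ENNReal Filter
set_option linter.all false
namespace ARWP
open ARW

noncomputable section
open scoped Classical

def bx (n : ℕ) : Finset (Site 2) := Fintype.piFinset fun _ => Finset.Icc (-(n : ℤ)) n

lemma mem_bx {n : ℕ} {x : Site 2} : x ∈ bx n ↔ ∀ i, -(n : ℤ) ≤ x i ∧ x i ≤ n := by
  simp [bx, Fintype.mem_piFinset]

lemma bx_mono {m n : ℕ} (h : m ≤ n) : bx m ⊆ bx n := by
  intro x hx
  rw [mem_bx] at *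
  intro i
  have := hx i
  omega

lemma exists_bx (V : Finset (Site 2)) : ∃ n, V ⊆ bx n := by
  refine ⟨V.sup fun x => (x 0).natAbs + (x 1).natAbs, fun x hx => ?_⟩
  have := Finset.le_sup (f := fun x : Site 2 => (x 0).natAbs + (x 1).natAbs) hx
  rw [mem_bx]
  intro i
  fin_cases i <;> simp <;> omega

def DJ (k n : ℕ) : Set Om := ⋃ l : {l : List (Site 2) // l.length ≤ n}, LQ (bx n) l.1 (fun _ => k ≤ l.1.count 0)

lemma mem_DJ {k n : ℕ} {p : Om} : p ∈ DJ k n ↔ ∃ l : List (Site 2), l.length ≤ n ∧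
    Legal (bx n) p.2 (initState 2 (bx n) p.1) l ∧ k ≤ l.count 0 := by
  simp only [DJ, LQ, Set.mem_iUnion, Set.mem_setOf_eq, Subtype.exists, exists_prop]

lemma DJ_meas (k n : ℕ) : MeasurableSet (DJ k n) := MeasurableSet.iUnion fun l => LQ_meas _ _ _

lemma DJ_mono (k : ℕ) : Monotone (DJ k) := by
  intro m n h p hp
  obtain ⟨l, h1, h2, h3⟩ := mem_DJ.1 hp
  exact mem_DJ.2 ⟨l, h1.trans h, init_legal_mono (bx_mono h) _ _ _ h2, h3⟩

lemma DJ_iUnion (k : ℕ) : GJ k 0 = ⋃ n, DJ k n := by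
  ext p
  rw [mem_GJ, Set.mem_iUnion]
  constructor
  · rintro ⟨V, l, h1, h2⟩
    obtain ⟨n, hn⟩ := exists_bx V
    exact ⟨max n l.length, mem_DJ.2 ⟨l, le_max_right _ _,
      init_legal_mono (hn.trans (bx_mono (le_max_left _ _))) _ _ _ h1, h2⟩⟩
  · rintro ⟨n, hn⟩
    obtain ⟨l, h1, h2, h3⟩ := mem_DJ.1 hn
    exact ⟨_, l, h2, h3⟩

lemma DJ_dep (k n : ℕ) (η : Site 2 → ℕ) (I I' : Stacks 2) (h2 : ∀ i ∈ bx n ×ˢ Finset.range n, I i = I' i)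
    (h3 : (η, I) ∈ DJ k n) : (η, I') ∈ DJ k n := by
  rw [DJ, Set.mem_iUnion] at *
  obtain ⟨l, hl⟩ := h3
  exact ⟨l, LQ_dep _ _ _ n l.2 η η I I' (fun _ _ => rfl) h2 hl⟩

lemma GJ_anti (x : Site 2) : Antitone (fun k => GJ k x) := by
  intro m n h p hp
  obtain ⟨V, l, h1, h2⟩ := mem_GJ.1 hp
  exact mem_GJ.2 ⟨V, l, h1, h.trans h2⟩

lemma DJ_subset (k n : ℕ) : DJ k n ⊆ GJ k 0 := by
  rw [DJ_iUnion]; exact Set.subset_iUnion _ n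

lemma TT_meas (z : Site 2) : Measurable (TT z) :=
  ((shift_meas z).comp measurable_fst).prodMk ((tau_meas z).comp measurable_snd)

lemma TT_pres {lam : ℝ} (hl : 0 < lam) {μ : Measure (Stacks 2)} (hμ : IsStackLaw 2 (ssrwStep 2) lam μ)
    {ν : Measure (Site 2 → ℕ)} [IsProbabilityMeasure ν] (hν : IsTransErgodic ν) (z : Site 2) :
    MeasurePreserving (TT z) (ν.prod μ) (ν.prod μ) := by
  haveI := hμ.1
  exact MeasurePreserving.prod ⟨shift_meas z, hν.1 z⟩ ⟨tau_meas z, tau_map hl hμ z⟩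

lemma const_of_erg {ν : Measure (Site 2 → ℕ)} [IsProbabilityMeasure ν] (hν : IsTransErgodic ν)
    (f : (Site 2 → ℕ) → ℝ≥0∞) (hf : Measurable f) (hf1 : ∀ η, f η ≤ 1) (hs : ∀ z η, f (shift z η) = f η) :
    ∀ᵐ η ∂ν, f η = ∫⁻ η, f η ∂ν := by
  set α := ∫⁻ η, f η ∂ν with hα
  have hα1 : α ≤ 1 := by
    calc α ≤ ∫⁻ η, 1 ∂ν := lintegral_mono hf1
      _ = 1 := by simp
  have hfin : α ≠ ⊤ := ne_top_of_le_ne_top one_ne_top hα1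
  have key1 : ∀ᵐ η ∂ν, α ≤ f η := by
    have m : MeasurableSet {η | f η < α} := measurableSet_lt hf measurable_const
    rcases hν.2 {η | f η < α} m (fun z => by ext η; simp [hs]) with h | h
    · rw [ae_iff]; simpa using h
    · exfalso
      have h' : ∀ᵐ η ∂ν, f η < α := (mem_ae_iff_prob_eq_one m).2 h
      have := lintegral_strict_mono (μ := ν) (f := f) (g := fun _ => α) (IsProbabilityMeasure.ne_zero ν) aemeasurable_const hfin h'
      simp at this
      exact absurd this (lt_irrefl _)
  have key2 : ∀ᵐ η ∂ν, f η ≤ α := by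
    have m : MeasurableSet {η | α < f η} := measurableSet_lt measurable_const hf
    rcases hν.2 {η | α < f η} m (fun z => by ext η; simp [hs]) with h | h
    · rw [ae_iff]; simpa using h
    · exfalso
      have h' : ∀ᵐ η ∂ν, α < f η := (mem_ae_iff_prob_eq_one m).2 h
      have := lintegral_strict_mono (μ := ν) (f := fun _ => α) (g := f) (IsProbabilityMeasure.ne_zero ν) hf.aemeasurable (by simpa using hfin) h'
      simp at this
      exact absurd this (lt_irrefl _)
  filter_upwards [key1, key2] with η h1 h2 using le_antisymm h2 h1

lemma alpha_sq {lam : ℝ} (hl : 0 < lam) {μ : Measure (Stacks 2)} (hμ : IsStackLaw 2 (ssrwStep 2) lam μ)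
    {ν : Measure (Site 2 → ℕ)} [IsProbabilityMeasure ν] (hν : IsTransErgodic ν) (α : ℝ≥0∞) (hα1 : α ≤ 1)
    (hα : α = (ν.prod μ) (AJ 0)) (hc : ∀ᵐ η ∂ν, pA μ η = α) (ε : ℝ≥0∞) (hε : 0 < ε) :
    α ≤ α * α + (ε + ε) + (ε + ε) := by
  haveI := hμ.1
  set P := ν.prod μ with hP
  -- choice of k
  obtain ⟨k, hk⟩ : ∃ k, P (GJ k 0 \ AJ 0) ≤ ε := by
    have h := tendsto_measure_iInter_atTop (μ := P) (s := fun k => GJ k 0 \ AJ 0)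
      (fun k => ((GJ_meas k 0).diff (AJ_meas 0)).nullMeasurableSet)
      (fun m n h => Set.diff_subset_diff_left (GJ_anti 0 h)) ⟨0, measure_ne_top _ _⟩
    have h0 : ⋂ k, GJ k 0 \ AJ 0 = ∅ := by
      ext p
      simp only [Set.mem_iInter, Set.mem_diff, Set.mem_empty_iff_false, iff_false]
      intro h
      exact (h 0).2 (Set.mem_iInter.2 fun k => (h k).1)
    rw [h0, measure_empty] at h
    exact (h.eventually (ge_mem_nhds hε)).exists
  obtain ⟨n, hn⟩ : ∃ n, P (GJ k 0 \ DJ k n) ≤ ε := by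
    have h := tendsto_measure_iInter_atTop (μ := P) (s := fun n => GJ k 0 \ DJ k n)
      (fun n => ((GJ_meas k 0).diff (DJ_meas k n)).nullMeasurableSet)
      (fun m n h => Set.diff_subset_diff_right (DJ_mono k h)) ⟨0, measure_ne_top _ _⟩
    have h0 : ⋂ n, GJ k 0 \ DJ k n = ∅ := by
      rw [← Set.diff_iUnion, ← DJ_iUnion]; exact Set.diff_self
    rw [h0, measure_empty] at h
    exact (h.eventually (ge_mem_nhds hε)).exists
  set D := DJ k n with hD
  have hDm : MeasurableSet D := DJ_meas k n
  obtain ⟨z, hz⟩ : ∃ z : Site 2, z = ![2 * (n : ℤ) + 1, 0] := ⟨_, rfl⟩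
  have pres := TT_pres hl hμ hν z
  have hAz : P (AJ 0) ≤ P (D ∩ TT z ⁻¹' D) + (ε + ε) := by
    have sub : AJ 0 ⊆ (D ∩ TT z ⁻¹' D) ∪ ((GJ k 0 \ D ∪ TT z ⁻¹' (GJ k 0 \ D)) ∪ (AJ 0 \ AJ z)) := by
      intro p hp
      by_cases h1 : p ∈ AJ z
      · have h2 : p ∈ GJ k 0 := Set.mem_iInter.1 hp k
        have h3 : TT z p ∈ GJ k 0 := by
          rw [GJ_sh, zero_add]; exact Set.mem_iInter.1 h1 k
        simp only [Set.mem_union, Set.mem_inter_iff, Set.mem_diff, Set.mem_preimage]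
        tauto
      · exact Or.inr (Or.inr ⟨hp, h1⟩)
    have hnull : P (AJ 0 \ AJ z) = 0 := by
      rw [hP, Measure.measure_prod_null ((AJ_meas 0).diff (AJ_meas z))]
      refine Eventually.of_forall fun η => ?_
      have := good_ae hl hμ
      rw [ae_iff] at this
      refine measure_mono_null ?_ this
      intro I hI hg
      exact hI.2 ((all_or_none hg η z).1 hI.1)
    calc P (AJ 0) ≤ P (D ∩ TT z ⁻¹' D) + (P (GJ k 0 \ D) + P (TT z ⁻¹' (GJ k 0 \ D)) + P (AJ 0 \ AJ z)) := by
          refine (measure_mono sub).trans ((measure_union_le _ _).trans (add_le_add le_rfl ?_))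
          refine (measure_union_le _ _).trans (add_le_add (measure_union_le _ _) le_rfl)
      _ ≤ _ := by
          rw [hnull, add_zero, pres.measure_preimage ((GJ_meas k 0).diff hDm).nullMeasurableSet]
          gcongr
  let g : (Site 2 → ℕ) → ℝ≥0∞ := fun η => μ (Prod.mk η ⁻¹' D)
  let δ : (Site 2 → ℕ) → ℝ≥0∞ := fun η => μ (Prod.mk η ⁻¹' (GJ k 0 \ AJ 0))
  have δm : Measurable δ := measurable_measure_prodMk_left ((GJ_meas k 0).diff (AJ_meas 0))
  have hδ : ∫⁻ η, δ η ∂ν ≤ ε := by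
    rw [← Measure.prod_apply ((GJ_meas k 0).diff (AJ_meas 0))]; exact hk
  have hδz : ∫⁻ η, δ (shift z η) ∂ν ≤ ε := by
    have : ∫⁻ η, δ (shift z η) ∂ν = ∫⁻ η, δ η ∂ν := by
      conv_rhs => rw [← hν.1 z]
      rw [lintegral_map δm (shift_meas z)]
    rw [this]; exact hδ
  have hg1 : ∀ η, g η ≤ 1 := fun η => prob_le_one
  have hgA : ∀ η, g η ≤ pA μ η + δ η := by
    intro η
    refine (measure_mono ?_).trans (measure_union_le _ _)
    intro I hI
    by_cases h : (η, I) ∈ AJ 0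
    · exact Or.inl h
    · exact Or.inr ⟨DJ_subset k n hI, h⟩
  have hcz : ∀ᵐ η ∂ν, pA μ (shift z η) = α := by
    filter_upwards [hc] with η h
    rw [pA_shift hl hμ, h]
  have hprod : P (D ∩ TT z ⁻¹' D) = ∫⁻ η, g η * g (shift z η) ∂ν := by
    rw [hP, Measure.prod_apply (hDm.inter (TT_meas z hDm))]
    refine lintegral_congr fun η => ?_
    have e1 : Prod.mk η ⁻¹' (D ∩ TT z ⁻¹' D) = (Prod.mk η ⁻¹' D) ∩ tau z ⁻¹' (Prod.mk (shift z η) ⁻¹' D) := rfl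
    rw [e1]
    have hm2 : MeasurableSet (Prod.mk (shift z η) ⁻¹' D) := measurable_prodMk_left hDm
    have e2 : g (shift z η) = μ (tau z ⁻¹' (Prod.mk (shift z η) ⁻¹' D)) := by
      rw [← Measure.map_apply (tau_meas z) hm2, tau_map hl hμ]
    rw [e2]
    refine indep_dep hl hμ (bx n ×ˢ Finset.range n) (shV z (bx n) ×ˢ Finset.range n) ?_ _ _ ?_ ?_
    · rw [Finset.disjoint_left]
      rintro ⟨x, i⟩ h1 h2
      simp only [Finset.mem_product] at h1 h2
      have h3 := (mem_bx.1 h1.1) 0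
      have h4 : x = (x - z) + z := by simp
      rw [h4, mem_shV] at h2
      have h5 := (mem_bx.1 h2.1) 0
      rw [hz] at h5
      simp at h5
      omega
    · intro I I' h h'
      exact DJ_dep k n η I I' h h'
    · intro I I' h h'
      refine DJ_dep k n (shift z η) (tau z I) (tau z I') (fun i hi => ?_) h'
      refine h _ ?_
      simp only [Finset.mem_product] at hi ⊢
      exact ⟨mem_shV.2 hi.1, hi.2⟩
  have hintg : ∫⁻ η, g η * g (shift z η) ∂ν ≤ α * α + (ε + ε) := by
    calc ∫⁻ η, g η * g (shift z η) ∂ν ≤ ∫⁻ η, (α * α + (δ (shift z η) + δ η)) ∂ν := by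
          refine lintegral_mono_ae ?_
          filter_upwards [hc, hcz] with η h1 h2
          have a1 : g η ≤ α + δ η := h1 ▸ hgA η
          have a2 : g (shift z η) ≤ α + δ (shift z η) := h2 ▸ hgA (shift z η)
          calc g η * g (shift z η) ≤ (α + δ η) * g (shift z η) := by gcongr
            _ = α * g (shift z η) + δ η * g (shift z η) := add_mul _ _ _
            _ ≤ α * (α + δ (shift z η)) + δ η * 1 := by gcongr; exact hg1 _
            _ = α * α + α * δ (shift z η) + δ η := by rw [mul_add, mul_one]
            _ ≤ α * α + 1 * δ (shift z η) + δ η := by gcongr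
            _ = _ := by rw [one_mul, add_assoc]
      _ = α * α + (∫⁻ η, δ (shift z η) ∂ν + ∫⁻ η, δ η ∂ν) := by
          rw [lintegral_add_left measurable_const, lintegral_add_right _ δm]
          simp
      _ ≤ _ := by gcongr
  calc α ≤ P (D ∩ TT z ⁻¹' D) + (ε + ε) := hα ▸ hAz
    _ ≤ _ := by rw [hprod]; gcongr

/-- The zero-one law for staying active. -/
lemma zero_one {lam : ℝ} (hl : 0 < lam) {μ : Measure (Stacks 2)} (hμ : IsStackLaw 2 (ssrwStep 2) lam μ)
    {ν : Measure (Site 2 → ℕ)} [IsProbabilityMeasure ν] (hν : IsTransErgodic ν) :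
    (ν.prod μ) (AJ 0) = 0 ∨ (ν.prod μ) (AJ 0) = 1 := by
  haveI := hμ.1
  have h1 : (ν.prod μ) (AJ 0) = ∫⁻ η, pA μ η ∂ν := Measure.prod_apply (AJ_meas 0)
  have h2 := const_of_erg hν (pA μ) pA_meas (fun η => prob_le_one) (pA_shift hl hμ)
  obtain ⟨α, hα⟩ : ∃ α, α = (ν.prod μ) (AJ 0) := ⟨_, rfl⟩
  rw [← h1, ← hα] at h2
  rw [← hα]
  have hα1 : α ≤ 1 := hα ▸ prob_le_one
  have hfin : α ≠ ⊤ := ne_top_of_le_ne_top one_ne_top hα1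
  have h3 : α ≤ α * α := by
    refine ENNReal.le_of_forall_pos_le_add fun ε hε _ => ?_
    have := alpha_sq hl hμ hν α hα1 hα h2 ((ε : ℝ≥0∞) / 4) (by simp; exact_mod_cast hε.ne')
    refine this.trans (le_of_eq ?_)
    rw [add_assoc]
    congr 1
    have : (ε : ℝ≥0∞) / 4 + ε / 4 = ε / 2 := by
      rw [← two_mul, ENNReal.div_eq_inv_mul, ENNReal.div_eq_inv_mul, ← mul_assoc]
      congr 1
      have : (4 : ℝ≥0∞) = 2 * 2 := by norm_num
      rw [this, ENNReal.mul_inv (by simp) (by simp), ← mul_assoc, ENNReal.mul_inv_cancel (by simp) (by simp), one_mul]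
    rw [this, ENNReal.add_halves]
  by_cases h0 : α = 0
  · exact Or.inl h0
  · right
    refine le_antisymm hα1 ?_
    have : α * 1 ≤ α * α := by rwa [mul_one]
    exact (ENNReal.mul_le_mul_iff_right h0 hfin).1 this

end
end ARWP

open MeasureTheory ENNReal Filter
set_option linter.all false
namespace ARWP
open ARW

noncomputable section
open scoped Classical

/-! ### An explicit superharmonic function -/

def HH (a b : ℤ) : ℝ :=
  if a ^ 2 + b ^ 2 = 0 then 0 else Real.log 63 + Real.log (2 * ((a : ℝ) ^ 2 + (b : ℝ) ^ 2) - 1)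

lemma ge_one_of {a b : ℤ} (h : a ^ 2 + b ^ 2 ≠ 0) : (1 : ℝ) ≤ 2 * ((a : ℝ) ^ 2 + (b : ℝ) ^ 2) - 1 := by
  have h1 : 1 ≤ a ^ 2 + b ^ 2 := by
    have : 0 ≤ a ^ 2 + b ^ 2 := by positivity
    omega
  have h2 : (1 : ℝ) ≤ (a : ℝ) ^ 2 + (b : ℝ) ^ 2 := by exact_mod_cast h1
  linarith

lemma l63_pos : 0 < Real.log 63 := Real.log_pos (by norm_num)

lemma HH_nonneg (a b : ℤ) : 0 ≤ HH a b := by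
  unfold HH
  split_ifs with h
  · exact le_rfl
  · have := l63_pos
    have := Real.log_nonneg (ge_one_of h)
    linarith

lemma HH_big {a b : ℤ} (h : 2 ≤ a ^ 2 + b ^ 2) :
    HH (a + 1) b + (HH (a - 1) b + (HH a (b + 1) + HH a (b - 1))) ≤ 4 * HH a b := by
  have n1 : (a + 1) ^ 2 + b ^ 2 ≠ 0 := by
    intro h1
    have h2 : a + 1 = 0 := by nlinarith [sq_nonneg b, sq_nonneg (a+1)]
    have h3 : b = 0 := by nlinarith [sq_nonneg b, sq_nonneg (a+1)]
    have : a = -1 := by linarith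
    subst this; subst h3; norm_num at h
  have n2 : (a - 1) ^ 2 + b ^ 2 ≠ 0 := by
    intro h1
    have h2 : a - 1 = 0 := by nlinarith [sq_nonneg b, sq_nonneg (a-1)]
    have h3 : b = 0 := by nlinarith [sq_nonneg b, sq_nonneg (a-1)]
    have : a = 1 := by linarith
    subst this; subst h3; norm_num at h
  have n3 : a ^ 2 + (b + 1) ^ 2 ≠ 0 := by
    intro h1
    have h2 : b + 1 = 0 := by nlinarith [sq_nonneg a, sq_nonneg (b+1)]
    have h3 : a = 0 := by nlinarith [sq_nonneg a, sq_nonneg (b+1)]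
    have : b = -1 := by linarith
    subst this; subst h3; norm_num at h
  have n4 : a ^ 2 + (b - 1) ^ 2 ≠ 0 := by
    intro h1
    have h2 : b - 1 = 0 := by nlinarith [sq_nonneg a, sq_nonneg (b-1)]
    have h3 : a = 0 := by nlinarith [sq_nonneg a, sq_nonneg (b-1)]
    have : b = 1 := by linarith
    subst this; subst h3; norm_num at h
  have n0 : a ^ 2 + b ^ 2 ≠ 0 := by omega
  unfold HH
  rw [if_neg n0, if_neg n1, if_neg n2, if_neg n3, if_neg n4]
  have p0 := ge_one_of n0
  have p1 := ge_one_of n1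
  have p2 := ge_one_of n2
  have p3 := ge_one_of n3
  have p4 := ge_one_of n4
  push_cast at *
  generalize (a : ℝ) = x at *
  generalize (b : ℝ) = y at *
  have key : Real.log (2 * ((x + 1) ^ 2 + y ^ 2) - 1) + (Real.log (2 * ((x - 1) ^ 2 + y ^ 2) - 1) +
      (Real.log (2 * (x ^ 2 + (y + 1) ^ 2) - 1) + Real.log (2 * (x ^ 2 + (y - 1) ^ 2) - 1))) ≤
      4 * Real.log (2 * (x ^ 2 + y ^ 2) - 1) := by
    rw [← Real.log_mul (by positivity) (by positivity), ← Real.log_mul (by positivity) (by positivity),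
      ← Real.log_mul (by positivity) (by positivity)]
    have : 4 * Real.log (2 * (x ^ 2 + y ^ 2) - 1) = Real.log ((2 * (x ^ 2 + y ^ 2) - 1) ^ 4) := by
      rw [Real.log_pow]; norm_num
    rw [this]
    apply Real.log_le_log (by positivity)
    nlinarith [sq_nonneg (x ^ 2 - y ^ 2)]
  linarith

lemma HH_super {a b : ℤ} (h : a ^ 2 + b ^ 2 ≠ 0) :
    HH (a + 1) b + (HH (a - 1) b + (HH a (b + 1) + HH a (b - 1))) ≤ 4 * HH a b := by
  by_cases h2 : 2 ≤ a ^ 2 + b ^ 2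
  · exact HH_big h2
  · have e : a ^ 2 + b ^ 2 = 1 := by
      have : 0 ≤ a ^ 2 + b ^ 2 := by positivity
      omega
    have key : Real.log 7 + 2 * Real.log 3 = Real.log 63 := by
      have : (63 : ℝ) = 7 * 3 ^ 2 := by norm_num
      rw [this, Real.log_mul (by norm_num) (by norm_num), Real.log_pow]; norm_num
    have a1 : a ≤ 1 := by nlinarith [sq_nonneg b]
    have a2 : -1 ≤ a := by nlinarith [sq_nonneg b]
    have b1 : b ≤ 1 := by nlinarith [sq_nonneg a]
    have b2 : -1 ≤ b := by nlinarith [sq_nonneg a]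
    interval_cases a <;> interval_cases b <;> norm_num at e <;> norm_num [HH] <;> linarith

def hf (x : Site 2) : ℝ := HH (x 0) (x 1)

lemma sq_ne {x : Site 2} (h : x ≠ 0) : (x 0) ^ 2 + (x 1) ^ 2 ≠ 0 := by
  intro h1
  apply h
  have h2 : x 0 = 0 := by nlinarith [sq_nonneg (x 0), sq_nonneg (x 1)]
  have h3 : x 1 = 0 := by nlinarith [sq_nonneg (x 0), sq_nonneg (x 1)]
  ext i; fin_cases i <;> simp [h2, h3]

lemma hf_nonneg (x : Site 2) : 0 ≤ hf x := HH_nonneg _ _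

lemma hf_zero : hf 0 = 0 := by simp [hf, HH]

lemma hf_super {x : Site 2} (h : x ≠ 0) : ∑ z ∈ dirs, hf (x + z) ≤ 4 * hf x := by
  rw [sum_dirs]
  have := HH_super (sq_ne h)
  simpa [hf, sub_eq_add_neg] using this

lemma hf_ctr : ∑ z ∈ dirs, hf (0 + z) = 4 * Real.log 63 := by
  rw [sum_dirs]
  norm_num [hf, HH]
  ring

def Th (r : ℕ) : ℝ := Real.log 63 + Real.log (2 * ((r : ℝ) + 1) ^ 2 - 1)

lemma Th_pos (r : ℕ) : 0 < Th r := by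
  unfold Th
  have := l63_pos
  have : 0 ≤ Real.log (2 * ((r : ℝ) + 1) ^ 2 - 1) := Real.log_nonneg (by nlinarith [(Nat.cast_nonneg r : (0:ℝ) ≤ r)])
  linarith

lemma hf_off {r : ℕ} {x : Site 2} (h : x ∉ bx r) : Th r ≤ hf x := by
  rw [mem_bx] at h
  push Not at h
  obtain ⟨i, hi⟩ := h
  have h1 : ((r : ℤ) + 1) ^ 2 ≤ (x i) ^ 2 := by
    by_cases h2 : -(r : ℤ) ≤ x i
    · have := hi h2; nlinarith
    · push Not at h2; nlinarith
  have h3 : ((r : ℤ) + 1) ^ 2 ≤ (x 0) ^ 2 + (x 1) ^ 2 := by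
    have := sq_nonneg (x 0)
    have := sq_nonneg (x 1)
    fin_cases i <;> simp at h1 <;> linarith
  have h4 : (x 0) ^ 2 + (x 1) ^ 2 ≠ 0 := by
    have : 0 < ((r : ℤ) + 1) ^ 2 := by positivity
    omega
  unfold hf HH Th
  rw [if_neg h4]
  have h5 : ((r : ℝ) + 1) ^ 2 ≤ (x 0 : ℝ) ^ 2 + (x 1 : ℝ) ^ 2 := by exact_mod_cast h3
  have : Real.log (2 * ((r : ℝ) + 1) ^ 2 - 1) ≤ Real.log (2 * ((x 0 : ℝ) ^ 2 + (x 1 : ℝ) ^ 2) - 1) :=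
    Real.log_le_log (by nlinarith [(Nat.cast_nonneg r : (0:ℝ) ≤ r)]) (by linarith)
  linarith

/-- Upper bound inside a box. -/
lemma hf_on {j : ℕ} {x : Site 2} (hj : 1 ≤ j) (h : x ∈ bx j) :
    hf x ≤ Real.log 63 + Real.log (4 * (j : ℝ) ^ 2 - 1) := by
  have hj' : (1 : ℝ) ≤ j := by exact_mod_cast hj
  have h0 : 0 ≤ Real.log (4 * (j : ℝ) ^ 2 - 1) := Real.log_nonneg (by nlinarith)
  rw [mem_bx] at h
  unfold hf HH
  split_ifs with h4
  · have := l63_pos; linarith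
  · have h1 : (x 0 : ℝ) ^ 2 ≤ (j : ℝ) ^ 2 := by
      have : (x 0) ^ 2 ≤ (j : ℤ) ^ 2 := by have := h 0; nlinarith
      exact_mod_cast this
    have h2 : (x 1 : ℝ) ^ 2 ≤ (j : ℝ) ^ 2 := by
      have : (x 1) ^ 2 ≤ (j : ℤ) ^ 2 := by have := h 1; nlinarith
      exact_mod_cast this
    have := Real.log_le_log (by linarith [ge_one_of h4]) (show 2 * ((x 0 : ℝ) ^ 2 + (x 1 : ℝ) ^ 2) - 1 ≤ 4 * (j : ℝ) ^ 2 - 1 by linarith)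
    linarith

lemma hf_step_le (x z : Site 2) (hz : z ∈ dirs) : hf (x + z) ≤ hf x + Real.log 63 := by
  have hl := l63_pos
  by_cases h0 : x + z = 0
  · rw [h0, hf_zero]; have := hf_nonneg x; linarith
  by_cases hx : x = 0
  · subst hx
    rw [hf_zero]
    have : hf (0 + z) = Real.log 63 := by
      simp only [dirs, Finset.mem_insert, Finset.mem_singleton] at hz
      rcases hz with rfl | rfl | rfl | rfl <;> norm_num [hf, HH]
    linarith
  have n0 := sq_ne hx
  have n1 := sq_ne h0
  unfold hf HH
  rw [if_neg n0, if_neg n1]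
  have p0 := ge_one_of n0
  have p1 := ge_one_of n1
  have : Real.log (2 * (((x + z) 0 : ℤ) ^ 2 + ((x + z) 1 : ℤ) ^ 2 : ℝ) - 1) ≤ Real.log (2 * ((x 0 : ℝ) ^ 2 + (x 1 : ℝ) ^ 2) - 1) + Real.log 63 := by
    rw [← Real.log_mul (by positivity) (by positivity)]
    refine Real.log_le_log (by linarith) ?_
    simp only [dirs, Finset.mem_insert, Finset.mem_singleton] at hz
    rcases hz with rfl | rfl | rfl | rfl <;> simp <;>
      nlinarith [sq_nonneg ((x 0 : ℝ) - 1), sq_nonneg ((x 1 : ℝ) - 1), sq_nonneg ((x 0 : ℝ) + 1), sq_nonneg ((x 1 : ℝ) + 1)]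
  linarith

lemma hf_step_ge (x z : Site 2) (hz : z ∈ dirs) : hf x ≤ hf (x + z) + Real.log 63 := by
  have hz' : -z ∈ dirs := by rw [mem_dirs] at hz ⊢; simpa using hz
  simpa using hf_step_le (x + z) (-z) hz'

lemma core_hyp (c : Site 2) (r : ℕ) :
    CoreHyp (shV c (bx r)) c (fun y => hf (y - c) / Th r) (Real.log 63 / Th r) where
  mem := by
    have h : 0 + c ∈ shV c (bx r) := mem_shV.2 (by rw [mem_bx]; simp)
    rwa [zero_add] at h
  nn y := div_nonneg (hf_nonneg _) (Th_pos r).le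
  off y hy := by
    have : y = (y - c) + c := by simp
    rw [this, mem_shV] at hy
    rw [le_div_iff₀ (Th_pos r), one_mul]
    exact hf_off hy
  sup y _ hy := by
    rw [← Finset.sum_div, ← mul_div_assoc]
    have h := hf_super (x := y - c) (sub_ne_zero.2 hy)
    have e : ∀ z, y + z - c = y - c + z := fun z => by abel
    simp only [e]
    exact div_le_div_of_nonneg_right h (Th_pos r).le
  ctr := by
    rw [← Finset.sum_div, ← mul_div_assoc]
    have e : ∀ z, c + z - c = 0 + z := fun z => by abel
    simp only [e]
    rw [hf_ctr]

lemma core_hyp_one (c : Site 2) : CoreHyp {c} c (fun _ => 1) 1 where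
  mem := Finset.mem_singleton_self c
  nn _ := zero_le_one
  off _ _ := le_rfl
  sup y hy h := absurd (Finset.mem_singleton.1 hy) h
  ctr := by rw [sum_dirs]; norm_num

lemma bx_card (n : ℕ) : (bx n).card = (2 * n + 1) ^ 2 := by
  unfold bx
  rw [Fintype.card_piFinset]
  simp
  congr 1
  omega

lemma shV_card (z : Site 2) (V : Finset (Site 2)) : (shV z V).card = V.card := Finset.card_map _

end
end ARWP

open MeasureTheory ENNReal Filter
set_option linter.all false
namespace ARWP
open ARW

noncomputable section
open scoped Classical

/-- Joint event that `x` is not sleeping after stabilization in `V`. -/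
def NJ (V : Finset (Site 2)) (x : Site 2) : Set Om := {p | p.2 ∈ NS V p.1 x}
lemma NJ_meas (V : Finset (Site 2)) (x : Site 2) : MeasurableSet (NJ V x) := NSJ_meas V x
def VJ (V : Finset (Site 2)) (x : Site 2) : Set Om := {p | p.2 ∈ Vis V p.1 x}

lemma VJ_meas (V : Finset (Site 2)) (x : Site 2) : MeasurableSet (VJ V x) := VisJ_meas V x

lemma count_bound {V : Finset (Site 2)} {p : Om}
    (h : ∃ l, Legal V p.2 (initState 2 V p.1) l ∧ Stable V (run V p.2 (initState 2 V p.1) l).1) :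
    (V.card : ℝ≥0∞) ≤ ∑ x ∈ V, (NJ V x).indicator 1 p + ∑ x ∈ V, (p.1 x : ℝ≥0∞) := by
  obtain ⟨l, h1, h2⟩ := h
  have h3 := stable_count V (run V p.2 (initState 2 V p.1) l)
  have h4 := mass_run_le V p.2 _ l h1
  rw [mass_init] at h4
  have h5 : (V.card : ℝ) ≤ (∑ x ∈ V, if p ∈ NJ V x then (1 : ℝ) else 0) + ∑ x ∈ V, (p.1 x : ℝ) := by
    refine h3.trans (add_le_add (Finset.sum_le_sum fun x hx => ?_) (h4.trans (by simp)))
    by_cases h6 : (run V p.2 (initState 2 V p.1) l).1 x = .sleeping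
    · simp [h6]; split_ifs <;> norm_num
    · have : p ∈ NJ V x := ⟨l, h1, h2, h6⟩
      simp [h6, this]
  have h6 : V.card ≤ (∑ x ∈ V, if p ∈ NJ V x then 1 else 0) + ∑ x ∈ V, p.1 x := by exact_mod_cast h5
  have h7 : (V.card : ℝ≥0∞) ≤ (((∑ x ∈ V, if p ∈ NJ V x then 1 else 0) + ∑ x ∈ V, p.1 x : ℕ) : ℝ≥0∞) := by
    exact_mod_cast h6
  refine h7.trans (le_of_eq ?_)
  push_cast
  congr 1

lemma dens_shift {ν : Measure (Site 2 → ℕ)} (hν : IsTransErgodic ν) (x : Site 2) :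
    ∫⁻ η, (η x : ℝ≥0∞) ∂ν = ∫⁻ η, (η 0 : ℝ≥0∞) ∂ν := by
  conv_rhs => rw [← hν.1 x]
  rw [lintegral_map (by fun_prop) (shift_meas x)]
  simp [shift]

lemma int_bound {lam : ℝ} (hl : 0 < lam) {μ : Measure (Stacks 2)} (hμ : IsStackLaw 2 (ssrwStep 2) lam μ)
    {ν : Measure (Site 2 → ℕ)} [IsProbabilityMeasure ν] (hν : IsTransErgodic ν) (V : Finset (Site 2)) :
    (V.card : ℝ≥0∞) ≤ ∑ x ∈ V, (ν.prod μ) (NJ V x) + V.card * ∫⁻ η, (η 0 : ℝ≥0∞) ∂ν := by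
  haveI := hμ.1
  have hm : MeasurableSet {p : Om | ∃ l, Legal V p.2 (initState 2 V p.1) l ∧ Stable V (run V p.2 (initState 2 V p.1) l).1} := by
    have : {p : Om | ∃ l, Legal V p.2 (initState 2 V p.1) l ∧ Stable V (run V p.2 (initState 2 V p.1) l).1} =
      ⋃ l : List (Site 2), LQ V l (fun s => Stable V s.1) := by
      ext p; simp only [LQ, Set.mem_setOf_eq, Set.mem_iUnion]
    rw [this]
    exact MeasurableSet.iUnion fun l => LQ_meas _ _ _
  have hae : ∀ᵐ p ∂(ν.prod μ), ∃ l, Legal V p.2 (initState 2 V p.1) l ∧ Stable V (run V p.2 (initState 2 V p.1) l).1 := by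
    rw [Measure.ae_prod_iff_ae_ae hm]
    exact Eventually.of_forall fun η => stab_ae hl hμ V η
  calc (V.card : ℝ≥0∞) = ∫⁻ p, (V.card : ℝ≥0∞) ∂(ν.prod μ) := by simp
    _ ≤ ∫⁻ p, (∑ x ∈ V, (NJ V x).indicator 1 p + ∑ x ∈ V, (p.1 x : ℝ≥0∞)) ∂(ν.prod μ) := by
        refine lintegral_mono_ae ?_
        filter_upwards [hae] with p hp using count_bound hp
    _ = ∑ x ∈ V, (ν.prod μ) (NJ V x) + ∑ x ∈ V, ∫⁻ p, (p.1 x : ℝ≥0∞) ∂(ν.prod μ) := by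
        rw [lintegral_add_right _ (by fun_prop), lintegral_finsetSum _ (fun x _ => measurable_one.indicator (NJ_meas V x)),
          lintegral_finsetSum _ (fun x _ => by fun_prop)]
        congr 1
        exact Finset.sum_congr rfl fun x _ => lintegral_indicator_one (NJ_meas V x)
    _ = _ := by
        congr 1
        rw [← nsmul_eq_mul, ← Finset.sum_const]
        refine Finset.sum_congr rfl fun x _ => ?_
        rw [← dens_shift hν x, lintegral_prod _ (by fun_prop)]
        simp

lemma vis_bound {lam : ℝ} (hl : 0 < lam) {μ : Measure (Stacks 2)} (hμ : IsStackLaw 2 (ssrwStep 2) lam μ)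
    {ν : Measure (Site 2 → ℕ)} [IsProbabilityMeasure ν] (hν : IsTransErgodic ν) (n : ℕ) (V : Finset (Site 2)) (c : Site 2)
    (hc : shV c (bx n) ⊆ V) : (ν.prod μ) (VJ V c)ᶜ ≤ (ν.prod μ) (DJ 1 n)ᶜ := by
  haveI := hμ.1
  have pres := TT_pres hl hμ hν c
  rw [← pres.measure_preimage (DJ_meas 1 n).compl.nullMeasurableSet]
  refine measure_mono ?_
  intro p hp hq
  apply hp
  obtain ⟨l, h1, h2, h3⟩ := mem_DJ.1 hq
  have : (TT c p).2 ∈ Vis (bx n) (TT c p).1 0 := ⟨l, h2, List.count_pos_iff.1 h3⟩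
  have := vis_sh (bx n) c 0 p this
  rw [zero_add] at this
  obtain ⟨l', h4, h5⟩ := this
  exact ⟨l', init_legal_mono hc _ _ _ h4, h5⟩

lemma ns_bound {lam : ℝ} (hl : 0 < lam) {μ : Measure (Stacks 2)} (hμ : IsStackLaw 2 (ssrwStep 2) lam μ)
    {ν : Measure (Site 2 → ℕ)} [IsProbabilityMeasure ν] (hν : IsTransErgodic ν) (n : ℕ) (V : Finset (Site 2)) (c : Site 2)
    (hc : shV c (bx n) ⊆ V) {B : Finset (Site 2)} {e : Site 2 → ℝ} {eb : ℝ} (hB : B ⊆ V) (H : CoreHyp B c e eb) :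
    (ν.prod μ) (NJ V c) ≤ (ν.prod μ) (DJ 1 n)ᶜ + (ENNReal.ofReal (lamJ lam * (lamJ lam + eb)) +
      ENNReal.ofReal (lamJ lam / lamS lam) * ∑ x ∈ B.erase c, (ν.prod μ) (NJ V x)) := by
  haveI := hμ.1
  have h1 : (ν.prod μ) (NJ V c) ≤ (ν.prod μ) (VJ V c)ᶜ + (ν.prod μ) (VJ V c ∩ NJ V c) := by
    refine (measure_mono ?_).trans (measure_union_le _ _)
    intro p hp
    by_cases h : p ∈ VJ V c
    · exact Or.inr ⟨h, hp⟩
    · exact Or.inl h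
  refine h1.trans (add_le_add (vis_bound hl hμ hν n V c hc) ?_)
  rw [Measure.prod_apply ((VJ_meas V c).inter (NJ_meas V c))]
  have mm : ∀ x, Measurable fun η => μ (NS V η x) := fun x => measurable_measure_prodMk_left (NSJ_meas V x)
  calc ∫⁻ η, μ (Prod.mk η ⁻¹' (VJ V c ∩ NJ V c)) ∂ν ≤ ∫⁻ η, (ENNReal.ofReal (lamJ lam * (lamJ lam + eb)) +
      ENNReal.ofReal (lamJ lam / lamS lam) * ∑ x ∈ B.erase c, μ (NS V η x)) ∂ν :=
        lintegral_mono fun η => core_main hl hμ η hB H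
    _ = _ := by
      rw [lintegral_add_left measurable_const, lintegral_const_mul _ (Finset.measurable_fun_sum _ fun x _ => mm x),
        lintegral_finsetSum _ (fun x _ => mm x)]
      simp only [lintegral_const, measure_univ, mul_one]
      congr 2
      refine Finset.sum_congr rfl fun x _ => ?_
      rw [Measure.prod_apply (NJ_meas V x)]
      rfl

lemma shV_sub {c : Site 2} {m L : ℕ} (hc : c ∈ bx L) : shV c (bx m) ⊆ bx (L + m) := by
  intro x hx
  have : x = (x - c) + c := by simp
  rw [this, mem_shV] at hx
  rw [mem_bx] at *
  intro i
  have h1 := hx i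
  have h2 := hc i
  simp at h1
  push_cast
  omega

def UU (lam : ℝ) (r : ℕ) (δ : ℝ) : ℝ :=
  δ + (lamJ lam * (lamJ lam + Real.log 63 / Th r) +
    lamJ lam / lamS lam * ((2 * r + 1) ^ 2 * (δ + lamJ lam * (lamJ lam + 1))))

lemma deep_bound {lam : ℝ} (hl : 0 < lam) {μ : Measure (Stacks 2)} (hμ : IsStackLaw 2 (ssrwStep 2) lam μ)
    {ν : Measure (Site 2 → ℕ)} [IsProbabilityMeasure ν] (hν : IsTransErgodic ν) (n r L : ℕ) (δ : ℝ) (hδ : 0 ≤ δ)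
    (hn : (ν.prod μ) (DJ 1 n)ᶜ ≤ ENNReal.ofReal δ) (c : Site 2) (hc : c ∈ bx L) :
    (ν.prod μ) (NJ (bx (L + (r + n))) c) ≤ ENNReal.ofReal (UU lam r δ) := by
  haveI := hμ.1
  have hJ := lamJ_pos hl
  have hS := lamS_pos hl
  have hT := Th_pos r
  have h63 := l63_pos
  set V := bx (L + (r + n)) with hV
  have hBV : shV c (bx r) ⊆ V := (shV_sub hc).trans (bx_mono (by omega))
  have hcn : shV c (bx n) ⊆ V := (shV_sub hc).trans (bx_mono (by omega))
  have one : ∀ x ∈ shV c (bx r), (ν.prod μ) (NJ V x) ≤ ENNReal.ofReal (δ + lamJ lam * (lamJ lam + 1)) := by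
    intro x hx
    have hxn : shV x (bx n) ⊆ V := by
      rw [hV, ← add_assoc]
      exact shV_sub (shV_sub hc hx)
    have := ns_bound hl hμ hν n V x hxn (B := {x}) (Finset.singleton_subset_iff.2 (hBV hx)) (core_hyp_one x)
    rw [show ({x} : Finset (Site 2)).erase x = ∅ by simp, Finset.sum_empty, mul_zero, add_zero] at this
    refine this.trans ?_
    rw [ENNReal.ofReal_add hδ (by positivity)]
    gcongr
  refine (ns_bound hl hμ hν n V c hcn hBV (core_hyp c r)).trans ?_
  unfold UU
  rw [ENNReal.ofReal_add hδ (by positivity), ENNReal.ofReal_add (by positivity) (by positivity),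
    ENNReal.ofReal_mul (by positivity : 0 ≤ lamJ lam / lamS lam)]
  gcongr
  calc ∑ x ∈ (shV c (bx r)).erase c, (ν.prod μ) (NJ V x)
      ≤ ∑ x ∈ (shV c (bx r)), (ν.prod μ) (NJ V x) := Finset.sum_le_sum_of_subset (Finset.erase_subset _ _)
    _ ≤ ∑ x ∈ (shV c (bx r)), ENNReal.ofReal (δ + lamJ lam * (lamJ lam + 1)) := Finset.sum_le_sum one
    _ = ENNReal.ofReal ((2 * r + 1) ^ 2 * (δ + lamJ lam * (lamJ lam + 1))) := by
      rw [Finset.sum_const, shV_card, bx_card, nsmul_eq_mul, ENNReal.ofReal_mul (by positivity)]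
      congr 1
      rw [← ENNReal.ofReal_natCast]
      push_cast; rfl

lemma box_ineq {lam : ℝ} (hl : 0 < lam) {μ : Measure (Stacks 2)} (hμ : IsStackLaw 2 (ssrwStep 2) lam μ)
    {ν : Measure (Site 2 → ℕ)} [IsProbabilityMeasure ν] (hν : IsTransErgodic ν) (n r L : ℕ) (δ ρ : ℝ) (hδ : 0 ≤ δ)
    (hρ : 0 ≤ ρ) (hd : ∫⁻ η, (η 0 : ℝ≥0∞) ∂ν = ENNReal.ofReal ρ)
    (hn : (ν.prod μ) (DJ 1 n)ᶜ ≤ ENNReal.ofReal δ) :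
    (2 * (L : ℝ) + 1) ^ 2 ≤ (2 * L + 1) ^ 2 * UU lam r δ + (2 * (L + (r + n)) + 1) ^ 2 * ρ := by
  haveI := hμ.1
  have hJ := lamJ_pos hl
  have hS := lamS_pos hl
  have hT := Th_pos r
  have h63 := l63_pos
  have hU : 0 ≤ UU lam r δ := by unfold UU; positivity
  set V := bx (L + (r + n)) with hV
  have hsub : bx L ⊆ V := bx_mono (by omega)
  have h1 := int_bound hl hμ hν V
  rw [hd, ← Finset.sum_sdiff hsub] at h1
  have h2 : ∑ x ∈ V \ bx L, (ν.prod μ) (NJ V x) ≤ ((V \ bx L).card : ℝ≥0∞) := by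
    rw [← nsmul_one, ← Finset.sum_const]
    exact Finset.sum_le_sum fun x _ => prob_le_one
  have h3 : ∑ x ∈ bx L, (ν.prod μ) (NJ V x) ≤ ((bx L).card : ℝ≥0∞) * ENNReal.ofReal (UU lam r δ) := by
    rw [← nsmul_eq_mul, ← Finset.sum_const]
    exact Finset.sum_le_sum fun x hx => deep_bound hl hμ hν n r L δ hδ hn x hx
  have h4 : (V.card : ℝ≥0∞) ≤ ((V \ bx L).card : ℝ≥0∞) + ((bx L).card : ℝ≥0∞) * ENNReal.ofReal (UU lam r δ)
      + V.card * ENNReal.ofReal ρ := h1.trans (by gcongr)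
  simp only [← ENNReal.ofReal_natCast] at h4
  rw [← ENNReal.ofReal_mul (by positivity), ← ENNReal.ofReal_mul (by positivity), ← ENNReal.ofReal_add (by positivity) (by positivity),
    ← ENNReal.ofReal_add (by positivity) (by positivity), ENNReal.ofReal_le_ofReal_iff (by positivity)] at h4
  have h5 : ((V \ bx L).card : ℝ) + (bx L).card = V.card := by
    exact_mod_cast Finset.card_sdiff_add_card_eq_card hsub
  have h6 : ((bx L).card : ℝ) = (2 * L + 1) ^ 2 := by rw [bx_card]; push_cast; rfl
  have h7 : (V.card : ℝ) = (2 * (L + (r + n)) + 1) ^ 2 := by rw [hV, bx_card]; push_cast; rfl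
  rw [h6] at h4 h5
  rw [h7] at h4 h5
  linarith

/-- If the system does not fixate at density `ρ` then `1 - ρ` is small. -/
lemma dens_lower {lam : ℝ} (hl : 0 < lam) {μ : Measure (Stacks 2)} (hμ : IsStackLaw 2 (ssrwStep 2) lam μ)
    {ν : Measure (Site 2 → ℕ)} [IsProbabilityMeasure ν] (hν : IsTransErgodic ν) (r : ℕ) (ρ : ℝ)
    (hρ : 0 ≤ ρ) (hd : ∫⁻ η, (η 0 : ℝ≥0∞) ∂ν = ENNReal.ofReal ρ)
    (hA : (ν.prod μ) (AJ 0) = 1) : 1 ≤ UU lam r 0 + ρ := by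
  haveI := hμ.1
  have step1 : ∀ δ : ℝ, 0 < δ → 1 ≤ UU lam r δ + ρ := by
    intro δ hδ
    obtain ⟨n, hn⟩ : ∃ n, (ν.prod μ) (DJ 1 n)ᶜ ≤ ENNReal.ofReal δ := by
      have h := tendsto_measure_iInter_atTop (μ := ν.prod μ) (s := fun n => (DJ 1 n)ᶜ)
        (fun n => (DJ_meas 1 n).compl.nullMeasurableSet)
        (fun m n h => Set.compl_subset_compl.2 (DJ_mono 1 h)) ⟨0, measure_ne_top _ _⟩
      have h0 : (ν.prod μ) (⋂ n, (DJ 1 n)ᶜ) = 0 := by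
        rw [← Set.compl_iUnion, ← DJ_iUnion]
        refine measure_mono_null (Set.compl_subset_compl.2 (show AJ 0 ⊆ GJ 1 0 from Set.iInter_subset _ 1)) ?_
        exact (prob_compl_eq_zero_iff (AJ_meas 0)).2 hA
      rw [h0] at h
      exact (h.eventually (ge_mem_nhds (by simpa using hδ))).exists
    have lim : Tendsto (fun L : ℕ => UU lam r δ + ((2 * (L + (r + n)) + 1) / (2 * (L : ℝ) + 1)) ^ 2 * ρ) atTop
        (nhds (UU lam r δ + 1 ^ 2 * ρ)) := by
      refine tendsto_const_nhds.add (Tendsto.mul_const _ (Tendsto.pow ?_ 2))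
      have e : (fun L : ℕ => (2 * (L + (r + n)) + 1) / (2 * (L : ℝ) + 1)) = fun L : ℕ => 1 + (2 * (r + n) : ℝ) / (2 * (L : ℝ) + 1) := by
        funext L
        have : (2 * (L : ℝ) + 1) ≠ 0 := by positivity
        field_simp; ring
      rw [e]
      have h2 : Tendsto (fun L : ℕ => (2 * (L : ℝ) + 1)) atTop atTop :=
        tendsto_atTop_add_const_right _ _ (tendsto_natCast_atTop_atTop.const_mul_atTop (by norm_num))
      have := (tendsto_const_nhds (x := (1:ℝ))).add ((tendsto_const_nhds (x := (2 * (r + n) : ℝ))).div_atTop h2)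
      simpa using this
    rw [one_pow, one_mul] at lim
    refine ge_of_tendsto' lim fun L => ?_
    have h := box_ineq hl hμ hν n r L δ ρ hδ.le hρ hd hn
    have hpos : 0 < (2 * (L : ℝ) + 1) ^ 2 := by positivity
    rw [div_pow]
    have e : UU lam r δ + (2 * (L + (r + n)) + 1 : ℝ) ^ 2 / (2 * (L : ℝ) + 1) ^ 2 * ρ =
      ((2 * L + 1) ^ 2 * UU lam r δ + (2 * (L + (r + n)) + 1) ^ 2 * ρ) / (2 * (L : ℝ) + 1) ^ 2 := by
      field_simp
    rw [e, le_div_iff₀ hpos, one_mul]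
    exact h
  have cont : Tendsto (fun δ => UU lam r δ + ρ) (nhdsWithin 0 (Set.Ioi 0)) (nhds (UU lam r 0 + ρ)) := by
    have : Continuous fun δ => UU lam r δ + ρ := by unfold UU; fun_prop
    exact (this.tendsto 0).mono_left nhdsWithin_le_nhds
  exact ge_of_tendsto cont (eventually_nhdsWithin_of_forall fun δ hδ => step1 δ hδ)

lemma not_fix {lam : ℝ} (hl : 0 < lam) {ν : Measure (Site 2 → ℕ)} [IsProbabilityMeasure ν]
    (hν : IsTransErgodic ν) (h : ¬ Fixates 2 (ssrwStep 2) lam ν) :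
    (ν.prod (stackLaw 2 (ssrwStep 2) lam)) (AJ 0) = 1 := by
  have hμ := stackLaw_spec hl
  haveI := hμ.1
  rcases zero_one hl hμ hν with h0 | h1
  · exfalso
    apply h
    unfold Fixates
    rw [Measure.measure_prod_null (AJ_meas 0)] at h0
    filter_upwards [h0] with η hη
    rw [ae_iff]
    refine measure_mono_null ?_ hη
    intro I hI
    simp only [ne_eq, not_not, Set.mem_setOf_eq] at hI
    exact mem_AJ_iff.2 hI
  · exact h1

end
end ARWP

open MeasureTheory ENNReal Filter
set_option linter.all false
namespace ARWP
open ARW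

noncomputable section
open scoped Classical

/-! ### Activity at very high density -/

def ff (L : ℕ) (x : Site 2) : ℝ := max (Th L - hf x) 0

lemma ff_nonneg (L : ℕ) (x : Site 2) : 0 ≤ ff L x := le_max_right _ _

lemma ff_off {L : ℕ} {x : Site 2} (h : x ∉ bx L) : ff L x = 0 := by
  have := hf_off h
  unfold ff
  exact max_eq_right (by linarith)

lemma l63_le : Real.log 63 ≤ 5 := by
  rw [Real.log_le_iff_le_exp (by norm_num)]
  have h1 : (2.7182818283 : ℝ) < Real.exp 1 := Real.exp_one_gt_d9
  have h2 : Real.exp 5 = Real.exp 1 ^ 5 := by rw [← Real.exp_nat_mul]; norm_num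
  rw [h2]
  calc (63 : ℝ) ≤ 2.7 ^ 5 := by norm_num
    _ ≤ _ := by gcongr; linarith

lemma ff_lip (L : ℕ) (x z : Site 2) (hz : z ∈ dirs) : |ff L (x + z) - ff L x| ≤ 5 := by
  have h1 := hf_step_le x z hz
  have h2 := hf_step_ge x z hz
  have h3 := l63_le
  unfold ff
  refine (abs_max_sub_max_le_abs _ _ _).trans ?_
  rw [abs_le]; constructor <;> linarith

lemma ff_sub {L : ℕ} {x : Site 2} (h : x ≠ 0) : 0 ≤ ∑ z ∈ dirs, (ff L (x + z) - ff L x) := by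
  have h1 := hf_super h
  rw [sum_dirs] at h1 ⊢
  unfold ff
  rcases le_total (Th L - hf x) 0 with h2 | h2
  · rw [max_eq_right h2]
    have := ff_nonneg L (x + ![1, 0])
    have := ff_nonneg L (x + ![-1, 0])
    have := ff_nonneg L (x + ![0, 1])
    have := ff_nonneg L (x + ![0, -1])
    unfold ff at *
    linarith
  · rw [max_eq_left h2]
    have := le_max_left (Th L - hf (x + ![1, 0])) 0
    have := le_max_left (Th L - hf (x + ![-1, 0])) 0
    have := le_max_left (Th L - hf (x + ![0, 1])) 0
    have := le_max_left (Th L - hf (x + ![0, -1])) 0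
    linarith

lemma ff_in {j : ℕ} (hj : 1 ≤ j) {x : Site 2} (h : x ∈ bx j) : 1 ≤ ff (4 * j) x := by
  have hj' : (1 : ℝ) ≤ j := by exact_mod_cast hj
  have h1 := hf_on hj h
  have h2 : Real.log (4 * (j : ℝ) ^ 2 - 1) + 1 ≤ Real.log (2 * (((4 * j : ℕ) : ℝ) + 1) ^ 2 - 1) := by
    have h3 : Real.log (4 * (j : ℝ) ^ 2 - 1) + 1 = Real.log ((4 * (j : ℝ) ^ 2 - 1) * Real.exp 1) := by
      rw [Real.log_mul (by nlinarith) (Real.exp_pos 1).ne', Real.log_exp]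
    rw [h3]
    have he := Real.exp_one_lt_d9
    have he' := Real.exp_pos 1
    refine Real.log_le_log (mul_pos (by nlinarith) he') ?_
    push_cast
    nlinarith
  unfold ff Th
  refine le_max_of_le_left ?_
  linarith

lemma sqp (D x : ℝ) (hx : |x| ≤ 10) : (max (D - x) 0) ^ 2 ≤ (max D 0) ^ 2 - 2 * max D 0 * x + 100 := by
  have h2 : x ^ 2 ≤ 100 := by
    have := sq_le_sq' (by linarith [abs_nonneg x, neg_abs_le x, le_abs_self x] : -10 ≤ x) (le_trans (le_abs_self x) hx)
    linarith
  rcases le_total D 0 with h | h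
  · rw [max_eq_right h]
    rcases le_total (D - x) 0 with h1 | h1
    · rw [max_eq_right h1]; nlinarith
    · rw [max_eq_left h1]; nlinarith
  · rw [max_eq_left h]
    rcases le_total (D - x) 0 with h1 | h1
    · rw [max_eq_right h1]; nlinarith [sq_nonneg (D - x)]
    · rw [max_eq_left h1]; nlinarith

def DD (L : ℕ) (A : ℝ) (s : State 2) : ℝ := A - Mass (bx L) (ff L) s - 5 * (s.2 0 : ℝ)

def RR (L : ℕ) : ℝ := ((L : ℝ) + 1) ^ 2

lemma RR_ok (L : ℕ) : ∀ x ∈ bx L, ∀ z ∈ dirs, 0 ≤ quad (RR L) (x + z) := by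
  intro x hx z hz
  have h := mem_bx.1 hx 0
  have h2 : -((L : ℤ) + 1) ≤ (x + z) 0 ∧ (x + z) 0 ≤ (L : ℤ) + 1 := by
    simp only [dirs, Finset.mem_insert, Finset.mem_singleton] at hz
    rcases hz with rfl | rfl | rfl | rfl <;> simp <;> omega
  have h3 : ((x + z) 0) ^ 2 ≤ ((L : ℤ) + 1) ^ 2 := sq_le_sq' h2.1 h2.2
  have h4 : (((x + z) 0 : ℤ) : ℝ) ^ 2 ≤ ((L : ℝ) + 1) ^ 2 := by exact_mod_cast h3
  unfold quad RR
  linarith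

def QQ (lam : ℝ) (L : ℕ) (A : ℝ) (s : State 2) : ℝ :=
  (max (DD L A s) 0) ^ 2 + 200 / lamJ lam * Mass (bx L) (quad (RR L)) s

lemma lamJ_le {lam : ℝ} (h : 0 < lam) : lamJ lam ≤ 1 := by
  have := lam_sum h; have := lamS_pos h; linarith

lemma QQ_step {lam : ℝ} (h : 0 < lam) (L : ℕ) (A : ℝ) (s : State 2) (x : Site 2) (hx : x ∈ bx L)
    (ha : 1 ≤ numActive (s.1 x)) : avg lam (fun a => QQ lam L A (toppleA (bx L) x a s)) ≤ QQ lam L A s := by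
  have hJ := lamJ_pos h
  have hJ1 := lamJ_le h
  unfold QQ
  rw [avg_add, avg_smul]
  have h1 := avg_quad h (RR_ok L) s x hx ha
  set M := Mass (bx L) (ff L) s with hM
  obtain ⟨i, hi⟩ : ∃ i : ℝ, i = if x = 0 then 1 else 0 := ⟨_, rfl⟩
  have hi0 : 0 ≤ i := by rw [hi]; split_ifs <;> norm_num
  have hi1 : i ≤ 1 := by rw [hi]; split_ifs <;> norm_num
  set D := DD L A s with hD
  have hDD : ∀ a, DD L A (toppleA (bx L) x a s) = D - (Mass (bx L) (ff L) (toppleA (bx L) x a s) - M + 5 * i) := by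
    intro a
    rw [hD]
    unfold DD
    rw [toppleA_snd, Function.update_apply]
    by_cases h0 : x = 0
    · subst h0; simp at hi; subst hi; simp; ring
    · rw [if_neg h0] at hi; rw [if_neg (Ne.symm h0), hi]; ring
  have e0 : Mass (bx L) (ff L) (toppleA (bx L) x none s) = M := mass_none ..
  have e1 : ∀ z, Mass (bx L) (ff L) (toppleA (bx L) x (some z) s) = M + (ff L (x + z) - ff L x) := by
    intro z
    rw [mass_some _ _ _ _ _ hx ha]
    split_ifs with h2
    · ring
    · rw [ff_off h2]; ring
  have h2 : avg lam (fun a => (max (DD L A (toppleA (bx L) x a s)) 0) ^ 2) ≤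
      avg lam (fun a => ((max D 0) ^ 2 + 2 * max D 0 * (M - 5 * i) + 100) +
        (-2 * max D 0) * Mass (bx L) (ff L) (toppleA (bx L) x a s)) := by
    refine avg_mono h ?_ ?_
    · have := sqp D (Mass (bx L) (ff L) (toppleA (bx L) x none s) - M + 5 * i) (by
        rw [e0, abs_le]; constructor <;> linarith)
      rw [hDD]
      linarith
    · intro z hz
      have h4 := abs_le.1 (ff_lip L x z hz)
      have := sqp D (Mass (bx L) (ff L) (toppleA (bx L) x (some z) s) - M + 5 * i) (by
        rw [e1, abs_le]; constructor <;> linarith)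
      rw [hDD]
      linarith
  rw [avg_add, avg_smul, avg_const h] at h2
  have h3 : M - 5 * i ≤ avg lam (fun a => Mass (bx L) (ff L) (toppleA (bx L) x a s)) := by
    rw [avg_mass h _ _ _ hx ha]
    have e2 : ∑ z ∈ dirs, ((if x + z ∈ bx L then ff L (x + z) else 0) - ff L x) = ∑ z ∈ dirs, (ff L (x + z) - ff L x) := by
      refine Finset.sum_congr rfl fun z _ => ?_
      split_ifs with h2
      · rfl
      · rw [ff_off h2]
    rw [e2]
    by_cases h0 : x = 0
    · have hs : ∑ z ∈ dirs, (-5 : ℝ) ≤ ∑ z ∈ dirs, (ff L (x + z) - ff L x) :=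
        Finset.sum_le_sum fun z hz => (abs_le.1 (ff_lip L x z hz)).1
      rw [sum_dirs (fun _ => (-5 : ℝ))] at hs
      rw [hi, if_pos h0]
      have : lamJ lam / 4 * (-20) ≤ lamJ lam / 4 * ∑ z ∈ dirs, (ff L (x + z) - ff L x) :=
        mul_le_mul_of_nonneg_left (by linarith) (by positivity)
      linarith
    · have := ff_sub (L := L) h0
      rw [hi, if_neg h0]
      have : 0 ≤ lamJ lam / 4 * ∑ z ∈ dirs, (ff L (x + z) - ff L x) := by positivity
      linarith
  have h5 : 0 ≤ max D 0 := le_max_right _ _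
  have h6 := mul_le_mul_of_nonneg_left h3 h5
  have h7 : 200 / lamJ lam * avg lam (fun a => Mass (bx L) (quad (RR L)) (toppleA (bx L) x a s)) ≤
      200 / lamJ lam * Mass (bx L) (quad (RR L)) s - 100 := by
    have := mul_le_mul_of_nonneg_left h1 (by positivity : 0 ≤ 200 / lamJ lam)
    refine this.trans (le_of_eq ?_)
    field_simp
    ring
  linarith

lemma mass_stable {V : Finset (Site 2)} {f : Site 2 → ℝ} (hf : ∀ x, 0 ≤ f x) {s : State 2} (h : Stable V s.1) :
    Mass V f s ≤ ∑ x ∈ V, f x := by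
  refine Finset.sum_le_sum fun x hx => ?_
  have h1 := h x hx
  have h2 : cnt (s.1 x) ≤ 1 := by
    cases hs : s.1 x with
    | active n => rw [hs] at h1; simp [numActive] at h1; simp [cnt, h1]
    | sleeping => simp [cnt]
  have h3 : (cnt (s.1 x) : ℝ) ≤ 1 := by exact_mod_cast h2
  nlinarith [hf x]

def quiet (L K : ℕ) : Set (Unit × State 2) := {c | (topp (bx L)).pick c.1 c.2 = none ∧ c.2.2 0 < K}

lemma quiet_prob {lam : ℝ} (h : 0 < lam) (n : ℕ) (hn : 2 ≤ n) (hnl : 3240000 * (1 + lam) ≤ n) (K : ℕ)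
    (j : ℕ) (hj : 1 ≤ j) (hK : 5 * K ≤ j ^ 2) (η : Site 2 → ℕ) (h1 : ∀ x, n ≤ η x) (h2 : ∀ x, η x ≤ n + 1) (N : ℕ) :
    (topp (bx (4 * j))).E lam ((quiet (4 * j) K).indicator 1) N ((), initState 2 (bx (4 * j)) η) ≤ 1 / 4 := by
  have hJ := lamJ_pos h
  set L := 4 * j with hL
  set s0 := initState 2 (bx L) η with hs0
  set A := Mass (bx L) (ff L) s0 with hA
  have hn' : (2 : ℝ) ≤ n := by exact_mod_cast hn
  have hj' : (1 : ℝ) ≤ j := by exact_mod_cast hj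
  have hK' : 5 * (K : ℝ) ≤ (j : ℝ) ^ 2 := by exact_mod_cast hK
  set F := ∑ x ∈ bx L, ff L x with hF
  have F_ge : 4 * (j : ℝ) ^ 2 ≤ F := by
    calc 4 * (j : ℝ) ^ 2 ≤ ((bx j).card : ℝ) := by rw [bx_card]; push_cast; nlinarith
      _ = ∑ x ∈ bx j, (1 : ℝ) := by simp
      _ ≤ ∑ x ∈ bx j, ff L x := Finset.sum_le_sum fun x hx => ff_in hj hx
      _ ≤ F := Finset.sum_le_sum_of_subset_of_nonneg (bx_mono (by omega)) fun x _ _ => ff_nonneg L x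
  have A_ge : n * F ≤ A := by
    rw [hA, mass_init, hF, Finset.mul_sum]
    refine Finset.sum_le_sum fun x _ => ?_
    have : (n : ℝ) ≤ η x := by exact_mod_cast h1 x
    exact mul_le_mul_of_nonneg_right this (ff_nonneg L x)
  have qn : ∀ s, 0 ≤ Mass (bx L) (quad (RR L)) s := fun s => mass_nonneg _ _ (quad_nonneg_of (RR_ok L)) s
  set t : ℝ := (n * (j : ℝ) ^ 2) ^ 2 with ht
  have tpos : 0 < t := by positivity
  have mk : ∀ c : Unit × State 2, t * (quiet L K).indicator (1 : Unit × State 2 → ℝ) c ≤ QQ lam L A c.2 := by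
    intro c
    have hq : 0 ≤ 200 / lamJ lam * Mass (bx L) (quad (RR L)) c.2 := mul_nonneg (by positivity) (qn _)
    by_cases hc : c ∈ quiet L K
    · rw [Set.indicator_of_mem hc]
      have hst := topp_none hc.1
      have hM := mass_stable (ff_nonneg L) hst
      have hk : (c.2.2 0 : ℝ) ≤ K := by exact_mod_cast hc.2.le
      have hD : n * (j : ℝ) ^ 2 ≤ DD L A c.2 := by
        unfold DD
        nlinarith
      have hD2 : n * (j : ℝ) ^ 2 ≤ max (DD L A c.2) 0 := le_max_of_le_left hD
      have : t ≤ (max (DD L A c.2) 0) ^ 2 := pow_le_pow_left₀ (by positivity) hD2 2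
      unfold QQ
      simp only [Pi.one_apply, mul_one]
      linarith
    · rw [Set.indicator_of_notMem hc, mul_zero]
      unfold QQ
      positivity
  have e1 : t * (topp (bx L)).E lam ((quiet L K).indicator 1) N ((), s0) ≤ QQ lam L A s0 := by
    rw [← Proc.E_smul]
    refine ((topp (bx L)).E_mono h mk N _).trans ?_
    refine (topp (bx L)).E_le h (fun c => QQ lam L A c.2) ?_ N ((), s0)
    intro c x hp
    obtain ⟨hx, ha⟩ := (topp (bx L)).legal _ _ _ hp
    exact QQ_step h L A c.2 x hx ha
  have e2 : QQ lam L A s0 ≤ 200 / lamJ lam * (4050 * n * (j : ℝ) ^ 4) := by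
    have hD0 : DD L A s0 = 0 := by
      unfold DD
      have : s0.2 0 = 0 := rfl
      rw [this, ← hA]; simp
    unfold QQ
    rw [hD0]
    have hm : Mass (bx L) (quad (RR L)) s0 ≤ 4050 * n * (j : ℝ) ^ 4 := by
      rw [mass_init]
      calc ∑ x ∈ bx L, (η x : ℝ) * quad (RR L) x ≤ ∑ x ∈ bx L, (n + 1 : ℝ) * RR L := by
            refine Finset.sum_le_sum fun x hx => ?_
            have a1 : (η x : ℝ) ≤ n + 1 := by exact_mod_cast h2 x
            have a2 := quad_nonneg_of (RR_ok L) x hx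
            have a3 : quad (RR L) x ≤ RR L := by unfold quad; nlinarith [sq_nonneg (x 0 : ℝ)]
            gcongr
        _ = (8 * j + 1) ^ 2 * ((n + 1) * (4 * j + 1) ^ 2) := by
            rw [Finset.sum_const, bx_card, nsmul_eq_mul, RR, hL]; push_cast; ring
        _ ≤ (9 * j) ^ 2 * ((2 * n) * (5 * j) ^ 2) := by
            gcongr <;> linarith
        _ = 4050 * n * (j : ℝ) ^ 4 := by ring
    have := mul_le_mul_of_nonneg_left hm (by positivity : 0 ≤ 200 / lamJ lam)
    simp
    linarith
  have e3 : 200 / lamJ lam * (4050 * n * (j : ℝ) ^ 4) ≤ t * (1 / 4) := by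
    have : 200 / lamJ lam = 200 * (1 + lam) := by unfold lamJ; field_simp
    rw [this, ht]
    have : 200 * (1 + lam) * (4050 * n * (j : ℝ) ^ 4) = (3240000 * (1 + lam)) * (n * (j : ℝ) ^ 4) * (1/4) := by ring
    rw [this]
    have : (n * (j : ℝ) ^ 2) ^ 2 = n * (n * (j : ℝ) ^ 4) := by ring
    rw [this]
    gcongr
  exact le_of_mul_le_mul_left (e1.trans (e2.trans e3)) tpos

lemma active_half {lam : ℝ} (h : 0 < lam) {μ : Measure (Stacks 2)} (hμ : IsStackLaw 2 (ssrwStep 2) lam μ)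
    (n : ℕ) (hn : 2 ≤ n) (hnl : 3240000 * (1 + lam) ≤ n)
    (η : Site 2 → ℕ) (h1 : ∀ x, n ≤ η x) (h2 : ∀ x, η x ≤ n + 1) : pA μ η ≠ 0 := by
  haveI := hμ.1
  have key : ∀ K, ENNReal.ofReal (1 / 2) ≤ μ {I | (η, I) ∈ GJ K 0} := by
    intro K
    obtain ⟨j, hj, hK⟩ : ∃ j : ℕ, 1 ≤ j ∧ 5 * K ≤ j ^ 2 := ⟨5 * K + 1, by omega, by nlinarith⟩
    set L := 4 * j with hL
    set c0 : Unit × State 2 := ((), initState 2 (bx L) η) with hc0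
    have ht := (topp (bx L)).term h hμ c0
    obtain ⟨N, hN⟩ := (ht.eventually (ge_mem_nhds (show (0 : ℝ≥0∞) < ENNReal.ofReal (1/4) by simp))).exists
    have hq := (topp (bx L)).exec_law h hμ (quiet L K) N c0
    have hq2 : μ {I | (topp (bx L)).exec I N c0 ∈ quiet L K} ≤ ENNReal.ofReal (1/4) := by
      rw [hq]; exact ENNReal.ofReal_le_ofReal (quiet_prob h n hn hnl K j hj hK η h1 h2 N)
    have hcov : (Set.univ : Set (Stacks 2)) ⊆ {I | (η, I) ∈ GJ K 0} ∪
        ({I | (topp (bx L)).pick ((topp (bx L)).exec I N c0).1 ((topp (bx L)).exec I N c0).2 ≠ none} ∪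
        {I | (topp (bx L)).exec I N c0 ∈ quiet L K}) := by
      intro I _
      by_cases a1 : (topp (bx L)).pick ((topp (bx L)).exec I N c0).1 ((topp (bx L)).exec I N c0).2 = none
      · by_cases a2 : ((topp (bx L)).exec I N c0).2.2 0 < K
        · exact Or.inr (Or.inr ⟨a1, a2⟩)
        · left
          obtain ⟨l, b1, b2, -⟩ := (topp (bx L)).exec_run I N c0
          refine mem_GJ.2 ⟨bx L, l, b1, ?_⟩
          rw [b2, run_snd] at a2
          have : c0.2.2 0 = 0 := rfl
          omega
      · exact Or.inr (Or.inl a1)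
    have h3 : (1 : ℝ≥0∞) ≤ μ {I | (η, I) ∈ GJ K 0} + (ENNReal.ofReal (1/4) + ENNReal.ofReal (1/4)) := by
      rw [← measure_univ (μ := μ)]
      refine (measure_mono hcov).trans ((measure_union_le _ _).trans (add_le_add le_rfl ?_))
      exact (measure_union_le _ _).trans (add_le_add hN hq2)
    rw [← ENNReal.ofReal_add (by norm_num) (by norm_num)] at h3
    have h4 : ENNReal.ofReal (1/2) + ENNReal.ofReal (1/4 + 1/4) ≤ μ {I | (η, I) ∈ GJ K 0} + ENNReal.ofReal (1/4 + 1/4) := by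
      refine le_trans (le_of_eq ?_) h3
      rw [← ENNReal.ofReal_add (by norm_num) (by norm_num)]; norm_num
    exact (ENNReal.add_le_add_iff_right ENNReal.ofReal_ne_top).1 h4
  have hlim := tendsto_measure_iInter_atTop (μ := μ) (s := fun K => {I | (η, I) ∈ GJ K 0})
    (fun K => (measurable_prodMk_left (GJ_meas K 0) : MeasurableSet {I | (η, I) ∈ GJ K 0}).nullMeasurableSet)
    (fun m n h I hI => GJ_anti 0 h hI) ⟨0, measure_ne_top _ _⟩
  have e : ⋂ K, {I | (η, I) ∈ GJ K 0} = {I | (η, I) ∈ AJ 0} := by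
    ext I; simp [AJ]
  rw [e] at hlim
  have := ge_of_tendsto' hlim key
  intro h0
  have h0' : μ {I | (η, I) ∈ AJ 0} = 0 := h0
  rw [h0'] at this
  norm_num at this

end
end ARWP

open MeasureTheory ENNReal Filter
set_option linter.all false
namespace ARWP
open ARW
noncomputable section
open scoped Classical

def rotA : UnitAddCircle := ((Real.sqrt 2 : ℝ) : UnitAddCircle)

lemma rotA_erg : Ergodic (fun θ : UnitAddCircle => rotA + θ) := by
  rw [AddCircle.ergodic_add_left, ← AddCircle.denseRange_zsmul_iff, rotA,
    AddCircle.denseRange_zsmul_coe_iff]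
  simpa using irrational_sqrt_two

def rotEta (n : ℕ) (t : ℝ) (θ : UnitAddCircle) : Site 2 → ℕ :=
  fun x => n + (Metric.closedBall (0 : UnitAddCircle) (t / 2)).indicator (fun _ => 1) ((x 0) • rotA + θ)

lemma rotEta_meas (n : ℕ) (t : ℝ) : Measurable (rotEta n t) := by
  refine measurable_pi_lambda _ fun x => ?_
  unfold rotEta
  refine Measurable.const_add ?_ n
  have h1 : Measurable ((Metric.closedBall (0 : UnitAddCircle) (t / 2)).indicator (fun _ => (1:ℕ))) :=
    measurable_const.indicator Metric.isClosed_closedBall.measurableSet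
  exact h1.comp (measurable_const_add _)

lemma rotEta_shift (n : ℕ) (t : ℝ) (z : Site 2) (θ : UnitAddCircle) :
    shift z (rotEta n t θ) = rotEta n t ((z 0) • rotA + θ) := by
  funext x
  simp only [shift, rotEta, Pi.add_apply, add_smul, add_assoc]

lemma exists_erg (ρ : ℝ) (hρ : 0 ≤ ρ) : ∃ ν : Measure (Site 2 → ℕ), IsProbabilityMeasure ν ∧ IsTransErgodic ν ∧
    (∫⁻ η, (η 0 : ℝ≥0∞) ∂ν) = ENNReal.ofReal ρ ∧
    ∀ᵐ η ∂ν, (∀ x, ⌊ρ⌋₊ ≤ η x) ∧ (∀ x, η x ≤ ⌊ρ⌋₊ + 1) := by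
  set n := ⌊ρ⌋₊ with hn
  set t := ρ - n with ht
  have ht0 : 0 ≤ t := by have := Nat.floor_le hρ; rw [← hn] at this; linarith
  have ht1 : t ≤ 1 := by have := Nat.lt_floor_add_one ρ; rw [← hn] at this; linarith
  haveI : IsProbabilityMeasure (volume : Measure UnitAddCircle) := ⟨UnitAddCircle.measure_univ⟩
  have hm := rotEta_meas n t
  refine ⟨(volume : Measure UnitAddCircle).map (rotEta n t), Measure.isProbabilityMeasure_map hm.aemeasurable, ⟨?_, ?_⟩, ?_, ?_⟩
  · intro z
    rw [Measure.map_map (shift_meas z) hm]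
    have : shift z ∘ rotEta n t = rotEta n t ∘ (fun θ => (z 0) • rotA + θ) := by
      funext θ; exact rotEta_shift n t z θ
    rw [this, ← Measure.map_map hm (measurable_const_add _), map_add_left_eq_self]
  · intro s hs hinv
    rw [Measure.map_apply hm hs]
    have h1 : (fun θ : UnitAddCircle => rotA + θ) ⁻¹' (rotEta n t ⁻¹' s) = rotEta n t ⁻¹' s := by
      ext θ
      have h2 := rotEta_shift n t (fun _ => 1) θ
      simp only [one_smul] at h2
      rw [Set.mem_preimage, Set.mem_preimage, ← h2]
      have := hinv (fun _ => 1)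
      conv_rhs => rw [Set.mem_preimage, ← this]
      rfl
    exact rotA_erg.toPreErgodic.prob_eq_zero_or_one (hm hs) h1
  · have hc : Measurable (fun η : Site 2 → ℕ => (η 0 : ℝ≥0∞)) :=
      (measurable_of_countable (fun k : ℕ => (k : ℝ≥0∞))).comp (measurable_pi_apply 0)
    rw [lintegral_map hc hm]
    have : ∀ θ : UnitAddCircle, ((rotEta n t θ 0 : ℕ) : ℝ≥0∞) =
        n + (Metric.closedBall (0 : UnitAddCircle) (t / 2)).indicator (fun _ => 1) θ := by
      intro θ
      simp only [rotEta, Pi.zero_apply, zero_smul, zero_add, Set.indicator]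
      split_ifs <;> simp
    simp_rw [this]
    rw [lintegral_add_left measurable_const]
    rw [lintegral_indicator_const Metric.isClosed_closedBall.measurableSet, AddCircle.volume_closedBall]
    rw [lintegral_const, measure_univ, mul_one, one_mul, show 2 * (t / 2) = t by ring, min_eq_right ht1,
      ← ENNReal.ofReal_natCast, ← ENNReal.ofReal_add (by positivity) ht0]
    congr 1; rw [ht]; ring
  · rw [ae_map_iff hm.aemeasurable]
    · refine Eventually.of_forall fun θ => ⟨fun x => by simp [rotEta], fun x => ?_⟩
      simp only [rotEta, Set.indicator]; split_ifs <;> simp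
    · have : {η : Site 2 → ℕ | (∀ x, n ≤ η x) ∧ ∀ x, η x ≤ n + 1} =
        (⋂ x, {η | n ≤ η x}) ∩ ⋂ x, {η | η x ≤ n + 1} := by ext; simp
      rw [this]
      exact (MeasurableSet.iInter fun x => measurableSet_le measurable_const (measurable_pi_apply x)).inter
        (MeasurableSet.iInter fun x => measurableSet_le (measurable_pi_apply x) measurable_const)

lemma crit_bdd {lam : ℝ} (hl : 0 < lam) : BddAbove {ρ : ℝ | 0 ≤ ρ ∧
    ∀ ν : Measure (Site 2 → ℕ), IsProbabilityMeasure ν → IsTransErgodic ν →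
      (∫⁻ η, (η 0 : ℝ≥0∞) ∂ν) = ENNReal.ofReal ρ → Fixates 2 (ssrwStep 2) lam ν} := by
  refine ⟨3240000 * (1 + lam) + 1, ?_⟩
  rintro ρ ⟨h0, hρ⟩
  by_contra hc
  push Not at hc
  obtain ⟨ν, h1, h2, h3, h4⟩ := exists_erg ρ h0
  have hf := hρ ν h1 h2 h3
  have hμ := stackLaw_spec hl
  unfold Fixates at hf
  obtain ⟨η, ha, hb, hc2⟩ := (hf.and h4).exists
  have hfl := Nat.lt_floor_add_one ρ
  have hnl : 3240000 * (1 + lam) ≤ (⌊ρ⌋₊ : ℝ) := by linarith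
  have hn : 2 ≤ ⌊ρ⌋₊ := by
    have : (2 : ℝ) ≤ (⌊ρ⌋₊ : ℝ) := by linarith
    exact_mod_cast this
  refine active_half hl hμ _ hn hnl η hb hc2 ?_
  unfold pA
  rw [ae_iff] at ha
  rw [← ha]
  congr 1
  ext I
  rw [Set.mem_setOf_eq, mem_AJ_iff]
  simp

lemma UU_bound {lam : ℝ} (hl : 100 ≤ lam) : ∃ r : ℕ, UU lam r 0 < 100 / (lam * Real.log lam) := by
  set s := Real.sqrt (Real.sqrt lam) with hs
  have hs2 : s ^ 2 = Real.sqrt lam := Real.sq_sqrt (Real.sqrt_nonneg _)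
  have hs4 : s ^ 4 = lam := by
    rw [show s ^ 4 = (s ^ 2) ^ 2 by ring, hs2, Real.sq_sqrt (by linarith)]
  have hs0 : 0 ≤ s := Real.sqrt_nonneg _
  have hs1 : 1 < s := by
    by_contra h
    push Not at h
    have : s ^ 4 ≤ 1 := pow_le_one₀ hs0 h
    linarith
  have hlogs : 0 < Real.log s := Real.log_pos hs1
  have hlog : Real.log lam = 4 * Real.log s := by rw [← hs4, Real.log_pow]; norm_num
  have hlog_le : Real.log s ≤ s := (Real.log_le_sub_one_of_pos (by linarith)).trans (by linarith)
  have hlog2 : 2 * Real.log s ≤ s ^ 2 := by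
    have := Real.log_le_sub_one_of_pos (show 0 < s ^ 2 by positivity)
    rw [Real.log_pow] at this
    push_cast at this
    linarith
  refine ⟨⌊s⌋₊, ?_⟩
  set r := ⌊s⌋₊ with hr
  have hr1 : (r : ℝ) ≤ s := Nat.floor_le hs0
  have hr2 : s < r + 1 := Nat.lt_floor_add_one s
  have hTh : 2 * Real.log s ≤ Th r := by
    unfold Th
    have h1 : Real.log (s ^ 2) ≤ Real.log (2 * ((r : ℝ) + 1) ^ 2 - 1) := by
      apply Real.log_le_log (by positivity)
      nlinarith
    rw [Real.log_pow] at h1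
    push_cast at h1
    linarith [l63_pos]
  have hq : Real.log 63 / Th r ≤ 5 / (2 * Real.log s) := by
    have := l63_le
    have := l63_pos
    gcongr
  have hJ : lamJ lam ≤ 1 / lam := by unfold lamJ; gcongr <;> linarith
  have hJ0 : 0 < lamJ lam := lamJ_pos (by linarith)
  have hJS : lamJ lam / lamS lam = 1 / lam := by
    unfold lamJ lamS; field_simp
  have hJ1 : lamJ lam + 1 ≤ 2 := by have := lamJ_le (show 0 < lam by linarith); linarith
  have h9 : (2 * (r : ℝ) + 1) ^ 2 ≤ 9 * s ^ 2 := by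
    have : 2 * (r : ℝ) + 1 ≤ 3 * s := by linarith
    calc (2 * (r : ℝ) + 1) ^ 2 ≤ (3 * s) ^ 2 := by gcongr
      _ = _ := by ring
  unfold UU
  rw [hJS, zero_add, zero_add]
  have hq0 : 0 ≤ Real.log 63 / Th r := div_nonneg l63_pos.le (Th_pos r).le
  calc lamJ lam * (lamJ lam + Real.log 63 / Th r) + 1 / lam * ((2 * (r:ℝ) + 1) ^ 2 * (lamJ lam * (lamJ lam + 1)))
      ≤ 1 / lam * (1 / lam + 5 / (2 * Real.log s)) + 1 / lam * (9 * s ^ 2 * (1 / lam * 2)) := by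
        gcongr
    _ < 100 / (lam * Real.log lam) := by
        rw [hlog, ← hs4]
        have e : 1 / s ^ 4 * (1 / s ^ 4 + 5 / (2 * Real.log s)) + 1 / s ^ 4 * (9 * s ^ 2 * (1 / s ^ 4 * 2))
          = (4 * Real.log s / s ^ 4 + 10 + 72 * Real.log s / s ^ 2) / (s ^ 4 * (4 * Real.log s)) := by
          field_simp
          ring
        rw [e]
        apply div_lt_div_of_pos_right _ (by positivity)
        have a1 : 72 * Real.log s / s ^ 2 ≤ 36 := by
          rw [div_le_iff₀ (by positivity)]; linarith
        have a2 : 4 * Real.log s / s ^ 4 ≤ 2 := by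
          rw [div_le_iff₀ (by positivity)]
          nlinarith [one_le_pow₀ hs1.le (n := 2)]
        linarith

lemma main_bound {lam : ℝ} (hl : 100 ≤ lam) :
    1 - critDensity 2 (ssrwStep 2) lam ≤ 100 / (lam * Real.log lam) := by
  have hl0 : 0 < lam := by linarith
  obtain ⟨r, hr⟩ := UU_bound hl
  have hlog : 1 ≤ Real.log lam := by
    rw [Real.le_log_iff_exp_le hl0]
    have := Real.exp_one_lt_d9
    linarith
  have hρ0 : 0 ≤ 1 - 100 / (lam * Real.log lam) := by
    rw [sub_nonneg, div_le_one (by positivity)]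
    nlinarith
  suffices h : 1 - 100 / (lam * Real.log lam) ≤ critDensity 2 (ssrwStep 2) lam by linarith
  unfold critDensity
  refine le_csSup (crit_bdd hl0) ⟨hρ0, ?_⟩
  intro ν hν1 hν2 hd
  by_contra hc
  have h1 := not_fix hl0 hν2 hc
  have h2 := dens_lower hl0 (stackLaw_spec hl0) hν2 r _ hρ0 hd h1
  linarith

end
end ARWP

open MeasureTheory ENNReal Filter Topology ARW

theorem arw_high_sleep_dim2_lower :
    ∃ C > (0 : ℝ), ∃ lam₀ > (1 : ℝ), ∀ lam ≥ lam₀,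
      1 - critDensity 2 (ssrwStep 2) lam ≤ C / (lam * Real.log lam) := by
  refine ⟨100, by norm_num, 100, by norm_num, fun lam hl => ARWP.main_bound hl⟩
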